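/- There is a constant C depending only on b, c_+, c_- (and independent of p and U) such that for all 1<p≤2 and every nonempty U⊂(0,∞), ‖𝓜^U‖_{L^p→L^p} ≤ C Σ_{ℓ≥1} θ_{p,ℓ} 𝒦_p(U,2^{-ℓ}). -/

import Mathlib

open MeasureTheory Filter Set Topology
open scoped ENNReal NNReal Topology Classical

noncomputable section

/-- The homogeneous curve of degree `b`: `γ_b(t) = c₊ t^b` for `t > 0`,
`γ_b(t) = c₋ (-t)^b` for `t < 0`, `γ_b(0) = 0`. -/
def curve (b cp cm t : ℝ) : ℝ :=
  if 0 < t then cp * t ^ b else if t < 0 then cm * (-t) ^ b else 0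

/-- The maximal function along the curve `(t, u γ_b(t))`. -/
def Mu (b cp cm u : ℝ) (f : ℝ × ℝ → ℝ) (x : ℝ × ℝ) : ℝ :=
  ⨆ R : {R : ℝ // 0 < R},
    ((R : ℝ))⁻¹ * ∫ t in (0:ℝ)..(R : ℝ), |f (x - (t, u * curve b cp cm t))|

/-- The maximal function `𝓜^U f = sup_{u ∈ U} M^{(u)} f`. -/
def calM (b cp cm : ℝ) (U : Set ℝ) (f : ℝ × ℝ → ℝ) (x : ℝ × ℝ) : ℝ :=
  ⨆ u : U, Mu b cp cm (u : ℝ) f x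

/-- The Hilbert transform along the curve `(t, u γ_b(t))` (principal value). -/
def Hu (b cp cm u : ℝ) (f : ℝ × ℝ → ℝ) (x : ℝ × ℝ) : ℝ :=
  limUnder (𝓝[>] (0:ℝ)) fun ε : ℝ =>
    ∫ t in {t : ℝ | ε < |t| ∧ |t| < ε⁻¹}, f (x - (t, u * curve b cp cm t)) / t

/-- The maximal function `𝓗^U f = sup_{u ∈ U} |H^{(u)} f|`, valued in `ℝ≥0∞`. -/
def calH (b cp cm : ℝ) (U : Set ℝ) (f : ℝ × ℝ → ℝ) (x : ℝ × ℝ) : ℝ≥0∞ :=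
  ⨆ u : U, ENNReal.ofReal |Hu b cp cm (u : ℝ) f x|

/-- The `L^p` norm of an `ℝ≥0∞`-valued function on `ℝ²`. -/
def lpN (g : ℝ × ℝ → ℝ≥0∞) (p : ℝ) : ℝ≥0∞ :=
  (∫⁻ x : ℝ × ℝ, g x ^ p) ^ (1 / p)

def eN (p : ℝ) : ℝ≥0∞ := ENNReal.ofReal p

/-- `U^r = r⁻¹ U ∩ [1,2] = {ρ ∈ [1,2] : rρ ∈ U}`. -/
def UrSet (U : Set ℝ) (r : ℝ) : Set ℝ := {ρ : ℝ | ρ ∈ Icc (1:ℝ) 2 ∧ r * ρ ∈ U}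

/-- `N(A,δ)`: minimal number of intervals of length `δ` needed to cover `A`. -/
def covN (A : Set ℝ) (δ : ℝ) : ℕ :=
  sInf {n : ℕ | ∃ F : Finset ℝ, F.card = n ∧ A ⊆ ⋃ a ∈ F, Icc a (a + δ)}

/-- `𝒦_p(U,δ) = δ^{1-1/p} sup_{r>0} N(U^r,δ)^{1/p}`. -/
def Kp (U : Set ℝ) (δ p : ℝ) : ℝ :=
  δ ^ (1 - 1 / p) * ⨆ r : {r : ℝ // 0 < r}, ((covN (UrSet U (r : ℝ)) δ : ℝ)) ^ (1 / p)

/-- `p_cr(U) = 1 + limsup_{δ→0+} sup_{r>0} log N(U^r,δ) / log(1/δ)`. -/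
def pcr (U : Set ℝ) : ℝ :=
  1 + limsup (fun δ : ℝ =>
      (⨆ r : {r : ℝ // 0 < r}, Real.log (covN (UrSet U (r : ℝ)) δ)) / Real.log δ⁻¹)
    (𝓝[>] (0:ℝ))

/-- `𝔑(U) = 1 + #{n ∈ ℤ : [2ⁿ, 2ⁿ⁺¹] ∩ U ≠ ∅}`. -/
def frakN (U : Set ℝ) : ℕ∞ :=
  1 + Set.encard {n : ℤ | (Icc ((2:ℝ) ^ n) ((2:ℝ) ^ (n + 1)) ∩ U).Nonempty}

/-- `√(log 𝔑(U))`, valued in `ℝ≥0∞` (equal to `∞` if `𝔑(U) = ∞`). -/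
def sqrtLogN (U : Set ℝ) : ℝ≥0∞ :=
  if frakN U = ⊤ then ⊤
  else ENNReal.ofReal (Real.sqrt (Real.log ((frakN U).toNat : ℝ)))

/-- The `L^p → L^p` operator norm of `𝓜^U` (smallest admissible constant, possibly `∞`). -/
def opNormM (b cp cm : ℝ) (U : Set ℝ) (p : ℝ) : ℝ≥0∞ :=
  sInf {C : ℝ≥0∞ | ∀ f : SchwartzMap (ℝ × ℝ) ℝ,
    eLpNorm (calM b cp cm U ⇑f) (eN p) volume ≤ C * eLpNorm ⇑f (eN p) volume}

/-- The `L^p → L^p` operator norm of `𝓗^U` (smallest admissible constant, possibly `∞`). -/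
def opNormH (b cp cm : ℝ) (U : Set ℝ) (p : ℝ) : ℝ≥0∞ :=
  sInf {C : ℝ≥0∞ | ∀ f : SchwartzMap (ℝ × ℝ) ℝ,
    lpN (calH b cp cm U ⇑f) p ≤ C * eLpNorm ⇑f (eN p) volume}

/-- `θ_{p,ℓ}`. -/
def theta (p : ℝ) (l : ℕ) : ℝ :=
  if (l : ℝ) ≤ (p - 1)⁻¹ then (p - 1) ^ (3 - 10 / p) else (l : ℝ) ^ (7 * (2 / p - 1))

/-- `Σ_{ℓ≥1} θ_{p,ℓ} 𝒦_p(U, 2^{-ℓ})`, valued in `ℝ≥0∞`. -/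
def KpSum (U : Set ℝ) (p : ℝ) : ℝ≥0∞ :=
  ∑' l : ℕ, ENNReal.ofReal (theta p (l + 1) * Kp U ((2:ℝ) ^ (-((l : ℝ) + 1))) p)

/-! ### Convolution with a finite measure -/

/-- A strongly measurable bounded function. -/
def BM {α E : Type*} [MeasurableSpace α] [NormedAddCommGroup E] (f : α → E) : Prop :=
  StronglyMeasurable f ∧ ∃ C : ℝ, ∀ x, ‖f x‖ ≤ C

/-- Convolution of a vector-valued function with a measure. -/
def conv {G E : Type*} [AddCommGroup G] [MeasurableSpace G] [NormedAddCommGroup E]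
    [NormedSpace ℝ E] (μ : Measure G) (f : G → E) (x : G) : E := ∫ y, f (x - y) ∂μ

/-- Convolution of a nonnegative function with a measure. -/
def convP {G : Type*} [AddCommGroup G] [MeasurableSpace G] (μ : Measure G) (g : G → ℝ≥0∞)
    (x : G) : ℝ≥0∞ := ∫⁻ y, g (x - y) ∂μ

section BMBasic

variable {α E : Type*} [MeasurableSpace α] [NormedAddCommGroup E]

theorem BM.integrable {f : α → E} (hf : BM f) (μ : Measure α) [IsFiniteMeasure μ] :
    Integrable f μ := by
  obtain ⟨C, hC⟩ := hf.2
  exact Integrable.of_bound hf.1.aestronglyMeasurable C (Eventually.of_forall hC)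

theorem BM.comp {β : Type*} [MeasurableSpace β] {f : α → E} (hf : BM f) {g : β → α}
    (hg : Measurable g) : BM (fun x => f (g x)) := by
  obtain ⟨C, hC⟩ := hf.2
  exact ⟨hf.1.comp_measurable hg, C, fun x => hC _⟩

theorem BM.sub {f g : α → E} (hf : BM f) (hg : BM g) : BM (fun x => f x - g x) := by
  obtain ⟨C, hC⟩ := hf.2
  obtain ⟨D, hD⟩ := hg.2
  exact ⟨hf.1.sub hg.1, C + D, fun x => (norm_sub_le _ _).trans (add_le_add (hC x) (hD x))⟩

theorem BM.add {f g : α → E} (hf : BM f) (hg : BM g) : BM (fun x => f x + g x) := by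
  obtain ⟨C, hC⟩ := hf.2
  obtain ⟨D, hD⟩ := hg.2
  exact ⟨hf.1.add hg.1, C + D, fun x => (norm_add_le _ _).trans (add_le_add (hC x) (hD x))⟩

end BMBasic

section Conv

variable {G E : Type*} [AddCommGroup G] [MeasurableSpace G] [MeasurableAdd₂ G] [MeasurableNeg G]
  [NormedAddCommGroup E] [NormedSpace ℝ E]

theorem enorm_conv_le (μ : Measure G) (f : G → E) (x : G) :
    ‖conv μ f x‖ₑ ≤ convP μ (fun y => ‖f y‖ₑ) x :=
  enorm_integral_le_lintegral_enorm _

theorem convP_mono (μ : Measure G) {g h : G → ℝ≥0∞} (hgh : ∀ x, g x ≤ h x) (x : G) :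
    convP μ g x ≤ convP μ h x := lintegral_mono fun _ => hgh _

theorem measurable_convP (μ : Measure G) [SFinite μ] {g : G → ℝ≥0∞} (hg : Measurable g) :
    Measurable (convP μ g) := by
  unfold convP
  apply Measurable.lintegral_prod_right' (f := fun z : G × G => g (z.1 - z.2))
  exact hg.comp (measurable_fst.sub measurable_snd)

theorem BM.sub_left {f : G → E} (hf : BM f) (x : G) : BM (fun y => f (x - y)) :=
  hf.comp (measurable_const.sub measurable_id)

theorem BM.conv (μ : Measure G) [IsFiniteMeasure μ] {f : G → E} (hf : BM f) :
    BM (conv μ f) := by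
  obtain ⟨C, hC⟩ := hf.2
  refine ⟨?_, C * μ.real univ, fun x => ?_⟩
  · apply StronglyMeasurable.integral_prod_right' (f := fun z : G × G => f (z.1 - z.2))
    exact hf.1.comp_measurable (measurable_fst.sub measurable_snd)
  · exact norm_integral_le_of_norm_le_const (Eventually.of_forall fun y => hC _)

theorem conv_sub (μ : Measure G) [IsFiniteMeasure μ] {f g : G → E} (hf : BM f) (hg : BM g)
    (x : G) : conv μ (fun y => f y - g y) x = conv μ f x - conv μ g x :=
  integral_sub ((hf.sub_left x).integrable μ) ((hg.sub_left x).integrable μ)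

theorem conv_add (μ : Measure G) [IsFiniteMeasure μ] {f g : G → E} (hf : BM f) (hg : BM g)
    (x : G) : conv μ (fun y => f y + g y) x = conv μ f x + conv μ g x :=
  integral_add ((hf.sub_left x).integrable μ) ((hg.sub_left x).integrable μ)

theorem conv_comm (μ ν : Measure G) [IsFiniteMeasure μ] [IsFiniteMeasure ν] {f : G → E}
    (hf : BM f) (x : G) : conv μ (conv ν f) x = conv ν (conv μ f) x := by
  unfold conv
  rw [integral_integral_swap]
  · simp only [sub_right_comm]
  · have : BM (fun z : G × G => f (x - z.1 - z.2)) :=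
      hf.comp ((measurable_const.sub measurable_fst).sub measurable_snd)
    exact this.integrable (μ.prod ν)

theorem convP_comm (μ ν : Measure G) [SFinite μ] [SFinite ν] {f : G → ℝ≥0∞}
    (hf : Measurable f) (x : G) : convP μ (convP ν f) x = convP ν (convP μ f) x := by
  unfold convP
  rw [lintegral_lintegral_swap]
  · simp only [sub_right_comm]
  · exact (hf.comp ((measurable_const.sub measurable_fst).sub measurable_snd)).aemeasurable

theorem rpow_lintegral_le {α : Type*} [MeasurableSpace α] (μ : Measure α) [IsProbabilityMeasure μ]
    {p : ℝ} (hp : 1 ≤ p) {g : α → ℝ≥0∞} (hg : AEMeasurable g μ) :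
    (∫⁻ y, g y ∂μ) ^ p ≤ ∫⁻ y, g y ^ p ∂μ := by
  rcases hp.eq_or_lt with rfl | hp
  · simp
  have hpq := Real.HolderConjugate.conjExponent hp
  have := ENNReal.lintegral_mul_le_Lp_mul_Lq μ hpq hg (aemeasurable_const (b := (1 : ℝ≥0∞)))
  simp at this
  calc (∫⁻ y, g y ∂μ) ^ p ≤ ((∫⁻ y, g y ^ p ∂μ) ^ p⁻¹) ^ p := by gcongr
    _ = _ := by rw [← ENNReal.rpow_mul, inv_mul_cancel₀ (by positivity), ENNReal.rpow_one]

theorem convP_rpow_le (μ : Measure G) [IsProbabilityMeasure μ]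
    {p : ℝ} (hp : 1 ≤ p) {g : G → ℝ≥0∞} (hg : Measurable g) (x : G) :
    (convP μ g x) ^ p ≤ convP μ (fun y => g y ^ p) x :=
  rpow_lintegral_le μ hp (hg.comp (measurable_const.sub measurable_id)).aemeasurable

theorem lintegral_convP (μ : Measure G) [SFinite μ] (vol : Measure G) [SFinite vol]
    [vol.IsAddRightInvariant] {g : G → ℝ≥0∞} (hg : Measurable g) :
    ∫⁻ x, convP μ g x ∂vol = μ univ * ∫⁻ x, g x ∂vol := by
  unfold convP
  rw [lintegral_lintegral_swap]
  · simp_rw [lintegral_sub_right_eq_self]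
    rw [lintegral_const, mul_comm]
  · exact (hg.comp (measurable_fst.sub measurable_snd)).aemeasurable

theorem lintegral_convP_rpow_le (μ : Measure G) [IsProbabilityMeasure μ] (vol : Measure G)
    [SFinite vol] [vol.IsAddRightInvariant] {p : ℝ} (hp : 1 ≤ p) {g : G → ℝ≥0∞}
    (hg : Measurable g) : ∫⁻ x, (convP μ g x) ^ p ∂vol ≤ ∫⁻ x, g x ^ p ∂vol := by
  calc _ ≤ ∫⁻ x, convP μ (fun y => g y ^ p) x ∂vol := lintegral_mono (convP_rpow_le μ hp hg)
    _ = _ := by rw [lintegral_convP μ vol (hg.pow_const p)]; simp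

theorem integrable_conv (μ : Measure G) [IsProbabilityMeasure μ] (vol : Measure G)
    [SFinite vol] [vol.IsAddRightInvariant] {f : G → E} (hf : BM f) (hi : Integrable f vol) :
    Integrable (conv μ f) vol := by
  refine ⟨(hf.conv μ).1.aestronglyMeasurable, ?_⟩
  calc ∫⁻ x, ‖conv μ f x‖ₑ ∂vol ≤ ∫⁻ x, convP μ (fun y => ‖f y‖ₑ) x ∂vol :=
        lintegral_mono (enorm_conv_le μ f)
    _ = ∫⁻ x, ‖f x‖ₑ ∂vol := by rw [lintegral_convP μ vol hf.1.enorm]; simp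
    _ < ∞ := hi.2

theorem lintegral_enorm_conv_rpow_le (μ : Measure G) [IsProbabilityMeasure μ] (vol : Measure G)
    [SFinite vol] [vol.IsAddRightInvariant] {p : ℝ} (hp : 1 ≤ p) {f : G → E} (hf : BM f) :
    ∫⁻ x, ‖conv μ f x‖ₑ ^ p ∂vol ≤ ∫⁻ x, ‖f x‖ₑ ^ p ∂vol :=
  (lintegral_mono fun x => ENNReal.rpow_le_rpow (enorm_conv_le μ f x) (by linarith)).trans
    (lintegral_convP_rpow_le μ vol hp hf.1.enorm)

end Conv

/-! ### The dyadic Hardy–Littlewood maximal function -/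

/-- The uniform probability measure on `[-2^k, 2^k]`. -/
def bx (k : ℤ) : Measure ℝ :=
  (ENNReal.ofReal (2 * 2 ^ k))⁻¹ • volume.restrict (Icc (-(2:ℝ) ^ k) (2 ^ k))

/-- The dyadic centered maximal function on the line. -/
def HLM (g : ℝ → ℝ≥0∞) (x : ℝ) : ℝ≥0∞ := ⨆ k : ℤ, convP (bx k) g x

instance (k : ℤ) : IsProbabilityMeasure (bx k) := by
  refine ⟨?_⟩
  have h : (0:ℝ) < 2 ^ k := by positivity
  simp only [bx, Measure.smul_apply, Measure.restrict_apply_univ, Real.volume_Icc, smul_eq_mul]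
  rw [show (2:ℝ) ^ k - -2 ^ k = 2 * 2 ^ k by ring]
  exact ENNReal.inv_mul_cancel (by simpa using h) ENNReal.ofReal_ne_top

theorem convP_bx (k : ℤ) (g : ℝ → ℝ≥0∞) (x : ℝ) :
    convP (bx k) g x =
      (ENNReal.ofReal (2 * 2 ^ k))⁻¹ * ∫⁻ y in Metric.closedBall x (2 ^ k), g y := by
  rw [convP, bx, lintegral_smul_measure, smul_eq_mul]
  congr 1
  rw [← lintegral_indicator measurableSet_Icc, ← lintegral_indicator measurableSet_closedBall,
    ← lintegral_sub_left_eq_self _ x]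
  congr 1 with y
  simp only [indicator, Real.closedBall_eq_Icc, mem_Icc, sub_sub_cancel]
  congr 1
  apply propext; constructor <;> rintro ⟨h1, h2⟩ <;> constructor <;> linarith

theorem measurable_HLM {g : ℝ → ℝ≥0∞} (hg : Measurable g) : Measurable (HLM g) :=
  Measurable.iSup fun k => measurable_convP (bx k) hg

theorem HLM_weak (g : ℝ → ℝ≥0∞) {l : ℝ} (hl : 0 < l) :
    volume {x | ENNReal.ofReal l < HLM g x} ≤ ENNReal.ofReal (5 / l) * ∫⁻ y, g y := by
  set I := ∫⁻ y, g y with hI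
  by_cases hfin : I = ∞
  · rw [hfin, ENNReal.mul_top]
    · exact le_top
    · simpa using hl
  have key : ∀ x, ENNReal.ofReal l < HLM g x → ∃ k : ℤ,
      ENNReal.ofReal (l * (2 * 2 ^ k)) < ∫⁻ y in Metric.closedBall x (2 ^ k), g y := by
    intro x hx
    obtain ⟨k, hk⟩ := lt_iSup_iff.mp hx
    refine ⟨k, ?_⟩
    rw [convP_bx k g] at hk
    have h2 : (0:ℝ) < 2 * 2 ^ k := by positivity
    rw [mul_comm, ← div_eq_mul_inv, ENNReal.lt_div_iff_mul_lt (Or.inl (by simpa using h2))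
      (Or.inl ENNReal.ofReal_ne_top)] at hk
    rwa [ENNReal.ofReal_mul hl.le]
  choose! k hk using key
  set t := {x | ENNReal.ofReal l < HLM g x} with ht
  obtain ⟨u, hut, hdisj, hcov⟩ := Vitali.exists_disjoint_subfamily_covering_enlargement_closedBall
    t (fun x => x) (fun x => (2:ℝ) ^ (k x)) (I.toReal / l) (by
      intro x hx
      have h1 := (hk x hx).le.trans (setLIntegral_le_lintegral _ _)
      rw [← hI, ENNReal.ofReal_le_iff_le_toReal hfin] at h1
      rw [le_div_iff₀ hl]
      have : (0:ℝ) < 2 ^ (k x) := by positivity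
      nlinarith) 5 (by norm_num)
  have hucount : u.Countable := by
    refine hdisj.countable_of_nonempty_interior fun x _ => ?_
    have : (0:ℝ) < 2 ^ (k x) := by positivity
    exact ⟨x, Metric.ball_subset_interior_closedBall (Metric.mem_ball_self this)⟩
  have hsub : t ⊆ ⋃ a ∈ u, Metric.closedBall a (5 * 2 ^ (k a)) := by
    intro x hx
    obtain ⟨b, hb, hb2⟩ := hcov x hx
    have : (0:ℝ) < 2 ^ (k x) := by positivity
    exact mem_biUnion hb (hb2 (Metric.mem_closedBall_self this.le))
  calc volume t ≤ volume (⋃ a ∈ u, Metric.closedBall a (5 * (2:ℝ) ^ (k a))) := measure_mono hsub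
    _ ≤ ∑' a : u, volume (Metric.closedBall (a:ℝ) (5 * (2:ℝ) ^ (k a))) :=
        measure_biUnion_le _ hucount _
    _ ≤ ∑' a : u, ENNReal.ofReal (5 / l) * ∫⁻ y in Metric.closedBall (a:ℝ) (2 ^ (k a)), g y := by
        refine ENNReal.tsum_le_tsum fun a => ?_
        have := (hk a (hut a.2)).le
        rw [Real.volume_closedBall]
        calc _ = ENNReal.ofReal (5 / l) * ENNReal.ofReal (l * (2 * 2 ^ (k a))) := by
              rw [← ENNReal.ofReal_mul (by positivity)]; congr 1; field_simp
          _ ≤ _ := by gcongr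
    _ = ENNReal.ofReal (5 / l) * ∑' a : u, ∫⁻ y in Metric.closedBall (a:ℝ) (2 ^ (k a)), g y :=
        ENNReal.tsum_mul_left
    _ = ENNReal.ofReal (5 / l) * ∫⁻ y in ⋃ a ∈ u, Metric.closedBall a ((2:ℝ) ^ (k a)), g y := by
        rw [lintegral_biUnion hucount (fun _ _ => measurableSet_closedBall) hdisj]
    _ ≤ ENNReal.ofReal (5 / l) * I := by gcongr; exact setLIntegral_le_lintegral _ _

/-- Layer-cake formula for a single extended nonnegative number. -/
theorem layer_cake_pt {s : ℝ} (hs : 0 < s) (a : ℝ≥0∞) :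
    ∫⁻ t in Ioi (0:ℝ), {t : ℝ | ENNReal.ofReal t < a}.indicator
      (fun t => ENNReal.ofReal (s * t ^ (s - 1))) t = a ^ s := by
  have hm : ∀ a : ℝ≥0∞, MeasurableSet {t : ℝ | ENNReal.ofReal t < a} := fun a =>
    measurableSet_lt ENNReal.measurable_ofReal measurable_const
  have fin : ∀ r : ℝ, 0 ≤ r → ∫⁻ t in Ioi (0:ℝ), {t : ℝ | ENNReal.ofReal t < ENNReal.ofReal r}.indicator
      (fun t => ENNReal.ofReal (s * t ^ (s - 1))) t = ENNReal.ofReal r ^ s := by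
    intro r hr
    rw [setLIntegral_indicator (hm _)]
    have : {t : ℝ | ENNReal.ofReal t < ENNReal.ofReal r} ∩ Ioi 0 = Ioo 0 r := by
      ext t
      simp only [mem_inter_iff, mem_ofPred_eq, mem_Ioi, mem_Ioo]
      constructor
      · rintro ⟨h1, h2⟩
        exact ⟨h2, (ENNReal.ofReal_lt_ofReal_iff'.mp h1).1⟩
      · rintro ⟨h1, h2⟩
        exact ⟨ENNReal.ofReal_lt_ofReal_iff'.mpr ⟨h2, by linarith⟩, h1⟩
    rw [this, restrict_Ioo_eq_restrict_Ioc,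
      ← ofReal_integral_eq_lintegral_ofReal, ← intervalIntegral.integral_of_le hr,
      intervalIntegral.integral_const_mul, integral_rpow (Or.inl (by linarith)),
      ENNReal.ofReal_rpow_of_nonneg hr hs.le]
    · congr 1
      rw [sub_add_cancel, Real.zero_rpow hs.ne', sub_zero]; field_simp
    · have : IntervalIntegrable (fun t : ℝ => s * t ^ (s - 1)) volume 0 r :=
        (intervalIntegral.intervalIntegrable_rpow' (by linarith)).const_mul s
      exact (intervalIntegrable_iff_integrableOn_Ioc_of_le hr).mp this
    · filter_upwards [ae_restrict_mem measurableSet_Ioc] with t ht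
      have := ht.1
      positivity
  by_cases ha : a = ∞
  · subst ha
    rw [ENNReal.top_rpow_of_pos hs, eq_top_iff]
    refine ENNReal.le_of_forall_nnreal_lt fun r _ => ?_
    have h := fin ((r:ℝ) ^ s⁻¹) (by positivity)
    rw [ENNReal.ofReal_rpow_of_nonneg (by positivity) hs.le, ← Real.rpow_mul (by positivity),
      inv_mul_cancel₀ hs.ne', Real.rpow_one, ENNReal.ofReal_coe_nnreal] at h
    rw [← h]
    refine lintegral_mono fun t => ?_
    refine indicator_le_indicator_of_subset ?_ (fun _ => zero_le) t
    intro t _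
    exact ENNReal.ofReal_lt_top
  · have := fin a.toReal ENNReal.toReal_nonneg
    rwa [ENNReal.ofReal_toReal ha] at this

theorem layer_cake {α : Type*} [MeasurableSpace α] (μ : Measure α) [SFinite μ] {s : ℝ}
    (hs : 0 < s) {g : α → ℝ≥0∞} (hg : Measurable g) (w : α → ℝ≥0∞) (hw : Measurable w) :
    ∫⁻ x, w x * g x ^ s ∂μ = ∫⁻ t in Ioi (0:ℝ), ENNReal.ofReal (s * t ^ (s - 1)) *
      ∫⁻ x, {x | ENNReal.ofReal t < g x}.indicator w x ∂μ := by
  have hms : MeasurableSet {z : α × ℝ | ENNReal.ofReal z.2 < g z.1} :=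
    measurableSet_lt (ENNReal.measurable_ofReal.comp measurable_snd) (hg.comp measurable_fst)
  have hpw : Measurable fun t : ℝ => ENNReal.ofReal (s * t ^ (s - 1)) := by fun_prop
  have hm : Measurable fun z : α × ℝ => {z : α × ℝ | ENNReal.ofReal z.2 < g z.1}.indicator
      (fun z => ENNReal.ofReal (s * z.2 ^ (s - 1))) z :=
    (hpw.comp measurable_snd).indicator hms
  calc ∫⁻ x, w x * g x ^ s ∂μ = ∫⁻ x, (∫⁻ t in Ioi (0:ℝ), w x *
        {z : α × ℝ | ENNReal.ofReal z.2 < g z.1}.indicator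
          (fun z => ENNReal.ofReal (s * z.2 ^ (s - 1))) (x, t)) ∂μ := by
        refine lintegral_congr fun x => ?_
        have hmx : Measurable fun t : ℝ => {z : α × ℝ | ENNReal.ofReal z.2 < g z.1}.indicator
          (fun z => ENNReal.ofReal (s * z.2 ^ (s - 1))) (x, t) := hm.comp measurable_prodMk_left
        rw [lintegral_const_mul _ hmx, ← layer_cake_pt hs (g x)]
        rfl
    _ = _ := by
        rw [lintegral_lintegral_swap]
        · refine lintegral_congr fun t => ?_
          rw [← lintegral_const_mul _ (hw.indicator (measurableSet_lt measurable_const hg))]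
          refine lintegral_congr fun x => ?_
          by_cases h : ENNReal.ofReal t < g x
          · simp [indicator, h, mul_comm]
          · simp [indicator, h]
        · exact ((hw.comp measurable_fst).mul hm).aemeasurable

theorem HLM_add_le (g h : ℝ → ℝ≥0∞) (hg : Measurable g) (x : ℝ) :
    HLM (fun y => g y + h y) x ≤ HLM g x + HLM h x := by
  refine iSup_le fun k => ?_
  have : convP (bx k) (fun y => g y + h y) x = convP (bx k) g x + convP (bx k) h x :=
    lintegral_add_left (hg.comp (measurable_const.sub measurable_id)) _
  rw [this]
  exact add_le_add (le_iSup (fun k => convP (bx k) g x) k) (le_iSup (fun k => convP (bx k) h x) k)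

theorem HLM_mono {g h : ℝ → ℝ≥0∞} (hgh : ∀ x, g x ≤ h x) (x : ℝ) : HLM g x ≤ HLM h x :=
  iSup_mono fun _ => convP_mono _ hgh x

theorem HLM_const_le (c : ℝ≥0∞) (x : ℝ) : HLM (fun _ => c) x ≤ c := by
  refine iSup_le fun k => ?_
  simp [convP]

theorem HLM_rpow_le {p : ℝ} (hp : 1 < p) (hp2 : p ≤ 2) {g : ℝ → ℝ≥0∞} (hg : Measurable g) :
    ∫⁻ x, HLM g x ^ p ≤ ENNReal.ofReal (40 / (p - 1)) * ∫⁻ x, g x ^ p := by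
  have hp0 : 0 < p := by linarith
  have hp1 : 0 < p - 1 := by linarith
  have hstep : ∀ t : ℝ, 0 < t → ∫⁻ x, {x | ENNReal.ofReal t < HLM g x}.indicator 1 x ≤
      ENNReal.ofReal (10 / t) * ∫⁻ x, {x | ENNReal.ofReal t < 2 * g x}.indicator g x := by
    intro t ht
    have hmS : MeasurableSet {x | ENNReal.ofReal t < 2 * g x} :=
      measurableSet_lt measurable_const (hg.const_mul 2)
    rw [lintegral_indicator_one (measurableSet_lt measurable_const (measurable_HLM hg))]
    refine le_trans (measure_mono ?_) ((HLM_weak ({x | ENNReal.ofReal t < 2 * g x}.indicator g)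
      (half_pos ht)).trans_eq ?_)
    · intro x hx
      simp only [mem_ofPred_eq] at hx ⊢
      by_contra! hcon
      have h1 : HLM g x ≤ HLM ({x | ENNReal.ofReal t < 2 * g x}.indicator g) x
          + ENNReal.ofReal (t / 2) := by
        refine le_trans (HLM_mono (h := fun y => {x | ENNReal.ofReal t < 2 * g x}.indicator g y
          + ENNReal.ofReal (t / 2)) ?_ x) ?_
        · intro y
          by_cases hy : ENNReal.ofReal t < 2 * g y
          · simp [indicator, hy]
          · simp only [indicator, mem_ofPred_eq, hy, if_false, zero_add]
            rw [not_lt] at hy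
            rw [ENNReal.ofReal_div_of_pos two_pos, ENNReal.le_div_iff_mul_le (by simp) (by simp),
              mul_comm]
            simpa using hy
        · refine (HLM_add_le _ _ (hg.indicator hmS) x).trans ?_
          gcongr
          exact HLM_const_le _ x
      have h2 : HLM g x ≤ ENNReal.ofReal t := by
        refine (h1.trans (add_le_add hcon le_rfl)).trans_eq ?_
        rw [← ENNReal.ofReal_add (by linarith) (by linarith), add_halves]
      exact absurd hx (not_lt.mpr h2)
    · congr 2
      field_simp; norm_num
  have h1 := layer_cake volume hp0 (measurable_HLM hg) 1 measurable_one
  have h2 := layer_cake volume hp1 (hg.const_mul 2) g hg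
  simp only [Pi.one_apply, one_mul] at h1
  have hconst : ∀ t : ℝ, 0 < t → ENNReal.ofReal (p * t ^ (p - 1)) * ENNReal.ofReal (10 / t) =
      ENNReal.ofReal (10 * p / (p - 1)) * ENNReal.ofReal ((p - 1) * t ^ (p - 1 - 1)) := by
    intro t ht
    rw [← ENNReal.ofReal_mul (by positivity), ← ENNReal.ofReal_mul (by positivity)]
    congr 1
    rw [Real.rpow_sub_one ht.ne' (p - 1)]
    field_simp
  calc ∫⁻ x, HLM g x ^ p = _ := h1
    _ ≤ ∫⁻ t in Ioi (0:ℝ), ENNReal.ofReal (10 * p / (p - 1)) *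
        (ENNReal.ofReal ((p - 1) * t ^ (p - 1 - 1)) *
        ∫⁻ x, {x | ENNReal.ofReal t < 2 * g x}.indicator g x) := by
        refine setLIntegral_mono' measurableSet_Ioi fun t ht => ?_
        rw [← mul_assoc, ← hconst t ht, mul_assoc]
        gcongr
        exact hstep t ht
    _ = ENNReal.ofReal (10 * p / (p - 1)) * ∫⁻ x, g x * (2 * g x) ^ (p - 1) := by
        rw [lintegral_const_mul' _ _ ENNReal.ofReal_ne_top, h2]
    _ ≤ ENNReal.ofReal (10 * p / (p - 1)) * ∫⁻ x, 2 * g x ^ p := by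
        refine mul_le_mul_right (lintegral_mono fun x => ?_) _
        rw [ENNReal.mul_rpow_of_nonneg _ _ hp1.le]
        calc g x * (2 ^ (p - 1) * g x ^ (p - 1)) = 2 ^ (p - 1) * (g x ^ (1:ℝ) * g x ^ (p - 1)) := by
              rw [ENNReal.rpow_one]; ring
          _ = 2 ^ (p - 1) * g x ^ p := by
              rw [← ENNReal.rpow_add_of_nonneg _ _ zero_le_one hp1.le]; congr 2; ring
          _ ≤ 2 ^ (1:ℝ) * g x ^ p := by
              gcongr
              · norm_num
              · linarith
          _ = _ := by rw [ENNReal.rpow_one]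
    _ = ENNReal.ofReal (10 * p / (p - 1)) * 2 * ∫⁻ x, g x ^ p := by
        rw [lintegral_const_mul' _ _ (by simp), mul_assoc]
    _ ≤ _ := by
        gcongr
        rw [show (2:ℝ≥0∞) = ENNReal.ofReal 2 by simp, ← ENNReal.ofReal_mul (by positivity)]
        gcongr
        rw [div_mul_eq_mul_div]
        gcongr
        linarith

/-! ### A quantitative convexity inequality for `‖·‖ ^ p` -/

theorem rpow_sub_rpow_ge {p a c : ℝ} (hp : 1 < p) (hp2 : p ≤ 2) (ha : 0 ≤ a)
    (hc : 0 < c) : (p - 1) * c ^ (p - 2) * (c - a) ≤ c ^ (p - 1) - a ^ (p - 1) := by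
  have h := rpow_one_add_le_one_add_mul_self (s := a / c - 1) (p := p - 1)
    (by have := div_nonneg ha hc.le; linarith) (by linarith) (by linarith)
  rw [add_sub_cancel, Real.div_rpow ha hc.le, div_le_iff₀ (by positivity)] at h
  have h2 : c ^ (p - 1) = c ^ (p - 2) * c := by
    rw [← Real.rpow_add_one hc.ne']; congr 1; ring
  rw [h2] at h ⊢
  have : (1 + (p - 1) * (a / c - 1)) * (c ^ (p - 2) * c)
    = c ^ (p - 2) * c + (p - 1) * c ^ (p - 2) * (a - c) := by field_simp
  linarith

theorem rpow_tangent_real {p a c M : ℝ} (hp : 1 < p) (hp2 : p ≤ 2) (ha : 0 < a) (haM : a ≤ M)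
    (hc : 0 ≤ c) (hcM : c ≤ M) :
    a ^ p + p * a ^ (p - 1) * (c - a) + p * (p - 1) / 2 * M ^ (p - 2) * (c - a) ^ 2 ≤ c ^ p := by
  have hM : 0 < M := ha.trans_le haM
  set h : ℝ → ℝ := fun c => c ^ p - a ^ p - p * a ^ (p - 1) * (c - a)
    - p * (p - 1) / 2 * M ^ (p - 2) * (c - a) ^ 2 with hh
  have hder : ∀ x : ℝ, 0 < x → HasDerivAt h (p * (x ^ (p - 1) - a ^ (p - 1)
      - (p - 1) * M ^ (p - 2) * (x - a))) x := by
    intro x hx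
    have h1 := (Real.hasDerivAt_rpow_const (x := x) (p := p) (Or.inl hx.ne')).sub_const (a ^ p)
    have h2 := ((hasDerivAt_id x).sub_const a).const_mul (p * a ^ (p - 1))
    have h3 := (((hasDerivAt_id x).sub_const a).pow 2).const_mul (p * (p - 1) / 2 * M ^ (p - 2))
    have := (h1.sub h2).sub h3
    refine HasDerivAt.congr_deriv this ?_
    simp
    ring
  have hcont : ContinuousOn h (Icc 0 M) := by
    have : Continuous fun c : ℝ => c ^ p := Real.continuous_rpow_const (by linarith)
    apply Continuous.continuousOn
    simp only [hh]
    fun_prop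
  have hMp : ∀ x, 0 < x → x ≤ M → M ^ (p - 2) ≤ x ^ (p - 2) := fun x hx hxM =>
    Real.rpow_le_rpow_of_nonpos hx hxM (by linarith)
  have h0 : h a = 0 := by simp [hh]
  suffices 0 ≤ h c by simp only [hh] at this; linarith
  rw [← h0]
  rcases le_total a c with hac | hca
  · refine monotoneOn_of_deriv_nonneg (convex_Icc a M) (hcont.mono (Icc_subset_Icc_left ha.le))
      ?_ ?_ ⟨le_rfl, haM⟩ ⟨hac, hcM⟩ hac
    · intro x hx
      rw [interior_Icc] at hx
      exact (hder x (ha.trans hx.1)).differentiableAt.differentiableWithinAt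
    · intro x hx
      rw [interior_Icc] at hx
      have hx0 := ha.trans hx.1
      rw [(hder x hx0).deriv]
      have := rpow_sub_rpow_ge hp hp2 ha.le hx0
      have h4 : (p - 1) * M ^ (p - 2) * (x - a) ≤ (p - 1) * x ^ (p - 2) * (x - a) := by
        have := hMp x hx0 hx.2.le
        have := sub_pos.mpr hx.1
        gcongr
      exact mul_nonneg (by linarith) (by linarith)
  · refine antitoneOn_of_deriv_nonpos (convex_Icc 0 a) (hcont.mono (Icc_subset_Icc_right haM))
      ?_ ?_ ⟨hc, hca⟩ ⟨ha.le, le_rfl⟩ hca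
    · intro x hx
      rw [interior_Icc] at hx
      exact (hder x hx.1).differentiableAt.differentiableWithinAt
    · intro x hx
      rw [interior_Icc] at hx
      rw [(hder x hx.1).deriv]
      have := rpow_sub_rpow_ge hp hp2 hx.1.le ha
      have h4 : (p - 1) * M ^ (p - 2) * (a - x) ≤ (p - 1) * a ^ (p - 2) * (a - x) := by
        have := hMp a ha haM
        have := sub_pos.mpr hx.2
        gcongr
      exact mul_nonpos_of_nonneg_of_nonpos (by linarith) (by linarith)

open scoped RealInnerProductSpace in
theorem rpow_tangent {E : Type*} [NormedAddCommGroup E] [InnerProductSpace ℝ E] {p : ℝ}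
    (hp : 1 < p) (hp2 : p ≤ 2) (x y : E) :
    ‖x‖ ^ p + p * ‖x‖ ^ (p - 2) * ⟪x, y - x⟫
      + p * (p - 1) / 2 * (‖y - x‖ ^ 2 * (max ‖x‖ ‖y‖) ^ (p - 2)) ≤ ‖y‖ ^ p := by
  have hk1 : p * (p - 1) / 2 ≤ 1 := by nlinarith
  have hk0 : 0 ≤ p * (p - 1) / 2 := by
    have : 0 < p - 1 := by linarith
    positivity
  rcases eq_or_ne x 0 with rfl | hx
  · have hp0 : p ≠ 0 := by linarith
    simp only [norm_zero, Real.zero_rpow hp0, inner_zero_left, mul_zero, sub_zero, zero_add,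
      norm_nonneg, max_eq_right]
    rcases eq_or_ne y 0 with rfl | hy
    · simp [Real.zero_rpow hp0]
    · have hy := norm_pos_iff.mpr hy
      have : ‖y‖ ^ 2 * ‖y‖ ^ (p - 2) = ‖y‖ ^ p := by
        rw [← Real.rpow_two, ← Real.rpow_add hy]; congr 1; ring
      rw [this]
      have : 0 ≤ ‖y‖ ^ p := by positivity
      nlinarith
  have ha := norm_pos_iff.mpr hx
  set a := ‖x‖
  set c := ‖y‖
  set M := max a c
  have hM : 0 < M := ha.trans_le (le_max_left _ _)
  have key := rpow_tangent_real hp hp2 ha (le_max_left a c) (norm_nonneg y) (le_max_right a c)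
  set I := ⟪x, y - x⟫ with hI
  have hxy : ⟪x, y⟫ = I + a ^ 2 := by
    rw [hI, inner_sub_right, real_inner_self_eq_norm_sq]; ring
  have hexp : ‖y - x‖ ^ 2 = c ^ 2 - 2 * (I + a ^ 2) + a ^ 2 := by
    rw [norm_sub_sq_real, real_inner_comm, hxy]
  have hcs : I + a ^ 2 ≤ a * c := hxy ▸ real_inner_le_norm x y
  have hp1 : a ^ (p - 1) = a ^ (p - 2) * a := by
    rw [← Real.rpow_add_one ha.ne']; congr 1; ring
  have hmono : M ^ (p - 2) ≤ a ^ (p - 2) :=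
    Real.rpow_le_rpow_of_nonpos ha (le_max_left a c) (by linarith)
  have hMp : 0 ≤ M ^ (p - 2) := by positivity
  change c ^ p ≥ _ at key
  rw [hexp]
  rw [hp1] at key
  set A := a ^ (p - 2)
  set B := M ^ (p - 2)
  refine le_trans ?_ key
  have : p * A * I + p * (p - 1) / 2 * ((c ^ 2 - 2 * (I + a ^ 2) + a ^ 2) * B) -
      (p * (A * a) * (c - a) + p * (p - 1) / 2 * B * (c - a) ^ 2)
      = p * (A - (p - 1) * B) * (I + a ^ 2 - a * c) := by ring
  have h5 : p * (A - (p - 1) * B) * (I + a ^ 2 - a * c) ≤ 0 := by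
    apply mul_nonpos_of_nonneg_of_nonpos
    · have : (p - 1) * B ≤ 1 * B := by gcongr; linarith
      apply mul_nonneg (by linarith); linarith
    · linarith
  linarith

/-! ### Averages over dyadic scales -/

section
variable {G E : Type*} [AddCommGroup G] [MeasurableSpace G] [MeasurableAdd₂ G] [MeasurableNeg G]
  [NormedAddCommGroup E] [NormedSpace ℝ E]

theorem conv_conv (μ ν : Measure G) [IsFiniteMeasure μ] [IsFiniteMeasure ν] {f : G → E}
    (hf : BM f) (x : G) : conv (μ.conv ν) f x = conv μ (conv ν f) x := by
  unfold conv
  rw [integral_conv ((hf.sub_left x).integrable _)]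
  simp only [sub_sub]

theorem convP_conv (μ ν : Measure G) [SFinite μ] [SFinite ν] {f : G → ℝ≥0∞}
    (hf : Measurable f) (x : G) : convP (μ.conv ν) f x = convP μ (convP ν f) x := by
  unfold convP
  have h : Measurable fun y => f (x - y) := hf.comp (measurable_const.sub measurable_id)
  rw [Measure.lintegral_conv h]
  simp only [sub_sub]

end

/-- The convolution square of the uniform measure on `[-2^k, 2^k]`. -/
def tr (k : ℤ) : Measure ℝ := (bx k).conv (bx k)

instance (k : ℤ) : IsProbabilityMeasure (tr k) := by unfold tr; infer_instance

theorem ae_bx_mem (k : ℤ) : ∀ᵐ t ∂(bx k), |t| ≤ 2 ^ k := by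
  have : ∀ᵐ t ∂(volume.restrict (Icc (-(2:ℝ) ^ k) (2 ^ k))), |t| ≤ 2 ^ k := by
    filter_upwards [ae_restrict_mem measurableSet_Icc] with t ht
    exact abs_le.mpr ht
  exact Measure.ae_smul_measure this _

theorem convP_bx_sub_le (k : ℤ) (g : ℝ → ℝ≥0∞) (x y : ℝ) (hy : |y| ≤ 3 * 2 ^ k) :
    convP (bx k) g (x - y) ≤ 4 * convP (bx (k + 2)) g x := by
  rw [convP_bx, convP_bx]
  have h2 : (2:ℝ) ^ (k + 2) = 4 * 2 ^ k := by
    rw [zpow_add₀ two_ne_zero]; norm_num; ring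
  have hk : (0:ℝ) < 2 ^ k := by positivity
  have h3 : 4 * (ENNReal.ofReal (2 * (2:ℝ) ^ (k + 2)))⁻¹ = (ENNReal.ofReal (2 * 2 ^ k))⁻¹ := by
    rw [← ENNReal.ofReal_inv_of_pos (by positivity), ← ENNReal.ofReal_inv_of_pos (by positivity),
      show (4:ℝ≥0∞) = ENNReal.ofReal 4 by simp, ← ENNReal.ofReal_mul (by norm_num), h2]
    congr 1
    field_simp
  rw [← mul_assoc, h3]
  gcongr 1
  refine lintegral_mono_set ?_
  rw [h2]
  refine Metric.closedBall_subset_closedBall' ?_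
  rw [Real.dist_eq, sub_sub_cancel_left, abs_neg]
  linarith

theorem convP_bx_bx_le {j k : ℤ} (hjk : j ≤ k) {g : ℝ → ℝ≥0∞} (hg : Measurable g) (x y : ℝ)
    (hy : |y| ≤ 2 ^ k) :
    convP (bx k) (convP (bx j) g) (x - y) ≤ 4 * HLM g x := by
  rw [convP_comm _ _ hg]
  have hjk2 : (2:ℝ) ^ j ≤ 2 ^ k := zpow_le_zpow_right₀ one_le_two hjk
  calc _ ≤ ∫⁻ t, 4 * HLM g x ∂(bx j) := by
        refine lintegral_mono_ae ?_
        filter_upwards [ae_bx_mem j] with t ht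
        rw [sub_sub]
        refine (convP_bx_sub_le k g x _ ?_).trans ?_
        · have := abs_add_le y t
          have : (0:ℝ) < 2 ^ k := by positivity
          linarith
        · gcongr
          exact le_iSup (fun k => convP (bx k) g x) (k + 2)
    _ = _ := by simp

section
variable {E : Type*} [NormedAddCommGroup E] [NormedSpace ℝ E]

theorem conv_bx (k : ℤ) (f : ℝ → E) (x : ℝ) :
    conv (bx k) f x = (2 * (2:ℝ) ^ k)⁻¹ • ∫ y in (-(2:ℝ) ^ k)..(2 ^ k), f (x - y) := by
  have hk : (0:ℝ) < 2 ^ k := by positivity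
  rw [conv, bx, integral_smul_measure, ENNReal.toReal_inv, ENNReal.toReal_ofReal (by positivity),
    intervalIntegral.integral_of_le (by linarith), integral_Icc_eq_integral_Ioc]

/-- The centres of the `2^L` subintervals of `[-2^k, 2^k]` of radius `2^(k-L)`. -/
def ctr (k : ℤ) (L s : ℕ) : ℝ := 2 ^ k * (-1 + (2 * s + 1) / 2 ^ L)

theorem conv_bx_split (k : ℤ) (L : ℕ) {f : ℝ → E} (hf : BM f) (x : ℝ) :
    conv (bx k) f x = ((2:ℝ) ^ L)⁻¹ •
      ∑ s ∈ Finset.range (2 ^ L), conv (bx (k - L)) f (x - ctr k L s) := by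
  have hk : (0:ℝ) < 2 ^ k := by positivity
  have hL : (0:ℝ) < 2 ^ L := by positivity
  set a : ℕ → ℝ := fun s => 2 ^ k * (-1 + 2 * s / 2 ^ L) with ha
  have h2 : (2:ℝ) ^ (k - L) = 2 ^ k / 2 ^ L := by
    rw [zpow_sub₀ two_ne_zero]; simp
  have hint : ∀ u v, IntervalIntegrable (fun y => f (x - y)) volume u v := fun u v => by
    rw [intervalIntegrable_iff]
    have : IsFiniteMeasure (volume.restrict (Set.uIoc u v)) := by unfold uIoc; infer_instance
    exact ((hf.sub_left x).integrable (volume.restrict (Set.uIoc u v)))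
  have hs : ∀ s : ℕ, conv (bx (k - L)) f (x - ctr k L s) =
      (2 * (2:ℝ) ^ (k - L))⁻¹ • ∫ y in a s..a (s + 1), f (x - y) := by
    intro s
    rw [conv_bx]
    congr 1
    have := intervalIntegral.integral_comp_add_left (a := -(2:ℝ) ^ (k - L)) (b := 2 ^ (k - L))
      (fun y => f (x - y)) (ctr k L s)
    simp only [sub_sub]
    rw [this]
    have e1 : ctr k L s + -2 ^ (k - (L:ℤ)) = a s := by
      rw [h2]; simp only [ha, ctr]; field_simp; ring
    have e2 : ctr k L s + 2 ^ (k - (L:ℤ)) = a (s + 1) := by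
      rw [h2]; simp only [ha, ctr]; push_cast; field_simp; ring
    rw [e1, e2]
  simp_rw [hs]
  rw [← Finset.smul_sum, intervalIntegral.sum_integral_adjacent_intervals fun i _ => hint _ _,
    conv_bx, smul_smul]
  have e1 : a 0 = -2 ^ k := by simp [ha]
  have e2 : a (2 ^ L) = 2 ^ k := by
    simp only [ha]; push_cast; field_simp; ring
  rw [e1, e2, h2]
  congr 1
  field_simp

theorem ctr_reflect (k : ℤ) (L : ℕ) {s : ℕ} (hs : s < 2 ^ L) :
    ctr k L (2 ^ L - 1 - s) = -ctr k L s := by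
  have h : ((2 ^ L - 1 - s : ℕ) : ℝ) = 2 ^ L - 1 - s := by
    rw [Nat.cast_sub (by omega), Nat.cast_sub Nat.one_le_two_pow]; simp
  have hL : (0:ℝ) < 2 ^ L := by positivity
  unfold ctr
  rw [h]
  field_simp
  ring

theorem abs_ctr_le (k : ℤ) (L : ℕ) {s : ℕ} (hs : s < 2 ^ L) : |ctr k L s| ≤ 2 ^ k := by
  have hL : (0:ℝ) < 2 ^ L := by positivity
  have hk : (0:ℝ) < 2 ^ k := by positivity
  unfold ctr
  rw [abs_mul, abs_of_pos hk]
  have h : (s:ℝ) + 1 ≤ 2 ^ L := by exact_mod_cast hs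
  have h0 : (0:ℝ) ≤ s := by positivity
  have h1 : (2 * (s:ℝ) + 1) / 2 ^ L ≤ 2 := by rw [div_le_iff₀ hL]; linarith
  have h2 : 0 ≤ (2 * (s:ℝ) + 1) / 2 ^ L := by positivity
  have : |-1 + (2 * (s:ℝ) + 1) / 2 ^ L| ≤ 1 := abs_le.mpr ⟨by linarith, by linarith⟩
  nlinarith

end

/-! ### Square functions for differences of averages -/

section
variable {E : Type*} [NormedAddCommGroup E] [InnerProductSpace ℝ E]

theorem sum_tangent {p : ℝ} (hp : 1 < p) (hp2 : p ≤ 2) {n : ℕ} (hn : 0 < n) (v : ℕ → E) (h : E)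
    (hh : h = (n:ℝ)⁻¹ • ∑ s ∈ Finset.range n, v s) :
    n * ‖h‖ ^ p + p * (p - 1) / 2 * ∑ s ∈ Finset.range n,
      ‖v s - h‖ ^ 2 * (max ‖h‖ ‖v s‖) ^ (p - 2) ≤ ∑ s ∈ Finset.range n, ‖v s‖ ^ p := by
  have h0 : ∑ s ∈ Finset.range n, (v s - h) = 0 := by
    rw [Finset.sum_sub_distrib, Finset.sum_const, Finset.card_range, hh, ← Nat.cast_smul_eq_nsmul ℝ,
      smul_inv_smul₀ (by positivity), sub_self]
  have hsum := Finset.sum_le_sum fun s (_ : s ∈ Finset.range n) => rpow_tangent hp hp2 h (v s)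
  rw [Finset.sum_add_distrib, Finset.sum_add_distrib, ← Finset.mul_sum, ← Finset.mul_sum,
    ← inner_sum, h0, inner_zero_right] at hsum
  simpa using hsum

theorem sum_tangent_enorm {p : ℝ} (hp : 1 < p) (hp2 : p ≤ 2) {n : ℕ} (hn : 0 < n) (v : ℕ → E)
    (h : E) (hh : h = (n:ℝ)⁻¹ • ∑ s ∈ Finset.range n, v s) :
    n * ‖h‖ₑ ^ p + ENNReal.ofReal (p * (p - 1) / 2) * ∑ s ∈ Finset.range n,
      ENNReal.ofReal (‖v s - h‖ ^ 2 * (max ‖h‖ ‖v s‖) ^ (p - 2)) ≤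
      ∑ s ∈ Finset.range n, ‖v s‖ₑ ^ p := by
  have hp0 : 0 ≤ p := by linarith
  have hp1 : 0 ≤ p - 1 := by linarith
  have e : ∀ w : E, ‖w‖ₑ ^ p = ENNReal.ofReal (‖w‖ ^ p) := fun w => by
    rw [← ofReal_norm, ENNReal.ofReal_rpow_of_nonneg (norm_nonneg w) hp0]
  simp_rw [e]
  rw [← ENNReal.ofReal_sum_of_nonneg fun i _ => by positivity,
    ← ENNReal.ofReal_sum_of_nonneg fun i _ => by positivity, ← ENNReal.ofReal_natCast n,
    ← ENNReal.ofReal_mul (by positivity), ← ENNReal.ofReal_mul (by positivity),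
    ← ENNReal.ofReal_add (by positivity)]
  · exact ENNReal.ofReal_le_ofReal (sum_tangent hp hp2 hn v h hh)
  · exact mul_nonneg (by positivity) (Finset.sum_nonneg fun i _ => by positivity)

theorem enorm_sq_mul_rpow_le {p : ℝ} (hp2 : p ≤ 2) (x y : E) {W : ℝ≥0∞} (hx : ‖x‖ₑ ≤ W)
    (hy : ‖y‖ₑ ≤ W) :
    ‖y - x‖ₑ ^ 2 * W ^ (p - 2) ≤ ENNReal.ofReal (‖y - x‖ ^ 2 * (max ‖x‖ ‖y‖) ^ (p - 2)) := by
  rcases (norm_nonneg (y - x)).eq_or_lt with h0 | h0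
  · have : ‖y - x‖ₑ = 0 := by rw [← ofReal_norm, ← h0]; simp
    simp [this]
  have hm : 0 < max ‖x‖ ‖y‖ := by
    by_contra! hcon
    have h1 := (le_max_left _ _).trans hcon
    have h2 := (le_max_right _ _).trans hcon
    have := norm_sub_le y x
    linarith
  rw [ENNReal.ofReal_mul (by positivity), ENNReal.ofReal_pow (norm_nonneg _), ofReal_norm,
    ← ENNReal.ofReal_rpow_of_pos hm]
  gcongr 1
  have hW : ENNReal.ofReal (max ‖x‖ ‖y‖) ≤ W := by
    rw [ENNReal.ofReal_max, ofReal_norm, ofReal_norm]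
    exact max_le hx hy
  rw [show p - 2 = -(2 - p) by ring, ENNReal.rpow_neg, ENNReal.rpow_neg]
  exact ENNReal.inv_le_inv.mpr (ENNReal.rpow_le_rpow hW (by linarith))

theorem measurable_Phi {p : ℝ} {a b : ℝ → E} (ha : StronglyMeasurable a)
    (hb : StronglyMeasurable b) :
    Measurable fun x => ENNReal.ofReal (‖b x - a x‖ ^ 2 * (max ‖a x‖ ‖b x‖) ^ (p - 2)) := by
  apply ENNReal.measurable_ofReal.comp
  exact ((hb.sub ha).norm.measurable.pow_const 2).mul
    ((ha.norm.measurable.max hb.norm.measurable).pow_const _)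

variable [CompleteSpace E]

theorem conv_tr_eq (k : ℤ) (L : ℕ) {f : ℝ → E} (hf : BM f) (x : ℝ) :
    conv (bx k) (conv (bx (k - L)) f) x = ((2 ^ L : ℕ) : ℝ)⁻¹ •
      ∑ s ∈ Finset.range (2 ^ L), conv (tr (k - L)) f (x - ctr k L s) := by
  rw [conv_bx_split k L (hf.conv _)]
  push_cast
  congr 1
  refine Finset.sum_congr rfl fun s _ => ?_
  rw [tr, conv_conv _ _ hf]

theorem conv_tr_eq' (k : ℤ) (L : ℕ) {f : ℝ → E} (hf : BM f) (x : ℝ) :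
    conv (tr k) f x = ((2 ^ L : ℕ) : ℝ)⁻¹ •
      ∑ s ∈ Finset.range (2 ^ L), conv (bx k) (conv (bx (k - L)) f) (x - ctr k L s) := by
  rw [tr, conv_conv _ _ hf, conv_bx_split k L (hf.conv _)]
  push_cast
  congr 1
  refine Finset.sum_congr rfl fun s _ => ?_
  rw [conv_comm _ _ hf]

theorem conv_tr_eq'' (k : ℤ) (L : ℕ) {f : ℝ → E} (hf : BM f) (x : ℝ) :
    conv (tr k) f x = ((2 ^ L : ℕ) : ℝ)⁻¹ •
      ∑ s ∈ Finset.range (2 ^ L), conv (bx k) (conv (bx (k - L)) f) (x + ctr k L s) := by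
  rw [conv_tr_eq' k L hf]
  congr 1
  rw [← Finset.sum_range_reflect]
  refine Finset.sum_congr rfl fun s hs => ?_
  rw [ctr_reflect k L (Finset.mem_range.mp hs), sub_neg_eq_add]

theorem square_step {p : ℝ} (hp : 1 < p) (hp2 : p ≤ 2) (k : ℤ) (L : ℕ) {f : ℝ → E} (hf : BM f) :
    (∫⁻ x, ‖conv (tr k) f x‖ₑ ^ p) + ENNReal.ofReal (p * (p - 1) / 2) *
      (∫⁻ x, ‖conv (tr (k - L)) f x - conv (tr k) f x‖ₑ ^ 2 *
        (4 * HLM (fun y => ‖f y‖ₑ) x) ^ (p - 2)) ≤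
      ∫⁻ x, ‖conv (tr (k - L)) f x‖ₑ ^ p := by
  set g := conv (tr (k - L)) f with hg
  set h := conv (bx k) (conv (bx (k - L)) f) with hh
  set y := ctr k L
  set n := 2 ^ L with hn
  set κ := ENNReal.ofReal (p * (p - 1) / 2)
  set W : ℝ → ℝ≥0∞ := fun x => 4 * HLM (fun y => ‖f y‖ₑ) x with hW
  have hn0 : 0 < n := by positivity
  have hgB : BM g := hf.conv _
  have hhB : BM h := (hf.conv _).conv _
  have hPB : BM (conv (tr k) f) := hf.conv _
  have hWm : Measurable W := (measurable_HLM hf.1.enorm).const_mul 4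
  set Phi : E → E → ℝ≥0∞ := fun a b =>
    ENNReal.ofReal (‖b - a‖ ^ 2 * (max ‖a‖ ‖b‖) ^ (p - 2)) with hPhi
  have hk2 : (2:ℝ) ^ (k - L) ≤ 2 ^ k := zpow_le_zpow_right₀ one_le_two (by omega)
  have hgW : ∀ x, ‖g x‖ₑ ≤ W x := by
    intro x
    rw [hg, tr, conv_conv _ _ hf]
    refine (enorm_conv_le _ _ _).trans ((convP_mono _ (fun z => enorm_conv_le _ _ z) x).trans ?_)
    have := convP_bx_bx_le le_rfl hf.1.enorm x 0 (j := k - L) (by simp; positivity)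
    rwa [sub_zero] at this
  have hhW : ∀ s < n, ∀ x, ‖h (x + y s)‖ₑ ≤ W x := by
    intro s hs x
    refine (enorm_conv_le _ _ _).trans ((convP_mono _ (fun z => enorm_conv_le _ _ z) _).trans ?_)
    have := convP_bx_bx_le (show k - (L:ℤ) ≤ k by omega) hf.1.enorm x (-(y s))
      (by rw [abs_neg]; exact abs_ctr_le k L hs)
    rwa [sub_neg_eq_add] at this
  -- first inequality: averaging over the translates
  have A1 : ∀ x, n * ‖h x‖ₑ ^ p + κ * ∑ s ∈ Finset.range n, Phi (h x) (g (x - y s)) ≤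
      ∑ s ∈ Finset.range n, ‖g (x - y s)‖ₑ ^ p := fun x =>
    sum_tangent_enorm hp hp2 hn0 (fun s => g (x - y s)) (h x) (conv_tr_eq k L hf x)
  have A2 : ∀ x, n * ‖conv (tr k) f x‖ₑ ^ p ≤ ∑ s ∈ Finset.range n, ‖h (x - y s)‖ₑ ^ p :=
    fun x => le_self_add.trans
      (sum_tangent_enorm hp hp2 hn0 (fun s => h (x - y s)) _ (conv_tr_eq' k L hf x))
  have A3 : ∀ x, n * (‖g x - conv (tr k) f x‖ₑ ^ 2 * W x ^ (p - 2)) ≤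
      ∑ s ∈ Finset.range n, Phi (h (x + y s)) (g x) := by
    intro x
    have e := sum_tangent_enorm one_lt_two le_rfl hn0 (fun s => g x - h (x + y s))
      (g x - conv (tr k) f x) (by
        rw [Finset.sum_sub_distrib, smul_sub, ← conv_tr_eq'' k L hf x, Finset.sum_const,
          Finset.card_range, ← Nat.cast_smul_eq_nsmul ℝ, inv_smul_smul₀ (by positivity)])
    have e := le_self_add.trans e
    simp only [ENNReal.rpow_two] at e
    calc n * (‖g x - conv (tr k) f x‖ₑ ^ 2 * W x ^ (p - 2))
        = (n * ‖g x - conv (tr k) f x‖ₑ ^ 2) * W x ^ (p - 2) := by ring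
      _ ≤ (∑ s ∈ Finset.range n, ‖g x - h (x + y s)‖ₑ ^ 2) * W x ^ (p - 2) := by gcongr
      _ ≤ _ := by
        rw [Finset.sum_mul]
        exact Finset.sum_le_sum fun s hs => enorm_sq_mul_rpow_le hp2 _ _
          (hhW s (Finset.mem_range.mp hs) x) (hgW x)
  have mg : ∀ c : ℝ, StronglyMeasurable fun x => g (x - c) := fun c =>
    hgB.1.comp_measurable (measurable_id.sub_const c)
  have mh : ∀ c : ℝ, StronglyMeasurable fun x => h (x - c) := fun c =>
    hhB.1.comp_measurable (measurable_id.sub_const c)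
  have mh' : ∀ c : ℝ, StronglyMeasurable fun x => h (x + c) := fun c =>
    hhB.1.comp_measurable (measurable_id.add_const c)
  have B2 : n * (∫⁻ x, ‖conv (tr k) f x‖ₑ ^ p) ≤ n * ∫⁻ x, ‖h x‖ₑ ^ p := by
    rw [← lintegral_const_mul' _ _ (by simp)]
    refine (lintegral_mono A2).trans ?_
    rw [lintegral_finsetSum _ fun s _ => (mh (y s)).enorm.pow_const p]
    simp_rw [lintegral_sub_right_eq_self (fun x => ‖h x‖ₑ ^ p)]
    simp
  have B3 : n * (∫⁻ x, ‖g x - conv (tr k) f x‖ₑ ^ 2 * W x ^ (p - 2)) ≤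
      ∑ s ∈ Finset.range n, ∫⁻ x, Phi (h x) (g (x - y s)) := by
    rw [← lintegral_const_mul' _ _ (by simp)]
    refine (lintegral_mono A3).trans ?_
    rw [lintegral_finsetSum _ fun s _ => measurable_Phi (mh' (y s)) hgB.1]
    refine Finset.sum_le_sum fun s _ => ?_
    rw [← lintegral_add_right_eq_self (fun x => Phi (h x) (g (x - y s))) (y s)]
    simp only [add_sub_cancel_right]
    exact le_rfl
  have B1 : n * (∫⁻ x, ‖h x‖ₑ ^ p) + κ * ∑ s ∈ Finset.range n, ∫⁻ x, Phi (h x) (g (x - y s)) ≤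
      n * ∫⁻ x, ‖g x‖ₑ ^ p := by
    calc _ = ∫⁻ x, n * ‖h x‖ₑ ^ p + κ * ∑ s ∈ Finset.range n, Phi (h x) (g (x - y s)) := by
          rw [lintegral_add_left ((hhB.1.enorm.pow_const p).const_mul _),
            lintegral_const_mul' _ _ (by simp), lintegral_const_mul' _ _ (by simp [κ]),
            lintegral_finsetSum _ fun s _ => measurable_Phi hhB.1 (mg (y s))]
      _ ≤ _ := by
          refine (lintegral_mono A1).trans ?_
          rw [lintegral_finsetSum _ fun s _ => (mg (y s)).enorm.pow_const p]
          simp_rw [lintegral_sub_right_eq_self (fun x => ‖g x‖ₑ ^ p)]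
          simp
  have hnE : (n : ℝ≥0∞) ≠ 0 := by exact_mod_cast hn0.ne'
  rw [← ENNReal.mul_le_mul_iff_right hnE (by simp)]
  refine le_trans ?_ B1
  rw [mul_add, mul_left_comm]
  gcongr

end

theorem sum_le_of_telescope {b d : ℤ → ℝ≥0∞} {B : ℝ≥0∞} {L : ℕ} (hL : 1 ≤ L)
    (hb : ∀ k, b k ≤ B) (hd : ∀ k, b k + d k ≤ b (k - L)) (K : Finset ℤ) :
    ∑ k ∈ K, d k ≤ L * B := by
  obtain ⟨m, rfl⟩ : ∃ m, L = m + 1 := ⟨L - 1, by omega⟩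
  obtain ⟨a, ha⟩ := K.bddBelow
  obtain ⟨c, hc⟩ := K.bddAbove
  have key : ∀ n : ℕ, ∑ i ∈ Finset.range n, d (a + i) +
      ∑ i ∈ Finset.range (m + 1), b (a + n - (m + 1 : ℕ) + i) ≤
      ∑ i ∈ Finset.range (m + 1), b (a - (m + 1 : ℕ) + i) := by
    intro n
    induction n with
    | zero => simp
    | succ n ih =>
      refine le_trans ?_ ih
      rw [Finset.sum_range_succ, Finset.sum_range_succ _ m, Finset.sum_range_succ' _ m]
      have h1 := hd (a + n)
      have e1 : a + ((n + 1 : ℕ) : ℤ) - ((m + 1 : ℕ) : ℤ) + m = a + n := by push_cast; ring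
      have e2 : ∀ i : ℕ, a + ((n + 1 : ℕ) : ℤ) - ((m + 1 : ℕ) : ℤ) + i =
        a + n - ((m + 1 : ℕ) : ℤ) + ((i + 1 : ℕ) : ℤ) := fun i => by push_cast; ring
      rw [e1]
      simp only [e2]
      simp only [Nat.cast_zero, add_zero]
      calc _ = ∑ i ∈ Finset.range n, d (a + i) +
            (∑ i ∈ Finset.range m, b (a + n - ((m + 1 : ℕ) : ℤ) + ((i + 1 : ℕ) : ℤ)) +
              (b (a + n) + d (a + n))) := by ring
        _ ≤ _ := by gcongr
  have hK : K ⊆ (Finset.range (c - a + 1).toNat).image fun i : ℕ => a + i := by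
    intro k hk
    have h1 := ha hk
    have h2 := hc hk
    rw [Finset.mem_image]
    exact ⟨(k - a).toNat, by rw [Finset.mem_range]; omega, by omega⟩
  calc ∑ k ∈ K, d k ≤ ∑ k ∈ (Finset.range (c - a + 1).toNat).image fun i : ℕ => a + i, d k :=
        Finset.sum_le_sum_of_subset hK
    _ = ∑ i ∈ Finset.range (c - a + 1).toNat, d (a + i) :=
        Finset.sum_image fun i _ j _ h => by simpa using h
    _ ≤ _ := le_self_add.trans (key _)
    _ ≤ ∑ i ∈ Finset.range (m + 1), B := Finset.sum_le_sum fun i _ => hb _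
    _ = _ := by simp

theorem square_function {E : Type*} [NormedAddCommGroup E] [InnerProductSpace ℝ E]
    [CompleteSpace E] {p : ℝ} (hp : 1 < p) (hp2 : p ≤ 2) {L : ℕ} (hL : 1 ≤ L) {f : ℝ → E}
    (hf : BM f) (K : Finset ℤ) :
    ∫⁻ x, (∑ k ∈ K, ‖conv (tr (k - L)) f x - conv (tr k) f x‖ₑ ^ 2) ^ (p / 2) ≤
      ENNReal.ofReal (640 / (p - 1)) * (L : ℝ≥0∞) ^ (p / 2) * ∫⁻ x, ‖f x‖ₑ ^ p := by
  set F := ∫⁻ x, ‖f x‖ₑ ^ p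
  set W : ℝ → ℝ≥0∞ := fun x => 4 * HLM (fun y => ‖f y‖ₑ) x with hW
  set D : ℤ → ℝ → ℝ≥0∞ := fun k x => ‖conv (tr (k - L)) f x - conv (tr k) f x‖ₑ ^ 2 with hD
  have hp1 : 0 < p - 1 := by linarith
  have hWm : Measurable W := (measurable_HLM hf.1.enorm).const_mul 4
  have hDm : ∀ k, Measurable (D k) := fun k => ((hf.conv _).sub (hf.conv _)).1.enorm.pow_const 2
  set c := ENNReal.ofReal (640 / (p - 1)) with hc
  have hκ : 1 ≤ c * ENNReal.ofReal (p * (p - 1) / 2) := by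
    rw [hc, ← ENNReal.ofReal_mul (by positivity), ENNReal.one_le_ofReal]
    field_simp
    linarith
  have htele := sum_le_of_telescope hL (B := F)
    (b := fun k => ∫⁻ x, ‖conv (tr k) f x‖ₑ ^ p)
    (d := fun k => ENNReal.ofReal (p * (p - 1) / 2) * ∫⁻ x, D k x * W x ^ (p - 2))
    (fun k => lintegral_enorm_conv_rpow_le _ _ hp.le hf)
    (fun k => square_step hp hp2 k L hf) K
  have hS : ∫⁻ x, ∑ k ∈ K, D k x * W x ^ (p - 2) ≤ c * (L * F) := by
    have hm : ∀ k ∈ K, Measurable fun x => D k x * W x ^ (p - 2) :=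
      fun k _ => (hDm k).mul (hWm.pow_const _)
    rw [lintegral_finsetSum _ hm]
    rw [← Finset.mul_sum] at htele
    calc _ ≤ c * ENNReal.ofReal (p * (p - 1) / 2) * ∑ k ∈ K, ∫⁻ x, D k x * W x ^ (p - 2) :=
          le_mul_of_one_le_left zero_le hκ
      _ ≤ _ := by rw [mul_assoc]; gcongr
  have hWp : ∫⁻ x, W x ^ p ≤ c * F := by
    have := HLM_rpow_le hp hp2 hf.1.enorm
    calc ∫⁻ x, W x ^ p = 4 ^ p * ∫⁻ x, HLM (fun y => ‖f y‖ₑ) x ^ p := by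
          rw [← lintegral_const_mul' _ _ (by simp)]
          simp_rw [hW, ENNReal.mul_rpow_of_nonneg _ _ (by linarith : 0 ≤ p)]
      _ ≤ 16 * (ENNReal.ofReal (40 / (p - 1)) * F) := by
          gcongr
          calc (4:ℝ≥0∞) ^ p ≤ 4 ^ (2:ℝ) := ENNReal.rpow_le_rpow_of_exponent_le (by norm_num) hp2
            _ = 16 := by rw [ENNReal.rpow_two]; norm_num
      _ = c * F := by
          rw [← mul_assoc, show (16:ℝ≥0∞) = ENNReal.ofReal 16 by simp,
            ← ENNReal.ofReal_mul (by norm_num), hc]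
          congr 2; ring
  obtain ⟨Cf, hCf⟩ := hf.2
  have hWfin : ∀ x, W x ≠ ∞ := by
    intro x
    have : HLM (fun y => ‖f y‖ₑ) x ≤ ENNReal.ofReal Cf :=
      (HLM_mono (fun y => by rw [← ofReal_norm]; exact ENNReal.ofReal_le_ofReal (hCf y)) x).trans
        (HLM_const_le _ x)
    exact ENNReal.mul_ne_top (by simp) (ne_top_of_le_ne_top ENNReal.ofReal_ne_top this)
  have hDW : ∀ k x, D k x ≤ 4 * W x ^ 2 := by
    intro k x
    have hb : ∀ j, ‖conv (tr j) f x‖ₑ ≤ W x := by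
      intro j
      rw [tr, conv_conv _ _ hf]
      refine (enorm_conv_le _ _ _).trans ((convP_mono _ (fun z => enorm_conv_le _ _ z) x).trans ?_)
      have := convP_bx_bx_le le_rfl hf.1.enorm x 0 (j := j) (by simp; positivity)
      rwa [sub_zero] at this
    calc D k x ≤ (W x + W x) ^ 2 := by
          simp only [hD]
          gcongr
          exact (enorm_sub_le).trans (add_le_add (hb _) (hb _))
      _ = _ := by ring
  have hpt : ∀ x, (∑ k ∈ K, D k x) ^ (p / 2) ≤
      (∑ k ∈ K, D k x * W x ^ (p - 2)) ^ (p / 2) * (W x ^ p) ^ (1 - p / 2) := by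
    intro x
    rcases eq_or_ne (W x) 0 with h0 | h0
    · have : ∑ k ∈ K, D k x = 0 := by
        refine Finset.sum_eq_zero fun k _ => ?_
        have := hDW k x
        rw [h0] at this
        simpa using this
      rw [this, ENNReal.zero_rpow_of_pos (by linarith)]
      exact zero_le
    · rw [← Finset.sum_mul, ENNReal.mul_rpow_of_nonneg _ _ (by linarith), mul_assoc,
        ← ENNReal.rpow_mul, ← ENNReal.rpow_mul, ← ENNReal.rpow_add _ _ h0 (hWfin x)]
      rw [show (p - 2) * (p / 2) + p * (1 - p / 2) = 0 by ring, ENNReal.rpow_zero, mul_one]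
  have h1 : (0:ℝ) ≤ 1 - p / 2 := by linarith
  have h2 : 0 ≤ p / 2 := by linarith
  calc _ ≤ ∫⁻ x, (∑ k ∈ K, D k x * W x ^ (p - 2)) ^ (p / 2) * (W x ^ p) ^ (1 - p / 2) :=
        lintegral_mono hpt
    _ ≤ (∫⁻ x, ∑ k ∈ K, D k x * W x ^ (p - 2)) ^ (p / 2) * (∫⁻ x, W x ^ p) ^ (1 - p / 2) :=
        ENNReal.lintegral_mul_norm_pow_le
          (Finset.measurable_fun_sum _ fun k _ => (hDm k).mul (hWm.pow_const _)).aemeasurable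
          (hWm.pow_const _).aemeasurable h2 h1 (by ring)
    _ ≤ (c * (L * F)) ^ (p / 2) * (c * F) ^ (1 - p / 2) := by gcongr
    _ = (c ^ (p / 2) * c ^ (1 - p / 2)) * L ^ (p / 2) * (F ^ (p / 2) * F ^ (1 - p / 2)) := by
        rw [ENNReal.mul_rpow_of_nonneg _ _ h2, ENNReal.mul_rpow_of_nonneg _ _ h2,
          ENNReal.mul_rpow_of_nonneg _ _ h1]
        ring
    _ = _ := by
        rw [← ENNReal.rpow_add_of_nonneg _ _ h2 h1, ← ENNReal.rpow_add_of_nonneg _ _ h2 h1]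
        simp

/-! ### Directional operators in the plane -/

/-- A measure on the line, placed on the first coordinate axis. -/
def ax1 (μ : Measure ℝ) : Measure (ℝ × ℝ) := μ.map fun t => (t, 0)

/-- A measure on the line, placed on the second coordinate axis. -/
def ax2 (μ : Measure ℝ) : Measure (ℝ × ℝ) := μ.map fun t => (0, t)

theorem measurable_axis1 : Measurable fun t : ℝ => (t, (0:ℝ)) := by fun_prop
theorem measurable_axis2 : Measurable fun t : ℝ => ((0:ℝ), t) := by fun_prop

instance (μ : Measure ℝ) [IsProbabilityMeasure μ] : IsProbabilityMeasure (ax1 μ) :=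
  Measure.isProbabilityMeasure_map measurable_axis1.aemeasurable

instance (μ : Measure ℝ) [IsProbabilityMeasure μ] : IsProbabilityMeasure (ax2 μ) :=
  Measure.isProbabilityMeasure_map measurable_axis2.aemeasurable

theorem convP_ax1 (μ : Measure ℝ) {g : ℝ × ℝ → ℝ≥0∞} (hg : Measurable g) (x : ℝ × ℝ) :
    convP (ax1 μ) g x = convP μ (fun s => g (s, x.2)) x.1 := by
  have h : Measurable fun y => g (x - y) := hg.comp (measurable_const.sub measurable_id)
  rw [convP, ax1, lintegral_map h measurable_axis1]
  simp only [convP]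
  congr 1 with t
  congr 1
  ext <;> simp

theorem convP_ax2 (μ : Measure ℝ) {g : ℝ × ℝ → ℝ≥0∞} (hg : Measurable g) (x : ℝ × ℝ) :
    convP (ax2 μ) g x = convP μ (fun s => g (x.1, s)) x.2 := by
  have h : Measurable fun y => g (x - y) := hg.comp (measurable_const.sub measurable_id)
  rw [convP, ax2, lintegral_map h measurable_axis2]
  simp only [convP]
  congr 1 with t
  congr 1
  ext <;> simp

section
variable {E : Type*} [NormedAddCommGroup E] [NormedSpace ℝ E]

theorem conv_ax1 (μ : Measure ℝ) {f : ℝ × ℝ → E} (hf : BM f) (x : ℝ × ℝ) :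
    conv (ax1 μ) f x = conv μ (fun s => f (s, x.2)) x.1 := by
  rw [conv, ax1, integral_map measurable_axis1.aemeasurable (hf.sub_left x).1.aestronglyMeasurable]
  simp only [conv]
  congr 1 with t
  congr 1
  ext <;> simp

theorem conv_ax2 (μ : Measure ℝ) {f : ℝ × ℝ → E} (hf : BM f) (x : ℝ × ℝ) :
    conv (ax2 μ) f x = conv μ (fun s => f (x.1, s)) x.2 := by
  rw [conv, ax2, integral_map measurable_axis2.aemeasurable (hf.sub_left x).1.aestronglyMeasurable]
  simp only [conv]
  congr 1 with t
  congr 1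
  ext <;> simp

end

/-- The strong dyadic maximal function. -/
def HLM2 (g : ℝ × ℝ → ℝ≥0∞) (x : ℝ × ℝ) : ℝ≥0∞ :=
  ⨆ k : ℤ, convP (ax1 (bx k)) (fun y => ⨆ i : ℤ, convP (ax2 (bx i)) g y) x

theorem measurable_sup_ax2 {g : ℝ × ℝ → ℝ≥0∞} (hg : Measurable g) :
    Measurable (fun y => ⨆ i : ℤ, convP (ax2 (bx i)) g y) :=
  Measurable.iSup fun i => measurable_convP (ax2 (bx i)) hg

theorem measurable_HLM2 {g : ℝ × ℝ → ℝ≥0∞} (hg : Measurable g) : Measurable (HLM2 g) :=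
  Measurable.iSup fun k => measurable_convP (ax1 (bx k)) (measurable_sup_ax2 hg)

theorem convP_ax_le_HLM2 (g : ℝ × ℝ → ℝ≥0∞) (k i : ℤ) (x : ℝ × ℝ) :
    convP (ax1 (bx k)) (convP (ax2 (bx i)) g) x ≤ HLM2 g x :=
  (convP_mono _ (fun y => le_iSup (fun i => convP (ax2 (bx i)) g y) i) x).trans
    (le_iSup (fun k => convP (ax1 (bx k)) (fun y => ⨆ i : ℤ, convP (ax2 (bx i)) g y) x) k)

theorem HLM2_rpow_le {p : ℝ} (hp : 1 < p) (hp2 : p ≤ 2) {g : ℝ × ℝ → ℝ≥0∞} (hg : Measurable g) :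
    ∫⁻ x, HLM2 g x ^ p ≤ ENNReal.ofReal (40 / (p - 1)) ^ 2 * ∫⁻ x, g x ^ p := by
  set c := ENNReal.ofReal (40 / (p - 1))
  have h2m := measurable_sup_ax2 hg
  calc ∫⁻ x, HLM2 g x ^ p
      ≤ c * ∫⁻ x, (⨆ i : ℤ, convP (ax2 (bx i)) g x) ^ p := by
        rw [Measure.volume_eq_prod, lintegral_prod_symm _ ((measurable_HLM2 hg).pow_const p).aemeasurable,
          lintegral_prod_symm _ (h2m.pow_const p).aemeasurable,
          ← lintegral_const_mul' _ _ ENNReal.ofReal_ne_top]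
        refine lintegral_mono fun x2 => ?_
        have := HLM_rpow_le hp hp2 (h2m.comp (measurable_prodMk_right (y := x2)))
        refine le_trans (le_of_eq ?_) this
        congr 1 with x1
        simp only [HLM2, convP_ax1 _ h2m]
        rfl
    _ ≤ c * (c * ∫⁻ x, g x ^ p) := by
        gcongr 1
        rw [Measure.volume_eq_prod, lintegral_prod _ (h2m.pow_const p).aemeasurable,
          lintegral_prod _ (hg.pow_const p).aemeasurable,
          ← lintegral_const_mul' _ _ ENNReal.ofReal_ne_top]
        refine lintegral_mono fun x1 => ?_
        have := HLM_rpow_le hp hp2 (hg.comp (measurable_prodMk_left (x := x1)))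
        refine le_trans (le_of_eq ?_) this
        congr 1 with x2
        simp only [convP_ax2 _ hg]
        rfl
    _ = _ := by ring

/-! ### The double square function -/

/-- Difference of averages in the first variable. -/
def df1 {E : Type*} [NormedAddCommGroup E] [NormedSpace ℝ E] (L : ℕ) (k : ℤ) (f : ℝ × ℝ → E)
    (x : ℝ × ℝ) : E := conv (ax1 (tr (k - L))) f x - conv (ax1 (tr k)) f x

/-- Difference of averages in the second variable. -/
def df2 {E : Type*} [NormedAddCommGroup E] [NormedSpace ℝ E] (L : ℕ) (k : ℤ) (f : ℝ × ℝ → E)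
    (x : ℝ × ℝ) : E := conv (ax2 (tr (k - L))) f x - conv (ax2 (tr k)) f x

section
variable {E : Type*} [NormedAddCommGroup E] [NormedSpace ℝ E]

theorem BM.df1 (L : ℕ) (k : ℤ) {f : ℝ × ℝ → E} (hf : BM f) : BM (df1 L k f) :=
  (hf.conv _).sub (hf.conv _)

theorem BM.df2 (L : ℕ) (k : ℤ) {f : ℝ × ℝ → E} (hf : BM f) : BM (df2 L k f) :=
  (hf.conv _).sub (hf.conv _)

end

theorem enorm_sq_euclidean {ι : Type*} [Fintype ι] (v : EuclideanSpace ℝ ι) :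
    ‖v‖ₑ ^ 2 = ∑ i, ‖v i‖ₑ ^ 2 := by
  have : ∀ (F : Type) [NormedAddCommGroup F] (w : F), ‖w‖ₑ ^ 2 = ENNReal.ofReal (‖w‖ ^ 2) := by
    intro F _ w
    rw [ENNReal.ofReal_pow (norm_nonneg w), ofReal_norm]
  rw [← ofReal_norm, ← ENNReal.ofReal_pow (norm_nonneg v), EuclideanSpace.norm_sq_eq,
    ENNReal.ofReal_sum_of_nonneg fun i _ => by positivity]
  simp_rw [this]

theorem conv_euclidean_apply {G ι : Type*} [AddCommGroup G] [MeasurableSpace G]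
    [MeasurableAdd₂ G] [MeasurableNeg G] [Fintype ι] (μ : Measure G) [IsFiniteMeasure μ]
    {F : G → EuclideanSpace ℝ ι} (hF : BM F) (x : G) (i : ι) :
    conv μ F x i = conv μ (fun y => F y i) x :=
  ((EuclideanSpace.proj (𝕜 := ℝ) i).integral_comp_comm ((hF.sub_left x).integrable μ)).symm

theorem square_function2 {p : ℝ} (hp : 1 < p) (hp2 : p ≤ 2) {L : ℕ} (hL : 1 ≤ L)
    {f : ℝ × ℝ → ℝ} (hf : BM f) (K I : Finset ℤ) :
    ∫⁻ x, (∑ k ∈ K, ∑ i ∈ I, ‖df1 L k (df2 L i f) x‖ₑ ^ 2) ^ (p / 2) ≤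
      (ENNReal.ofReal (640 / (p - 1)) * (L : ℝ≥0∞) ^ (p / 2)) ^ 2 * ∫⁻ x, ‖f x‖ₑ ^ p := by
  set c := ENNReal.ofReal (640 / (p - 1)) * (L : ℝ≥0∞) ^ (p / 2) with hc
  have hcfin : c ≠ ∞ := by
    refine ENNReal.mul_ne_top ENNReal.ofReal_ne_top (ENNReal.rpow_ne_top_of_nonneg (by linarith) ?_)
    simp
  set F : ℝ × ℝ → EuclideanSpace ℝ I := fun x => WithLp.toLp 2 fun i : I => df2 L i f x with hF
  have hFi : ∀ x (i : I), F x i = df2 L i f x := fun x i => rfl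
  have hFB : BM F := by
    constructor
    · apply Measurable.stronglyMeasurable
      exact (PiLp.continuous_toLp 2 _).measurable.comp
        (measurable_pi_lambda _ fun i => (hf.df2 L i).1.measurable)
    · choose C hC using fun i : I => (hf.df2 L i).2
      refine ⟨Real.sqrt (∑ i, C i ^ 2), fun x => ?_⟩
      rw [EuclideanSpace.norm_eq]
      refine Real.sqrt_le_sqrt (Finset.sum_le_sum fun i _ => ?_)
      exact pow_le_pow_left₀ (norm_nonneg _) (hC i x) 2
  have hdf : ∀ k x, ∑ i ∈ I, ‖df1 L k (df2 L i f) x‖ₑ ^ 2 = ‖df1 L k F x‖ₑ ^ 2 := by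
    intro k x
    rw [enorm_sq_euclidean, ← Finset.sum_coe_sort]
    refine Finset.sum_congr rfl fun i _ => ?_
    congr 2
    simp only [df1, PiLp.sub_apply]
    rw [conv_euclidean_apply _ hFB, conv_euclidean_apply _ hFB]
  have hFn : ∀ x, ‖F x‖ₑ ^ p = (∑ i ∈ I, ‖df2 L i f x‖ₑ ^ 2) ^ (p / 2) := by
    intro x
    have h := enorm_sq_euclidean (F x)
    simp only [hFi] at h
    rw [Finset.sum_coe_sort I (fun i => ‖df2 L i f x‖ₑ ^ 2)] at h
    rw [← h, ← ENNReal.rpow_two, ← ENNReal.rpow_mul]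
    congr 1; ring
  simp_rw [hdf]
  have m1 : Measurable fun x => (∑ k ∈ K, ‖df1 L k F x‖ₑ ^ 2) ^ (p / 2) :=
    (Finset.measurable_fun_sum _ fun k _ => (hFB.df1 L k).1.enorm.pow_const 2).pow_const _
  have m2 : Measurable fun x => ‖F x‖ₑ ^ p := hFB.1.enorm.pow_const p
  have m3 : Measurable fun x => ‖f x‖ₑ ^ p := hf.1.enorm.pow_const p
  calc ∫⁻ x, (∑ k ∈ K, ‖df1 L k F x‖ₑ ^ 2) ^ (p / 2) ≤ c * ∫⁻ x, ‖F x‖ₑ ^ p := by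
        rw [Measure.volume_eq_prod, lintegral_prod_symm _ m1.aemeasurable,
          lintegral_prod_symm _ m2.aemeasurable, ← lintegral_const_mul' _ _ hcfin]
        refine lintegral_mono fun x2 => ?_
        have := square_function hp hp2 hL (hFB.comp (measurable_prodMk_right (y := x2))) K
        refine le_trans (le_of_eq ?_) this
        congr 1 with x1
        simp only [df1, conv_ax1 _ hFB]
    _ ≤ c * (c * ∫⁻ x, ‖f x‖ₑ ^ p) := by
        gcongr 1
        simp_rw [hFn] at m2 ⊢
        rw [Measure.volume_eq_prod, lintegral_prod _ m2.aemeasurable,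
          lintegral_prod _ m3.aemeasurable, ← lintegral_const_mul' _ _ hcfin]
        refine lintegral_mono fun x1 => ?_
        have := square_function hp hp2 hL (hf.comp (measurable_prodMk_left (x := x1))) I
        refine le_trans (le_of_eq ?_) this
        congr 1 with x2
        simp only [df2, conv_ax2 _ hf]
    _ = _ := by ring

/-! ### A vector-valued consequence of a maximal bound -/

theorem vec_conv {G ι : Type*} [Countable ι] [AddCommGroup G] [MeasurableSpace G] [MeasurableAdd₂ G]
    [MeasurableNeg G] (vol : Measure G) [SFinite vol] [vol.IsAddRightInvariant]
    {p q : ℝ} (hp : 1 < p) (hq : q = 2 * p / (p + 1)) (J : Finset ι) (μ : ι → Measure G)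
    [∀ j, IsProbabilityMeasure (μ j)] {B : ℝ≥0∞}
    (hB : ∀ g : G → ℝ≥0∞, Measurable g →
      ∫⁻ x, (⨆ j ∈ J, convP (μ j) g x) ^ p ∂vol ≤ B * ∫⁻ x, g x ^ p ∂vol)
    (g : ι → G → ℝ≥0∞) (hg : ∀ j, Measurable (g j)) (hfin : ∀ j x, g j x ≠ ∞) :
    ∫⁻ x, (∑ j ∈ J, convP (μ j) (g j) x ^ 2) ^ (q / 2) ∂vol ≤
      B ^ (q / (2 * p)) * ∫⁻ x, (∑ j ∈ J, g j x ^ 2) ^ (q / 2) ∂vol := by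
  have hp0 : 0 < p := by linarith
  have hq0 : 0 < q := by rw [hq]; positivity
  have hq2 : q < 2 := by rw [hq, div_lt_iff₀ (by linarith)]; linarith
  set S : G → ℝ≥0∞ := fun x => ∑ j ∈ J, g j x ^ 2 with hS
  have hSm : Measurable S := Finset.measurable_fun_sum _ fun j _ => (hg j).pow_const 2
  have hSfin : ∀ x, S x ≠ ∞ := fun x => by
    simp only [hS]
    exact ENNReal.sum_ne_top.mpr fun j _ => ENNReal.pow_ne_top (hfin j x)
  set a : ℝ := q / (2 * p) with ha
  have ha0 : 0 < a := by positivity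
  have hrel : q / 2 + a = 1 := by rw [ha, hq]; field_simp
  set u : ι → G → ℝ≥0∞ := fun j x => g j x ^ 2 * S x ^ (-a) with hu
  set v : G → ℝ≥0∞ := fun x => S x ^ a with hv
  have hum : ∀ j, Measurable (u j) := fun j => ((hg j).pow_const 2).mul (hSm.pow_const _)
  have hvm : Measurable v := hSm.pow_const _
  have hpt : ∀ j ∈ J, ∀ x, g j x = u j x ^ (1/2:ℝ) * v x ^ (1/2:ℝ) := by
    intro j hj x
    rcases eq_or_ne (S x) 0 with h0 | h0
    · have : g j x = 0 := by
        have := (Finset.sum_eq_zero_iff.mp h0) j hj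
        simpa using this
      simp [hu, this]
    · rw [← ENNReal.mul_rpow_of_nonneg _ _ (by norm_num : (0:ℝ) ≤ 1/2)]
      simp only [hu, hv]
      rw [mul_assoc, ← ENNReal.rpow_add _ _ h0 (hSfin x), neg_add_cancel, ENNReal.rpow_zero, mul_one,
        ← ENNReal.rpow_two, ← ENNReal.rpow_mul]
      norm_num
  set M : G → ℝ≥0∞ := fun x => ⨆ j ∈ J, convP (μ j) v x with hM
  have hMm : Measurable M :=
    Measurable.iSup fun j => Measurable.iSup fun _ => measurable_convP _ hvm
  set R : G → ℝ≥0∞ := fun x => ∑ j ∈ J, convP (μ j) (u j) x with hR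
  have hRm : Measurable R := Finset.measurable_fun_sum _ fun j _ => measurable_convP _ (hum j)
  have hCS : ∀ j ∈ J, ∀ x, convP (μ j) (g j) x ^ 2 ≤ convP (μ j) (u j) x * M x := by
    intro j hj x
    have h1 : convP (μ j) (g j) x ≤ convP (μ j) (u j) x ^ (1/2:ℝ) * convP (μ j) v x ^ (1/2:ℝ) := by
      have := ENNReal.lintegral_mul_norm_pow_le (μ := μ j)
        ((hum j).comp (measurable_const.sub measurable_id : Measurable fun y => x - y)).aemeasurable
        (hvm.comp (measurable_const.sub measurable_id : Measurable fun y => x - y)).aemeasurable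
        (by norm_num : (0:ℝ) ≤ 1/2) (by norm_num : (0:ℝ) ≤ 1/2) (by norm_num)
      refine le_trans (le_of_eq ?_) this
      simp only [convP]
      congr 1 with y
      exact hpt j hj _
    have h2 : convP (μ j) v x ≤ M x := le_iSup₂ (f := fun j (_ : j ∈ J) => convP (μ j) v x) j hj
    calc _ ≤ (convP (μ j) (u j) x ^ (1/2:ℝ) * convP (μ j) v x ^ (1/2:ℝ)) ^ 2 := by gcongr
      _ = convP (μ j) (u j) x * convP (μ j) v x := by
        rw [mul_pow, ← ENNReal.rpow_two, ← ENNReal.rpow_two, ← ENNReal.rpow_mul, ← ENNReal.rpow_mul]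
        norm_num
      _ ≤ _ := by gcongr
  have hRint : ∫⁻ x, R x ∂vol ≤ ∫⁻ x, S x ^ (q / 2) ∂vol := by
    have hcm : ∀ j ∈ J, Measurable fun x => convP (μ j) (u j) x := fun j _ =>
      measurable_convP _ (hum j)
    have hcm2 : ∀ j ∈ J, Measurable fun x => u j x := fun j _ => hum j
    calc ∫⁻ x, R x ∂vol = ∑ j ∈ J, ∫⁻ x, u j x ∂vol := by
          simp only [hR]
          rw [lintegral_finsetSum _ hcm]
          refine Finset.sum_congr rfl fun j _ => ?_
          rw [lintegral_convP _ _ (hum j)]; simp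
      _ = ∫⁻ x, ∑ j ∈ J, u j x ∂vol := (lintegral_finsetSum _ hcm2).symm
      _ ≤ _ := by
          refine lintegral_mono fun x => ?_
          simp only [hu]
          rw [← Finset.sum_mul]
          change S x * S x ^ (-a) ≤ _
          rcases eq_or_ne (S x) 0 with h0 | h0
          · simp [h0]
          · nth_rewrite 1 [← ENNReal.rpow_one (S x)]
            rw [← ENNReal.rpow_add _ _ h0 (hSfin x)]
            refine le_of_eq ?_
            congr 1; linarith
  have hMint : ∫⁻ x, M x ^ p ∂vol ≤ B * ∫⁻ x, S x ^ (q / 2) ∂vol := by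
    refine (hB v hvm).trans (le_of_eq ?_)
    congr 2 with x
    simp only [hv]
    rw [← ENNReal.rpow_mul]
    congr 1; rw [ha]; field_simp
  set X := ∫⁻ x, S x ^ (q / 2) ∂vol
  calc ∫⁻ x, (∑ j ∈ J, convP (μ j) (g j) x ^ 2) ^ (q / 2) ∂vol
      ≤ ∫⁻ x, R x ^ (q / 2) * (M x ^ p) ^ a ∂vol := by
        refine lintegral_mono fun x => ?_
        calc _ ≤ (R x * M x) ^ (q / 2) := by
              refine ENNReal.rpow_le_rpow ?_ (by positivity)
              simp only [hR]
              rw [Finset.sum_mul]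
              exact Finset.sum_le_sum fun j hj => hCS j hj x
          _ = _ := by
              rw [ENNReal.mul_rpow_of_nonneg _ _ (by positivity), ← ENNReal.rpow_mul]
              congr 2; rw [ha]; field_simp
    _ ≤ (∫⁻ x, R x ∂vol) ^ (q / 2) * (∫⁻ x, M x ^ p ∂vol) ^ a :=
        ENNReal.lintegral_mul_norm_pow_le hRm.aemeasurable (hMm.pow_const p).aemeasurable
          (by positivity) ha0.le hrel
    _ ≤ X ^ (q / 2) * (B * X) ^ a := by gcongr
    _ = B ^ a * X := by
        rw [ENNReal.mul_rpow_of_nonneg _ _ ha0.le, mul_left_comm,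
          ← ENNReal.rpow_add_of_nonneg _ _ (by positivity) ha0.le, hrel, ENNReal.rpow_one]

/-! ### Real interpolation between `L^q` and `L²` -/

theorem lintegral_Ioi_scale {η r : ℝ} (hr : 0 < r) {h : ℝ → ℝ≥0∞} (hh : Measurable h) :
    ∫⁻ t in Ioi (0:ℝ), ENNReal.ofReal (t ^ (-η - 1)) * h (r * t) =
      ENNReal.ofReal (r ^ η) * ∫⁻ t in Ioi (0:ℝ), ENNReal.ofReal (t ^ (-η - 1)) * h t := by
  set H : ℝ → ℝ≥0∞ := (Ioi 0).indicator fun t => ENNReal.ofReal (t ^ (-η - 1)) * h t with hH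
  have hHm : Measurable H := by
    refine Measurable.indicator (Measurable.mul ?_ hh) measurableSet_Ioi
    fun_prop
  have e1 : ∀ t, (Ioi (0:ℝ)).indicator (fun t => ENNReal.ofReal (t ^ (-η - 1)) * h (r * t)) t =
      ENNReal.ofReal (r ^ (η + 1)) * H (r * t) := by
    intro t
    by_cases ht : 0 < t
    · have : 0 < r * t := mul_pos hr ht
      rw [indicator_of_mem (mem_Ioi.mpr ht), hH, indicator_of_mem (mem_Ioi.mpr this), ← mul_assoc,
        ← ENNReal.ofReal_mul (by positivity), Real.mul_rpow hr.le ht.le, ← mul_assoc,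
        ← Real.rpow_add hr]
      congr 2
      ring_nf
      simp
    · have : ¬ 0 < r * t := fun h => ht (by
        rcases (mul_pos_iff.mp h) with h | h
        · exact h.2
        · linarith [h.1])
      rw [indicator_of_notMem (by simpa using ht), hH, indicator_of_notMem (by simpa using this),
        mul_zero]
  rw [← lintegral_indicator measurableSet_Ioi, ← lintegral_indicator measurableSet_Ioi]
  simp_rw [e1]
  rw [lintegral_const_mul' _ _ ENNReal.ofReal_ne_top]
  have e2 : ∫⁻ t, H (r * t) = ENNReal.ofReal |r⁻¹| * ∫⁻ t, H t := by
    rw [← lintegral_map hHm (measurable_const_mul r), Real.map_volume_mul_left hr.ne',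
      lintegral_smul_measure]
    rfl
  rw [e2, ← mul_assoc, ← ENNReal.ofReal_mul (by positivity), abs_of_pos (by positivity),
    Real.rpow_add hr, Real.rpow_one, mul_assoc, mul_inv_cancel₀ hr.ne', mul_one]

/-- The normalising constant of the real interpolation method. -/
def cK (η : ℝ) : ℝ≥0∞ :=
  ∫⁻ t in Ioi (0:ℝ), ENNReal.ofReal (t ^ (-η - 1)) * min 1 (ENNReal.ofReal t)

theorem cK_ne_top {η : ℝ} (h0 : 0 < η) (h1 : η < 1) : cK η ≠ ∞ := by
  have hsplit : Ioi (0:ℝ) = Ioc 0 1 ∪ Ioi 1 := (Ioc_union_Ioi_eq_Ioi zero_le_one).symm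
  have hA : ∫⁻ t in Ioc (0:ℝ) 1, ENNReal.ofReal (t ^ (-η - 1)) * min 1 (ENNReal.ofReal t) ≠ ∞ := by
    have hi : IntegrableOn (fun t : ℝ => t ^ (-η)) (Ioc 0 1) := by
      rw [← intervalIntegrable_iff_integrableOn_Ioc_of_le zero_le_one]
      exact intervalIntegral.intervalIntegrable_rpow' (by linarith)
    refine ne_top_of_le_ne_top hi.2.ne (setLIntegral_mono' measurableSet_Ioc fun t ht => ?_)
    calc _ ≤ ENNReal.ofReal (t ^ (-η - 1)) * ENNReal.ofReal t := by gcongr; exact min_le_right _ _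
      _ = ENNReal.ofReal (t ^ (-η)) := by
        rw [← ENNReal.ofReal_mul (Real.rpow_nonneg ht.1.le _)]
        congr 1
        nth_rewrite 2 [← Real.rpow_one t]
        rw [← Real.rpow_add ht.1]; congr 1; ring
      _ ≤ _ := Real.ofReal_le_enorm _
  have hB : ∫⁻ t in Ioi (1:ℝ), ENNReal.ofReal (t ^ (-η - 1)) * min 1 (ENNReal.ofReal t) ≠ ∞ := by
    have hi : IntegrableOn (fun t : ℝ => t ^ (-η - 1)) (Ioi 1) :=
      integrableOn_Ioi_rpow_of_lt (by linarith) one_pos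
    refine ne_top_of_le_ne_top hi.2.ne (setLIntegral_mono' measurableSet_Ioi fun t ht => ?_)
    calc _ ≤ ENNReal.ofReal (t ^ (-η - 1)) * 1 := by gcongr; exact min_le_left _ _
      _ ≤ _ := by rw [mul_one]; exact Real.ofReal_le_enorm _
  rw [cK, hsplit]
  exact ne_top_of_le_ne_top (ENNReal.add_ne_top.mpr ⟨hA, hB⟩) (lintegral_union_le _ _ _)

theorem cK_ne_zero {η : ℝ} : cK η ≠ 0 := by
  have hm : Measurable fun t : ℝ => ENNReal.ofReal (t ^ (-η - 1)) * min 1 (ENNReal.ofReal t) := by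
    fun_prop
  rw [cK, Ne, lintegral_eq_zero_iff hm]
  intro h
  have h2 : ∀ᵐ t ∂(volume.restrict (Ioi (0:ℝ))), False := by
    filter_upwards [h, ae_restrict_mem measurableSet_Ioi] with t ht h0
    have h0 : 0 < t := h0
    have : 0 < t ^ (-η - 1) := by positivity
    have h3 : ENNReal.ofReal (t ^ (-η - 1)) * min 1 (ENNReal.ofReal t) = 0 := ht
    rw [mul_eq_zero] at h3
    rcases h3 with h3 | h3
    · rw [ENNReal.ofReal_eq_zero] at h3; linarith
    · rcases min_choice 1 (ENNReal.ofReal t) with h4 | h4 <;> rw [h4] at h3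
      · exact one_ne_zero h3
      · rw [ENNReal.ofReal_eq_zero] at h3; linarith
  rw [eventually_false_iff_eq_bot, ae_eq_bot, Measure.restrict_eq_zero] at h2
  simp at h2

/-- The profile `min (a^q, t a²)`. -/
def Gt (q t : ℝ) (a : ℝ≥0∞) : ℝ≥0∞ := min (a ^ q) (ENNReal.ofReal t * a ^ 2)

theorem Gt_mono {q t : ℝ} (hq : 0 ≤ q) {a b : ℝ≥0∞} (h : a ≤ b) : Gt q t a ≤ Gt q t b := by
  unfold Gt; gcongr

theorem Gt_add_le {q t : ℝ} (hq : 0 ≤ q) (hq2 : q ≤ 2) (a b : ℝ≥0∞) :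
    Gt q t (a + b) ≤ 4 * (a ^ q + ENNReal.ofReal t * b ^ 2) := by
  rcases le_total b a with h | h
  · calc Gt q t (a + b) ≤ (2 * a) ^ q := (min_le_left _ _).trans (by rw [two_mul]; gcongr)
      _ ≤ 4 * a ^ q := by
        rw [ENNReal.mul_rpow_of_nonneg _ _ hq]
        gcongr
        calc (2:ℝ≥0∞) ^ q ≤ 2 ^ (2:ℝ) := ENNReal.rpow_le_rpow_of_exponent_le (by norm_num) hq2
          _ = 4 := by rw [ENNReal.rpow_two]; norm_num
      _ ≤ _ := by gcongr; exact le_self_add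
  · calc Gt q t (a + b) ≤ ENNReal.ofReal t * (2 * b) ^ 2 :=
          (min_le_right _ _).trans (by rw [two_mul]; gcongr)
      _ = 4 * (ENNReal.ofReal t * b ^ 2) := by ring
      _ ≤ _ := by gcongr; exact le_add_self

theorem lintegral_Gt {q p η : ℝ} (hq : 0 < q) (h0 : 0 < η) (h1 : η < 1)
    (hp : p = (1 - η) * q + 2 * η) (a : ℝ≥0∞) :
    ∫⁻ t in Ioi (0:ℝ), ENNReal.ofReal (t ^ (-η - 1)) * Gt q t a = cK η * a ^ p := by
  have hp0 : 0 < p := by rw [hp]; nlinarith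
  rcases eq_or_ne a 0 with rfl | ha0
  · simp [Gt, ENNReal.zero_rpow_of_pos hq, ENNReal.zero_rpow_of_pos hp0]
  rcases eq_or_ne a ∞ with rfl | haT
  · rw [ENNReal.top_rpow_of_pos hp0, ENNReal.mul_top cK_ne_zero]
    have : ∀ t ∈ Ioi (0:ℝ), ENNReal.ofReal (t ^ (-η - 1)) * Gt q t ∞ = ∞ := by
      intro t ht
      have ht : 0 < t := ht
      have h2 : ENNReal.ofReal (t ^ (-η - 1)) ≠ 0 := by
        rw [Ne, ENNReal.ofReal_eq_zero, not_le]; positivity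
      have h3 : ENNReal.ofReal t ≠ 0 := by rw [Ne, ENNReal.ofReal_eq_zero, not_le]; exact ht
      simp [Gt, ENNReal.top_rpow_of_pos hq, ENNReal.mul_top h3, ENNReal.mul_top h2]
    rw [setLIntegral_congr_fun measurableSet_Ioi this]
    simp
  lift a to ℝ≥0 using haT
  have har : 0 < (a:ℝ) := by
    rw [NNReal.coe_pos, pos_iff_ne_zero]; exact_mod_cast ha0
  have hae : (a:ℝ≥0∞) = ENNReal.ofReal a := by simp
  have e : ∀ t : ℝ, 0 < t → Gt q t a =
      (a:ℝ≥0∞) ^ q * min 1 (ENNReal.ofReal ((a:ℝ) ^ (2 - q) * t)) := by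
    intro t ht
    rw [mul_min, mul_one, Gt]
    congr 1
    rw [hae, ← ENNReal.rpow_two, ENNReal.ofReal_rpow_of_pos har, ENNReal.ofReal_rpow_of_pos har,
      ← ENNReal.ofReal_mul ht.le, ← ENNReal.ofReal_mul (by positivity), ← mul_assoc,
      ← Real.rpow_add har]
    congr 1
    rw [mul_comm]; congr 2; ring
  have e2 : ∫⁻ t in Ioi (0:ℝ), ENNReal.ofReal (t ^ (-η - 1)) * Gt q t a =
      (a:ℝ≥0∞) ^ q * ∫⁻ t in Ioi (0:ℝ), ENNReal.ofReal (t ^ (-η - 1)) *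
        min 1 (ENNReal.ofReal ((a:ℝ) ^ (2 - q) * t)) := by
    rw [← lintegral_const_mul' _ _ (by simp [hq.le])]
    refine setLIntegral_congr_fun measurableSet_Ioi fun t ht => ?_
    rw [e t ht]; ring
  have hm : Measurable fun s : ℝ => min 1 (ENNReal.ofReal s) := by fun_prop
  rw [e2, lintegral_Ioi_scale (h := fun s => min 1 (ENNReal.ofReal s)) (by positivity) hm, ← cK,
    mul_comm (cK η), ← mul_assoc]
  congr 1
  rw [hae, ENNReal.ofReal_rpow_of_pos har, ENNReal.ofReal_rpow_of_pos har,
    ← ENNReal.ofReal_mul (by positivity), ← Real.rpow_mul har.le, ← Real.rpow_add har]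
  congr 2
  rw [hp]; ring

theorem interpolation {α : Type*} [MeasurableSpace α] (μ : Measure α) [SFinite μ]
    {q p η A0 A1 : ℝ} (hq : 0 < q) (hq2 : q < 2) (h0 : 0 < η) (h1 : η < 1)
    (hp : p = (1 - η) * q + 2 * η) (hA0 : 0 < A0) (hA1 : 0 < A1)
    (P : (α → ℝ) → Prop) (T : (α → ℝ) → α → ℝ≥0∞)
    (hPm : ∀ f, P f → Measurable f)
    (hPs : ∀ f (s : Set α), P f → MeasurableSet s → P (s.indicator f))
    (hTm : ∀ f, P f → Measurable (T f))
    (hTs : ∀ f (s : Set α) x, P f → MeasurableSet s →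
      T f x ≤ T (s.indicator f) x + T (sᶜ.indicator f) x)
    (hTq : ∀ f, P f → ∫⁻ x, T f x ^ q ∂μ ≤ ENNReal.ofReal A0 * ∫⁻ x, ‖f x‖ₑ ^ q ∂μ)
    (hT2 : ∀ f, P f → ∫⁻ x, T f x ^ 2 ∂μ ≤ ENNReal.ofReal A1 * ∫⁻ x, ‖f x‖ₑ ^ 2 ∂μ)
    (f : α → ℝ) (hf : P f) :
    ∫⁻ x, T f x ^ p ∂μ ≤ 4 * ENNReal.ofReal (A0 ^ (1 - η) * A1 ^ η) * ∫⁻ x, ‖f x‖ₑ ^ p ∂μ := by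
  have hp0 : 0 < p := by rw [hp]; nlinarith
  have hfm := hPm f hf
  have hGm : ∀ g : α → ℝ≥0∞, Measurable g → ∀ r : ℝ,
      Measurable fun z : α × ℝ => ENNReal.ofReal (z.2 ^ (-η - 1)) * Gt q (r * z.2) (g z.1) := by
    intro g hg r
    unfold Gt
    fun_prop
  have key : ∀ g : α → ℝ≥0∞, Measurable g → ∀ r : ℝ, 0 < r →
      ∫⁻ t in Ioi (0:ℝ), ENNReal.ofReal (t ^ (-η - 1)) * ∫⁻ x, Gt q (r * t) (g x) ∂μ =
        ENNReal.ofReal (r ^ η) * (cK η * ∫⁻ x, g x ^ p ∂μ) := by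
    intro g hg r hr
    simp_rw [← lintegral_const_mul' _ _ ENNReal.ofReal_ne_top]
    have hsw : AEMeasurable (Function.uncurry fun (t : ℝ) (x : α) =>
        ENNReal.ofReal (t ^ (-η - 1)) * Gt q (r * t) (g x))
        ((volume.restrict (Ioi (0:ℝ))).prod μ) :=
      ((hGm g hg r).comp measurable_swap).aemeasurable
    rw [lintegral_lintegral_swap hsw]
    rw [← lintegral_const_mul _ (hg.pow_const p),
      ← lintegral_const_mul' _ _ ENNReal.ofReal_ne_top]
    congr 1 with x
    have hm : Measurable fun s : ℝ => Gt q s (g x) := by unfold Gt; fun_prop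
    rw [lintegral_Ioi_scale (h := fun s => Gt q s (g x)) hr hm, lintegral_Gt hq h0 h1 hp]
  have main : ∀ t : ℝ, 0 < t → ∫⁻ x, Gt q (1 * t) (T f x) ∂μ ≤
      4 * ENNReal.ofReal A0 * ∫⁻ x, Gt q (A1 / A0 * t) ‖f x‖ₑ ∂μ := by
    intro t ht
    rw [one_mul]
    set r := A1 / A0 * t with hr
    have hr0 : 0 < r := by positivity
    set l : ℝ := r ^ (-(2 - q)⁻¹) with hl
    have hl0 : 0 < l := by positivity
    have hlr : l ^ (2 - q) = r⁻¹ := by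
      rw [hl, ← Real.rpow_mul hr0.le, neg_mul, inv_mul_cancel₀ (by linarith), Real.rpow_neg_one]
    set s : Set α := {x | l < |f x|} with hs
    have hsm : MeasurableSet s := measurableSet_lt measurable_const (measurable_norm.comp hfm)
    have hf0 := hPs f s hf hsm
    have hf1 := hPs f sᶜ hf hsm.compl
    have hpt : ∀ x, ‖s.indicator f x‖ₑ ^ q + ENNReal.ofReal r * ‖sᶜ.indicator f x‖ₑ ^ 2 ≤
        Gt q r ‖f x‖ₑ := by
      intro x
      have hc : ∀ a : ℝ, 0 < a → ‖f x‖ = a → ‖f x‖ₑ ^ q = ENNReal.ofReal (a ^ q) ∧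
          ENNReal.ofReal r * ‖f x‖ₑ ^ 2 = ENNReal.ofReal (a ^ q * (r * a ^ (2 - q))) := by
        intro a ha hfa
        have : ‖f x‖ₑ = ENNReal.ofReal a := by rw [← ofReal_norm, hfa]
        rw [this, ← ENNReal.rpow_two, ENNReal.ofReal_rpow_of_pos ha, ENNReal.ofReal_rpow_of_pos ha,
          ← ENNReal.ofReal_mul hr0.le, mul_left_comm, ← Real.rpow_add ha]
        norm_num
      by_cases hx : x ∈ s
      · have hx' : x ∉ sᶜ := fun h => h hx
        rw [indicator_of_mem hx, indicator_of_notMem hx']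
        simp only [enorm_zero, ne_eq, OfNat.ofNat_ne_zero, not_false_eq_true, zero_pow, mul_zero,
          add_zero]
        have hx : l < |f x| := hx
        obtain ⟨e1, e2⟩ := hc |f x| (hl0.trans hx) rfl
        rw [Gt, e1, e2]
        refine le_min le_rfl (ENNReal.ofReal_le_ofReal ?_)
        refine le_mul_of_one_le_right (by positivity) ?_
        have : l ^ (2 - q) ≤ |f x| ^ (2 - q) := Real.rpow_le_rpow hl0.le hx.le (by linarith)
        rw [hlr] at this
        calc (1:ℝ) = r * r⁻¹ := by field_simp
          _ ≤ _ := by gcongr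
      · have hx' : x ∈ sᶜ := hx
        rw [indicator_of_notMem hx, indicator_of_mem hx']
        rw [enorm_zero, ENNReal.zero_rpow_of_pos hq, zero_add]
        rcases eq_or_ne (f x) 0 with hz | hz
        · simp [hz]
        have hx : |f x| ≤ l := not_lt.mp hx
        obtain ⟨e1, e2⟩ := hc |f x| (abs_pos.mpr hz) rfl
        rw [Gt, e1, e2]
        refine le_min (ENNReal.ofReal_le_ofReal ?_) le_rfl
        refine mul_le_of_le_one_right (by positivity) ?_
        have : |f x| ^ (2 - q) ≤ l ^ (2 - q) := Real.rpow_le_rpow (abs_nonneg _) hx (by linarith)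
        rw [hlr] at this
        calc r * |f x| ^ (2 - q) ≤ r * r⁻¹ := by gcongr
          _ = 1 := by field_simp
    have hAr : ENNReal.ofReal t * ENNReal.ofReal A1 = ENNReal.ofReal A0 * ENNReal.ofReal r := by
      rw [← ENNReal.ofReal_mul ht.le, ← ENNReal.ofReal_mul hA0.le, hr]
      congr 1; field_simp
    have m0 : Measurable fun x => ‖s.indicator f x‖ₑ ^ q := (hPm _ hf0).enorm.pow_const q
    have m1 : Measurable fun x => ‖sᶜ.indicator f x‖ₑ ^ 2 := (hPm _ hf1).enorm.pow_const 2
    have mT0 : Measurable fun x => T (s.indicator f) x ^ q := (hTm _ hf0).pow_const q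
    have mT1 : Measurable fun x => T (sᶜ.indicator f) x ^ 2 := (hTm _ hf1).pow_const 2
    calc ∫⁻ x, Gt q t (T f x) ∂μ
        ≤ ∫⁻ x, 4 * (T (s.indicator f) x ^ q + ENNReal.ofReal t * T (sᶜ.indicator f) x ^ 2) ∂μ :=
          lintegral_mono fun x => (Gt_mono hq.le (hTs f s x hf hsm)).trans
            (Gt_add_le hq.le hq2.le _ _)
      _ = 4 * (∫⁻ x, T (s.indicator f) x ^ q ∂μ +
            ENNReal.ofReal t * ∫⁻ x, T (sᶜ.indicator f) x ^ 2 ∂μ) := by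
          rw [lintegral_const_mul' _ _ (by simp), lintegral_add_left mT0,
            lintegral_const_mul' _ _ ENNReal.ofReal_ne_top]
      _ ≤ 4 * (ENNReal.ofReal A0 * ∫⁻ x, ‖s.indicator f x‖ₑ ^ q ∂μ +
            ENNReal.ofReal t * (ENNReal.ofReal A1 * ∫⁻ x, ‖sᶜ.indicator f x‖ₑ ^ 2 ∂μ)) := by
          gcongr
          · exact hTq _ hf0
          · exact hT2 _ hf1
      _ = 4 * ENNReal.ofReal A0 * ∫⁻ x, (‖s.indicator f x‖ₑ ^ q +
            ENNReal.ofReal r * ‖sᶜ.indicator f x‖ₑ ^ 2) ∂μ := by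
          rw [lintegral_add_left m0, lintegral_const_mul' _ _ ENNReal.ofReal_ne_top,
            ← mul_assoc (ENNReal.ofReal t), hAr]
          ring
      _ ≤ _ := by
          gcongr with x
          exact hpt x
  have hK := cK_ne_top h0 h1
  have h2 : cK η * ∫⁻ x, T f x ^ p ∂μ ≤
      cK η * (4 * ENNReal.ofReal (A0 ^ (1 - η) * A1 ^ η) * ∫⁻ x, ‖f x‖ₑ ^ p ∂μ) := by
    have k1 := key (T f) (hTm f hf) 1 one_pos
    have k2 := key (fun x => ‖f x‖ₑ) hfm.enorm (A1 / A0) (by positivity)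
    rw [Real.one_rpow, ENNReal.ofReal_one, one_mul] at k1
    rw [← k1]
    calc _ ≤ ∫⁻ t in Ioi (0:ℝ), (4 * ENNReal.ofReal A0) * (ENNReal.ofReal (t ^ (-η - 1)) *
          ∫⁻ x, Gt q (A1 / A0 * t) ‖f x‖ₑ ∂μ) := by
          refine setLIntegral_mono' measurableSet_Ioi fun t ht => ?_
          rw [mul_left_comm]
          gcongr
          exact main t ht
      _ = _ := by
          rw [lintegral_const_mul' _ _ (ENNReal.mul_ne_top (by simp) ENNReal.ofReal_ne_top), k2]
          have : ENNReal.ofReal (A0 ^ (1 - η) * A1 ^ η) =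
              ENNReal.ofReal A0 * ENNReal.ofReal ((A1 / A0) ^ η) := by
            rw [← ENNReal.ofReal_mul hA0.le]
            congr 1
            rw [Real.div_rpow hA1.le hA0.le, Real.rpow_sub hA0, Real.rpow_one]
            field_simp
          rw [this]; ring
  exact (ENNReal.mul_le_mul_iff_right cK_ne_zero hK).mp h2

/-! ### Oscillatory integrals -/

/-- The phase `α t + β t^b`. -/
def phs (b α β t : ℝ) : ℝ := α * t + β * t ^ b

/-- The oscillatory factor `exp (i (α t + β t^b))`. -/
def osc (b α β t : ℝ) : ℂ := Complex.exp ((phs b α β t : ℂ) * Complex.I)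

theorem norm_osc (b α β t : ℝ) : ‖osc b α β t‖ = 1 := Complex.norm_exp_ofReal_mul_I _

theorem hasDerivAt_phs (b α β : ℝ) {t : ℝ} (ht : 0 < t) :
    HasDerivAt (phs b α β) (α + β * (b * t ^ (b - 1))) t := by
  have h1 : HasDerivAt (fun t : ℝ => t ^ b) (b * t ^ (b - 1)) t :=
    Real.hasDerivAt_rpow_const (Or.inl ht.ne')
  have h2 : HasDerivAt (fun t : ℝ => α * t) α t := by
    simpa using (hasDerivAt_id t).const_mul α
  exact h2.add (h1.const_mul β)

theorem hasDerivAt_osc (b α β : ℝ) {t : ℝ} (ht : 0 < t) :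
    HasDerivAt (osc b α β) (osc b α β t * (((α + β * (b * t ^ (b - 1)) : ℝ) : ℂ) * Complex.I)) t :=
  (((hasDerivAt_phs b α β ht).ofReal_comp).mul_const Complex.I).cexp

theorem continuousOn_osc (b α β : ℝ) : ContinuousOn (osc b α β) (Ioi 0) := fun _ ht =>
  (hasDerivAt_osc b α β ht).continuousAt.continuousWithinAt

theorem measurable_osc (b α β : ℝ) : Measurable (osc b α β) := by
  unfold osc phs; fun_prop

theorem intervalIntegrable_osc (b α β u v : ℝ) : IntervalIntegrable (osc b α β) volume u v := by
  rw [intervalIntegrable_iff]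
  have : IsFiniteMeasure (volume.restrict (Set.uIoc u v)) := by unfold uIoc; infer_instance
  refine Integrable.of_bound (measurable_osc b α β).aestronglyMeasurable 1 ?_
  exact Eventually.of_forall fun t => (norm_osc b α β t).le

theorem norm_integral_osc_le_len (b α β : ℝ) {u v : ℝ} (h : u ≤ v) :
    ‖∫ t in u..v, osc b α β t‖ ≤ v - u := by
  have := intervalIntegral.norm_integral_le_of_norm_le_const (a := u) (b := v) (C := 1)
    (f := osc b α β) fun t _ => (norm_osc b α β t).le
  rwa [one_mul, abs_of_nonneg (by linarith)] at this

theorem vdc_first {b α β l a c : ℝ} (hb : 1 < b) (hl : 0 < l) (ha : 1 ≤ a) (hac : a ≤ c)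
    (h : ∀ t ∈ Icc a c, l ≤ |α + β * (b * t ^ (b - 1))|) :
    ‖∫ t in a..c, osc b α β t‖ ≤ 4 / l := by
  set d : ℝ → ℝ := fun t => α + β * (b * t ^ (b - 1)) with hd
  set d2 : ℝ → ℝ := fun t => β * (b * ((b - 1) * t ^ (b - 1 - 1))) with hd2
  have hpos : ∀ t ∈ Icc a c, 0 < t := fun t ht => by linarith [ht.1]
  have hu : uIcc a c = Icc a c := uIcc_of_le hac
  have hdne : ∀ t ∈ Icc a c, d t ≠ 0 := fun t ht h0 => by
    have := h t ht
    change l ≤ |d t| at this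
    rw [h0, abs_zero] at this; linarith
  have hdd : ∀ t ∈ Icc a c, HasDerivAt d (d2 t) t := by
    intro t ht
    exact (((Real.hasDerivAt_rpow_const (Or.inl (hpos t ht).ne')).const_mul b).const_mul β).const_add α
  have hdinv : ∀ t ∈ Icc a c, HasDerivAt (fun t => (d t)⁻¹) (-d2 t / d t ^ 2) t := fun t ht =>
    (hdd t ht).inv (hdne t ht)
  have hcd : ContinuousOn d (Icc a c) := fun t ht => (hdd t ht).continuousAt.continuousWithinAt
  have hcd2 : ContinuousOn d2 (Icc a c) := by
    have : ContinuousOn (fun t : ℝ => t ^ (b - 1 - 1)) (Icc a c) := fun t ht =>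
      (Real.continuousAt_rpow_const t _ (Or.inl (hpos t ht).ne')).continuousWithinAt
    exact continuousOn_const.mul (continuousOn_const.mul (continuousOn_const.mul this))
  have hcq : ContinuousOn (fun t => -d2 t / d t ^ 2) (Icc a c) :=
    hcd2.neg.div (hcd.pow 2) fun t ht => pow_ne_zero 2 (hdne t ht)
  have hco : ContinuousOn (osc b α β) (Icc a c) :=
    (continuousOn_osc b α β).mono fun t ht => hpos t ht
  have hG : ∀ t ∈ uIcc a c, HasDerivAt
      (fun t => osc b α β t * (((d t)⁻¹ : ℝ) : ℂ) * (-Complex.I))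
      (osc b α β t - Complex.I * (osc b α β t * ((-d2 t / d t ^ 2 : ℝ) : ℂ))) t := by
    intro t ht
    rw [hu] at ht
    have h1 := ((hasDerivAt_osc b α β (hpos t ht)).mul (hdinv t ht).ofReal_comp).mul_const
      (-Complex.I)
    refine h1.congr_deriv ?_
    have hne : (d t : ℂ) ≠ 0 := by exact_mod_cast hdne t ht
    change (osc b α β t * ((d t : ℂ) * Complex.I) * (((d t)⁻¹ : ℝ) : ℂ) + _) * _ = _
    push_cast
    field_simp
    ring_nf
    simp only [Complex.I_sq]
    ring
  have hco2 : ContinuousOn (fun t => osc b α β t * ((-d2 t / d t ^ 2 : ℝ) : ℂ)) (Icc a c) :=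
    hco.mul (Complex.continuous_ofReal.comp_continuousOn hcq)
  have hint2 : IntervalIntegrable (fun t => osc b α β t * ((-d2 t / d t ^ 2 : ℝ) : ℂ)) volume a c :=
    (by rw [← hu] at hco2; exact hco2.intervalIntegrable)
  have hF := intervalIntegral.integral_eq_sub_of_hasDerivAt hG
    ((intervalIntegrable_osc b α β a c).sub (hint2.const_mul Complex.I))
  rw [intervalIntegral.integral_sub (intervalIntegrable_osc b α β a c)
    (hint2.const_mul Complex.I), intervalIntegral.integral_const_mul] at hF
  have hsgn : (∀ t ∈ Icc a c, |(-d2 t / d t ^ 2)| = -d2 t / d t ^ 2) ∨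
      (∀ t ∈ Icc a c, |(-d2 t / d t ^ 2)| = -(-d2 t / d t ^ 2)) := by
    rcases le_total 0 β with hβ | hβ
    · right
      intro t ht
      have := (hpos t ht)
      refine abs_of_nonpos ?_
      rw [neg_div, neg_nonpos]
      have : 0 ≤ b - 1 := by linarith
      simp only [hd2]; positivity
    · left
      intro t ht
      have := (hpos t ht)
      refine abs_of_nonneg ?_
      have : 0 ≤ b - 1 := by linarith
      have h3 : 0 ≤ -d2 t := by
        simp only [hd2, ← neg_mul]
        have : 0 ≤ -β := by linarith
        positivity
      positivity
  have hiq : IntervalIntegrable (fun t => -d2 t / d t ^ 2) volume a c :=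
    (by rw [← hu] at hcq; exact hcq.intervalIntegrable)
  have hFu := intervalIntegral.integral_eq_sub_of_hasDerivAt
    (fun t ht => hdinv t (by rwa [hu] at ht)) hiq
  have hinv : ∀ t ∈ Icc a c, |(d t)⁻¹| ≤ 1 / l := fun t ht => by
    rw [abs_inv, ← one_div]
    exact one_div_le_one_div_of_le hl (h t ht)
  have ia := hinv a (left_mem_Icc.mpr hac)
  have ic := hinv c (right_mem_Icc.mpr hac)
  have hb2 : ‖∫ t in a..c, osc b α β t * ((-d2 t / d t ^ 2 : ℝ) : ℂ)‖ ≤ 2 / l := by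
    have h1 : ‖∫ t in a..c, osc b α β t * ((-d2 t / d t ^ 2 : ℝ) : ℂ)‖ ≤
        ∫ t in a..c, |(-d2 t / d t ^ 2)| := by
      refine (intervalIntegral.norm_integral_le_integral_norm hac).trans (le_of_eq ?_)
      congr 1 with t
      rw [norm_mul, norm_osc, one_mul, Complex.norm_real, Real.norm_eq_abs]
    have h2 : ∫ t in a..c, |(-d2 t / d t ^ 2)| ≤ |(d c)⁻¹ - (d a)⁻¹| := by
      rcases hsgn with hs | hs
      · rw [intervalIntegral.integral_congr (g := fun t => -d2 t / d t ^ 2)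
          (fun t ht => hs t (by rwa [hu] at ht)), hFu]
        exact le_abs_self _
      · rw [intervalIntegral.integral_congr (g := fun t => -(-d2 t / d t ^ 2))
          (fun t ht => hs t (by rwa [hu] at ht)), intervalIntegral.integral_neg, hFu]
        exact neg_le_abs _
    have h3 : |(d c)⁻¹ - (d a)⁻¹| ≤ 1 / l + 1 / l := (abs_sub _ _).trans (add_le_add ic ia)
    have : 2 / l = 1 / l + 1 / l := by ring
    linarith
  have hGn : ∀ t, ‖osc b α β t * (((d t)⁻¹ : ℝ) : ℂ) * (-Complex.I)‖ = |(d t)⁻¹| := fun t => by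
    rw [norm_mul, norm_mul, norm_osc, Complex.norm_real, norm_neg, Complex.norm_I, Real.norm_eq_abs]
    ring
  have hfin : ∫ t in a..c, osc b α β t =
      (osc b α β c * (((d c)⁻¹ : ℝ) : ℂ) * (-Complex.I) -
        osc b α β a * (((d a)⁻¹ : ℝ) : ℂ) * (-Complex.I)) +
      Complex.I * ∫ t in a..c, osc b α β t * ((-d2 t / d t ^ 2 : ℝ) : ℂ) := by
    rw [← hF]; ring
  rw [hfin]
  refine (norm_add_le _ _).trans ?_
  have h4 := norm_sub_le (osc b α β c * (((d c)⁻¹ : ℝ) : ℂ) * (-Complex.I))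
    (osc b α β a * (((d a)⁻¹ : ℝ) : ℂ) * (-Complex.I))
  rw [hGn, hGn] at h4
  rw [norm_mul, Complex.norm_I, one_mul]
  have : 4 / l = 1 / l + 1 / l + 2 / l := by ring
  linarith

/-- Lower bound for the derivative increments of `t^b` on `[1,2]`. -/
def vm (b : ℝ) : ℝ := b * (b - 1) * min 1 ((2:ℝ) ^ (b - 2))

theorem vm_pos {b : ℝ} (hb : 1 < b) : 0 < vm b := by
  unfold vm
  have : 0 < b - 1 := by linarith
  positivity

theorem rpow_incr {b s t : ℝ} (hb : 1 < b) (hs : 1 ≤ s) (hst : s ≤ t) (ht : t ≤ 2) :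
    vm b * (t - s) ≤ b * t ^ (b - 1) - b * s ^ (b - 1) := by
  have hder : ∀ x ∈ Ici (1:ℝ), HasDerivAt (fun x : ℝ => b * x ^ (b - 1))
      (b * ((b - 1) * x ^ (b - 1 - 1))) x := fun x hx =>
    (Real.hasDerivAt_rpow_const (Or.inl (by have : (1:ℝ) ≤ x := hx; positivity))).const_mul b
  have := (convex_Icc s t).mul_sub_le_image_sub_of_le_deriv (f := fun x : ℝ => b * x ^ (b - 1))
    (fun x hx => (hder x (hs.trans hx.1)).continuousAt.continuousWithinAt)
    (fun x hx => (hder x (hs.trans (interior_subset hx).1)).differentiableAt.differentiableWithinAt)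
    (C := vm b) (fun x hx => by
      have hx' := interior_subset hx
      have h1 : 1 ≤ x := hs.trans hx'.1
      have h2 : x ≤ 2 := hx'.2.trans ht
      rw [(hder x h1).deriv, vm, mul_assoc]
      have hb1 : 0 ≤ b - 1 := by linarith
      have : min 1 ((2:ℝ) ^ (b - 2)) ≤ x ^ (b - 1 - 1) := by
        rw [show b - 1 - 1 = b - 2 by ring]
        rcases le_total 0 (b - 2) with h | h
        · exact (min_le_left _ _).trans (Real.one_le_rpow h1 h)
        · exact (min_le_right _ _).trans
            (Real.rpow_le_rpow_of_nonpos (by linarith) h2 h)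
      gcongr)
    s (left_mem_Icc.mpr hst) t (right_mem_Icc.mpr hst) hst
  exact this

theorem exists_center {b α β : ℝ} (hb : 1 < b) (hβ : 0 < β) :
    ∃ z, ∀ t ∈ Icc (1:ℝ) 2, β * vm b * |t - z| ≤ |α + β * (b * t ^ (b - 1))| := by
  set d : ℝ → ℝ := fun t => α + β * (b * t ^ (b - 1)) with hd
  have hvm := vm_pos hb
  have hincr : ∀ s t, 1 ≤ s → s ≤ t → t ≤ 2 → β * vm b * (t - s) ≤ d t - d s := by
    intro s t h1 h2 h3
    have := rpow_incr hb h1 h2 h3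
    have h4 := mul_le_mul_of_nonneg_left this hβ.le
    simp only [hd]; linarith
  rcases le_total 0 (d 1) with h1 | h1
  · refine ⟨1, fun t ht => ?_⟩
    have := hincr 1 t le_rfl ht.1 ht.2
    rw [abs_of_nonneg (by linarith [ht.1])]
    exact le_trans (by linarith) (le_abs_self (d t))
  rcases le_total (d 2) 0 with h2 | h2
  · refine ⟨2, fun t ht => ?_⟩
    have := hincr t 2 ht.1 ht.2 le_rfl
    rw [abs_of_nonpos (by linarith [ht.2])]
    exact le_trans (by linarith) (neg_le_abs (d t))
  have hc : ContinuousOn d (Icc 1 2) := fun t ht => by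
    have : (0:ℝ) < t := by linarith [ht.1]
    refine ContinuousAt.continuousWithinAt ?_
    exact continuousAt_const.add (continuousAt_const.mul (continuousAt_const.mul
      (Real.continuousAt_rpow_const t _ (Or.inl this.ne'))))
  obtain ⟨z, hz, hz0⟩ := intermediate_value_Icc (by norm_num : (1:ℝ) ≤ 2) hc ⟨h1, h2⟩
  refine ⟨z, fun t ht => ?_⟩
  rcases le_total z t with h | h
  · have := hincr z t hz.1 h ht.2
    rw [abs_of_nonneg (by linarith)]
    exact le_trans (by linarith) (le_abs_self (d t))
  · have := hincr t z ht.1 h hz.2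
    rw [abs_of_nonpos (by linarith)]
    exact le_trans (by linarith) (neg_le_abs (d t))

theorem exists_center' {b α β : ℝ} (hb : 1 < b) (hβ : β ≠ 0) :
    ∃ z, ∀ t ∈ Icc (1:ℝ) 2, |β| * vm b * |t - z| ≤ |α + β * (b * t ^ (b - 1))| := by
  rcases lt_or_gt_of_ne hβ with h | h
  · obtain ⟨z, hz⟩ := exists_center (α := -α) (β := -β) hb (by linarith)
    refine ⟨z, fun t ht => ?_⟩
    have := hz t ht
    rw [abs_of_neg h]
    rwa [show -α + -β * (b * t ^ (b - 1)) = -(α + β * (b * t ^ (b - 1))) by ring, abs_neg] at this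
  · rw [abs_of_pos h]
    exact exists_center hb h

theorem vdc_second {b α β s : ℝ} (hb : 1 < b) (hβ : β ≠ 0) (hs : 1 ≤ s) (hs2 : s ≤ 2) :
    ‖∫ t in (1:ℝ)..s, osc b α β t‖ ≤ (2 + 8 / vm b) * |β| ^ (-(1/2) : ℝ) := by
  obtain ⟨z, hz⟩ := exists_center' (α := α) hb hβ
  have hβ' : 0 < |β| := abs_pos.mpr hβ
  set e := |β| ^ (-(1/2) : ℝ) with he
  have he0 : 0 < e := by positivity
  have hvm := vm_pos hb
  have hee : |β| * e = e⁻¹ := by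
    rw [he, ← Real.rpow_neg hβ'.le]
    nth_rewrite 1 [← Real.rpow_one |β|]
    rw [← Real.rpow_add hβ']; norm_num
  set c := max 1 (min (z - e) s) with hc
  set d := max 1 (min (z + e) s) with hd
  have hc1 : 1 ≤ c := le_max_left _ _
  have hcd : c ≤ d := max_le_max le_rfl (min_le_min (by linarith) le_rfl)
  have hds : d ≤ s := max_le hs (min_le_right _ _)
  have hde : d - c ≤ 2 * e := by
    have : d ≤ c + 2 * e := by
      refine max_le (by linarith) ?_
      rcases le_total (z - e) s with h | h
      · have : z - e ≤ c := by rw [hc, min_eq_left h]; exact le_max_right _ _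
        exact (min_le_left _ _).trans (by linarith)
      · have : s ≤ c := by rw [hc, min_eq_right h]; exact le_max_right _ _
        exact (min_le_right _ _).trans (by linarith)
    linarith
  have hlow : ∀ t ∈ Icc (1:ℝ) 2, e ≤ |t - z| → e⁻¹ * vm b ≤ |α + β * (b * t ^ (b - 1))| := by
    intro t ht h
    refine le_trans ?_ (hz t ht)
    rw [← hee]
    calc |β| * e * vm b = |β| * vm b * e := by ring
      _ ≤ _ := by gcongr
  have hl : 0 < e⁻¹ * vm b := by positivity
  have h4 : 4 / (e⁻¹ * vm b) = 4 / vm b * e := by field_simp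
  have i1 : ‖∫ t in (1:ℝ)..c, osc b α β t‖ ≤ 4 / vm b * e := by
    rcases hc1.eq_or_lt with h | h
    · rw [← h, intervalIntegral.integral_same, norm_zero]; positivity
    · rw [← h4]
      refine vdc_first hb hl le_rfl hc1 fun t ht => hlow t ⟨ht.1, by linarith [ht.2]⟩ ?_
      have hcz : c ≤ z - e := by
        rcases max_choice 1 (min (z - e) s) with h' | h'
        · rw [hc, h'] at h; linarith
        · rw [hc, h']; exact min_le_left _ _
      have := ht.2
      rw [abs_of_nonpos (by linarith)]; linarith
  have i3 : ‖∫ t in d..s, osc b α β t‖ ≤ 4 / vm b * e := by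
    rcases hds.eq_or_lt with h | h
    · rw [h, intervalIntegral.integral_same, norm_zero]; positivity
    · rw [← h4]
      refine vdc_first hb hl (hc1.trans hcd) hds fun t ht =>
        hlow t ⟨by linarith [ht.1], by linarith [ht.2]⟩ ?_
      have hdz : z + e ≤ d := by
        rcases le_total (z + e) s with h' | h'
        · rw [hd, min_eq_left h']; exact le_max_right _ _
        · rw [hd, min_eq_right h'] at h
          exact absurd (le_max_right 1 s) (not_le.mpr h)
      have := ht.1
      rw [abs_of_nonneg (by linarith)]; linarith
  have i2 := norm_integral_osc_le_len b α β hcd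
  have hI := intervalIntegrable_osc b α β
  rw [← intervalIntegral.integral_add_adjacent_intervals (hI 1 d) (hI d s),
    ← intervalIntegral.integral_add_adjacent_intervals (hI 1 c) (hI c d)]
  have n1 := norm_add_le ((∫ t in (1:ℝ)..c, osc b α β t) + ∫ t in c..d, osc b α β t)
    (∫ t in d..s, osc b α β t)
  have n2 := norm_add_le (∫ t in (1:ℝ)..c, osc b α β t) (∫ t in c..d, osc b α β t)
  have : (2 + 8 / vm b) * e = 4 / vm b * e + 2 * e + 4 / vm b * e := by ring
  linarith

theorem rpow_le_on {b t : ℝ} (hb : 1 < b) (h1 : 1 ≤ t) (h2 : t ≤ 2) :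
    1 ≤ t ^ (b - 1) ∧ t ^ (b - 1) ≤ 2 ^ (b - 1) :=
  ⟨Real.one_le_rpow h1 (by linarith), Real.rpow_le_rpow (by linarith) h2 (by linarith)⟩

/-- Threshold separating the nonstationary regimes. -/
def c0 (b : ℝ) : ℝ := b * 2 ^ b

theorem one_lt_c0 {b : ℝ} (hb : 1 < b) : 2 ≤ c0 b := by
  have : (2:ℝ) ≤ 2 ^ b := by
    nth_rewrite 1 [← Real.rpow_one 2]
    exact Real.rpow_le_rpow_of_exponent_le one_le_two hb.le
  unfold c0; nlinarith

theorem vdc_nonstat1 {b α β s : ℝ} (hb : 1 < b) (hα : α ≠ 0) (h : c0 b * |β| ≤ |α|) (hs : 1 ≤ s)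
    (hs2 : s ≤ 2) : ‖∫ t in (1:ℝ)..s, osc b α β t‖ ≤ 8 / |α| := by
  have hα' : 0 < |α| := abs_pos.mpr hα
  have := vdc_first (b := b) (α := α) (β := β) (l := |α| / 2) hb (by positivity) le_rfl hs
    fun t ht => by
      obtain ⟨h1, h2⟩ := rpow_le_on hb ht.1 (ht.2.trans hs2)
      have h3 : |β * (b * t ^ (b - 1))| ≤ |α| / 2 := by
        rw [abs_mul, abs_of_nonneg (by positivity : 0 ≤ b * t ^ (b - 1))]
        calc |β| * (b * t ^ (b - 1)) ≤ |β| * (b * 2 ^ (b - 1)) := by gcongr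
          _ = c0 b * |β| / 2 := by
            rw [c0, Real.rpow_sub two_pos, Real.rpow_one]; ring
          _ ≤ _ := by linarith
      have h4 := abs_sub_abs_le_abs_sub α (-(β * (b * t ^ (b - 1))))
      rw [abs_neg, sub_neg_eq_add] at h4
      linarith
  refine this.trans (le_of_eq ?_)
  field_simp; norm_num

theorem vdc_nonstat2 {b α β s : ℝ} (hb : 1 < b) (hβ : β ≠ 0) (h : c0 b * |α| ≤ |β|) (hs : 1 ≤ s)
    (hs2 : s ≤ 2) : ‖∫ t in (1:ℝ)..s, osc b α β t‖ ≤ 8 / |β| := by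
  have hβ' : 0 < |β| := abs_pos.mpr hβ
  have hα : |α| ≤ |β| / 2 := by
    have := one_lt_c0 hb
    nlinarith [abs_nonneg α]
  have := vdc_first (b := b) (α := α) (β := β) (l := |β| / 2) hb (by positivity) le_rfl hs
    fun t ht => by
      obtain ⟨h1, h2⟩ := rpow_le_on hb ht.1 (ht.2.trans hs2)
      have h3 : |β| ≤ |β * (b * t ^ (b - 1))| := by
        rw [abs_mul, abs_of_nonneg (by positivity : 0 ≤ b * t ^ (b - 1))]
        exact le_mul_of_one_le_right hβ'.le (by nlinarith)
      have h4 := abs_sub_abs_le_abs_sub (β * (b * t ^ (b - 1))) (-α)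
      rw [abs_neg, sub_neg_eq_add, add_comm (β * _)] at h4
      linarith
  refine this.trans (le_of_eq ?_)
  field_simp; norm_num

/-! ### Scalar almost orthogonality -/

/-- The function `min(√y, 1/√y)`. -/
def hh (y : ℝ) : ℝ := min (√y) (√y)⁻¹

theorem hh_nonneg (y : ℝ) : 0 ≤ hh y := by unfold hh; positivity

/-- The bound for dyadic sums of `hh`. -/
def cG : ℝ := √2 * ∑' m : ℤ, (√2)⁻¹ ^ m.natAbs

theorem summable_cG : Summable fun m : ℤ => (√2)⁻¹ ^ m.natAbs := by
  have h : Summable fun n : ℕ => (√2)⁻¹ ^ n := by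
    refine summable_geometric_of_lt_one (by positivity) (inv_lt_one_of_one_lt₀ ?_)
    rw [Real.lt_sqrt] <;> norm_num
  refine Summable.of_nat_of_neg ?_ ?_ <;> simpa using h

theorem cG_nonneg : 0 ≤ cG := by
  unfold cG
  have : 0 ≤ ∑' m : ℤ, (√2)⁻¹ ^ m.natAbs := tsum_nonneg fun m => by positivity
  positivity

theorem sum_hh_le (K : Finset ℤ) {x : ℝ} (hx : 0 < x) : ∑ k ∈ K, hh (2 ^ k * x) ≤ cG := by
  obtain ⟨n, hn1, hn2⟩ := exists_mem_Ico_zpow hx one_lt_two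
  have hterm : ∀ k : ℤ, hh (2 ^ k * x) ≤ √2 * (√2)⁻¹ ^ (k + n).natAbs := by
    intro k
    have hs2 : (0:ℝ) < √2 := by positivity
    have h2 : ∀ m : ℕ, √((2:ℝ) ^ m) = √2 ^ m := fun m => by
      induction m with
      | zero => simp
      | succ m ih => rw [pow_succ, Real.sqrt_mul (by positivity), ih, pow_succ]
    have hk0 : (0:ℝ) < 2 ^ k := by positivity
    have hlo : (2:ℝ) ^ (k + n) ≤ 2 ^ k * x := by
      rw [zpow_add₀ two_ne_zero]; gcongr
    have hhi : 2 ^ k * x ≤ (2:ℝ) ^ (k + n + 1) := by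
      rw [add_assoc, zpow_add₀ two_ne_zero]; gcongr
    rcases le_total 0 (k + n) with h | h
    · obtain ⟨m, hm⟩ := Int.eq_ofNat_of_zero_le h
      rw [hm] at hlo ⊢
      simp only [Int.natAbs_natCast, zpow_natCast] at hlo ⊢
      refine (min_le_right _ _).trans ?_
      calc (√(2 ^ k * x))⁻¹ ≤ (√((2:ℝ) ^ m))⁻¹ := by gcongr
        _ = 1 * (√2)⁻¹ ^ m := by rw [h2, inv_pow, one_mul]
        _ ≤ _ := by
          gcongr
          rw [Real.le_sqrt] <;> norm_num
    · obtain ⟨m, hm⟩ := Int.eq_ofNat_of_zero_le (neg_nonneg.mpr h)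
      have hm' : k + n = -m := by omega
      rw [hm'] at hhi ⊢
      simp only [Int.natAbs_neg, Int.natAbs_natCast]
      refine (min_le_left _ _).trans ?_
      calc √(2 ^ k * x) ≤ √(2 ^ (-(m:ℤ) + 1)) := by gcongr
        _ = √(2 * ((2:ℝ) ^ m)⁻¹) := by
          rw [zpow_add₀ two_ne_zero, zpow_neg, zpow_natCast, zpow_one, mul_comm]
        _ = _ := by rw [Real.sqrt_mul (by norm_num), Real.sqrt_inv, h2, inv_pow]
  have hs : Summable fun k : ℤ => (√2)⁻¹ ^ (k + n).natAbs :=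
    (Equiv.addRight n).summable_iff (f := fun m : ℤ => (√2)⁻¹ ^ m.natAbs) |>.mpr summable_cG
  have ht : ∑' k : ℤ, (√2)⁻¹ ^ (k + n).natAbs = ∑' k : ℤ, (√2)⁻¹ ^ k.natAbs :=
    (Equiv.addRight n).tsum_eq (fun m : ℤ => (√2)⁻¹ ^ m.natAbs)
  have hle : ∑ k ∈ K, (√2)⁻¹ ^ (k + n).natAbs ≤ ∑' k : ℤ, (√2)⁻¹ ^ (k + n).natAbs :=
    hs.sum_le_tsum K fun k _ => by positivity
  calc ∑ k ∈ K, hh (2 ^ k * x) ≤ ∑ k ∈ K, √2 * (√2)⁻¹ ^ (k + n).natAbs :=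
        Finset.sum_le_sum fun k _ => hterm k
    _ = √2 * ∑ k ∈ K, (√2)⁻¹ ^ (k + n).natAbs := by rw [Finset.mul_sum]
    _ ≤ √2 * ∑' k : ℤ, (√2)⁻¹ ^ (k + n).natAbs :=
        mul_le_mul_of_nonneg_left hle (Real.sqrt_nonneg 2)
    _ = cG := by rw [ht, cG]

theorem min_one_div_sqrt_le {z : ℝ} (hz : 0 < z) : min 1 z ≤ √z * hh z := by
  have hs : 0 < √z := Real.sqrt_pos.mpr hz
  rw [hh, mul_min_of_nonneg _ _ hs.le, Real.mul_self_sqrt hz.le, mul_inv_cancel₀ hs.ne', min_comm]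

theorem scalar_caseA {x y d : ℝ} (hy : 0 < y) (hyx : y ≤ x) (hd : 0 < d) :
    (x ^ 2)⁻¹ * min 1 (d * y) ^ 2 * (min 1 (x ^ 2) * min 1 (y ^ 2)) ≤ d * (hh x * hh y) := by
  have hx : 0 < x := by linarith
  have hhx := hh_nonneg x
  have hhy := hh_nonneg y
  set X := √x with hX
  set Y := √y with hY
  have hX0 : 0 < X := Real.sqrt_pos.mpr hx
  have hY0 : 0 < Y := Real.sqrt_pos.mpr hy
  have hxX : x = X ^ 2 := (Real.sq_sqrt hx.le).symm
  have hyY : y = Y ^ 2 := (Real.sq_sqrt hy.le).symm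
  have hYX : Y ≤ X := Real.sqrt_le_sqrt hyx
  have h1 : min 1 (d * y) ^ 2 ≤ d * y := by
    have ha : min 1 (d * y) ≤ 1 := min_le_left _ _
    have hb : min 1 (d * y) ≤ d * y := min_le_right _ _
    have hc : 0 ≤ min 1 (d * y) := by positivity
    nlinarith
  have key : (x ^ 2)⁻¹ * y * (min 1 (x ^ 2) * min 1 (y ^ 2)) ≤ hh x * hh y := by
    rcases le_total x 1 with hx1 | hx1
    · have hX1 : X ≤ 1 := by rw [hX]; exact Real.sqrt_le_one.mpr hx1
      have hY1 : Y ≤ 1 := hYX.trans hX1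
      have e1 : X ≤ hh x := le_min le_rfl (hX1.trans (one_le_inv_iff₀.mpr ⟨hX0, hX1⟩))
      have e2 : Y ≤ hh y := le_min le_rfl (hY1.trans (one_le_inv_iff₀.mpr ⟨hY0, hY1⟩))
      calc (x ^ 2)⁻¹ * y * (min 1 (x ^ 2) * min 1 (y ^ 2)) ≤ (x ^ 2)⁻¹ * y * (x ^ 2 * y ^ 2) := by
            gcongr; exacts [min_le_right _ _, min_le_right _ _]
        _ = Y * Y * Y ^ 4 := by field_simp; rw [hyY]; ring
        _ ≤ X * Y * 1 := by gcongr; exact pow_le_one₀ hY0.le hY1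
        _ ≤ _ := by rw [mul_one]; gcongr
    · have hX1 : 1 ≤ X := by rw [hX]; exact Real.one_le_sqrt.mpr hx1
      have e1 : X⁻¹ ≤ hh x := le_min ((inv_le_one_of_one_le₀ hX1).trans hX1) le_rfl
      rcases le_total y 1 with hy1 | hy1
      · have hY1 : Y ≤ 1 := by rw [hY]; exact Real.sqrt_le_one.mpr hy1
        have e2 : Y ≤ hh y := le_min le_rfl (hY1.trans (one_le_inv_iff₀.mpr ⟨hY0, hY1⟩))
        calc (x ^ 2)⁻¹ * y * (min 1 (x ^ 2) * min 1 (y ^ 2)) ≤ (x ^ 2)⁻¹ * y * (1 * y ^ 2) := by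
              gcongr; exacts [min_le_left _ _, min_le_right _ _]
          _ = (X ^ 4)⁻¹ * (Y * Y ^ 5) := by rw [hxX, hyY]; ring
          _ ≤ (X ^ 1)⁻¹ * (Y * 1) := by
            gcongr
            · norm_num
            · exact pow_le_one₀ hY0.le hY1
          _ ≤ _ := by rw [pow_one, mul_one]; gcongr
      · have hY1 : 1 ≤ Y := by rw [hY]; exact Real.one_le_sqrt.mpr hy1
        have e2 : Y⁻¹ ≤ hh y := le_min ((inv_le_one_of_one_le₀ hY1).trans hY1) le_rfl
        calc (x ^ 2)⁻¹ * y * (min 1 (x ^ 2) * min 1 (y ^ 2)) ≤ (x ^ 2)⁻¹ * y * (1 * 1) := by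
              gcongr; exacts [min_le_left _ _, min_le_left _ _]
          _ = (X ^ 4)⁻¹ * Y ^ 3 * Y⁻¹ := by rw [hxX, hyY]; field_simp
          _ ≤ (X ^ 4)⁻¹ * X ^ 3 * Y⁻¹ := by gcongr
          _ = X⁻¹ * Y⁻¹ := by field_simp
          _ ≤ _ := by gcongr
  calc _ ≤ (x ^ 2)⁻¹ * (d * y) * (min 1 (x ^ 2) * min 1 (y ^ 2)) := by gcongr
    _ = d * ((x ^ 2)⁻¹ * y * (min 1 (x ^ 2) * min 1 (y ^ 2))) := by ring
    _ ≤ _ := by gcongr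

theorem scalar_caseB {x y d : ℝ} (hx : 0 < x) (hxy : x ≤ y) (hd : 0 < d) :
    (y ^ 2)⁻¹ * min 1 (d * y) ^ 2 * (min 1 (x ^ 2) * min 1 (y ^ 2)) ≤ d * (hh x * hh y) := by
  have hy : 0 < y := by linarith
  have hhx := hh_nonneg x
  have hhy := hh_nonneg y
  set X := √x with hX
  set Y := √y with hY
  have hX0 : 0 < X := Real.sqrt_pos.mpr hx
  have hY0 : 0 < Y := Real.sqrt_pos.mpr hy
  have hxX : x = X ^ 2 := (Real.sq_sqrt hx.le).symm
  have hyY : y = Y ^ 2 := (Real.sq_sqrt hy.le).symm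
  have hXY : X ≤ Y := Real.sqrt_le_sqrt hxy
  have h1 : min 1 (d * y) ^ 2 ≤ d * y := by
    have ha : min 1 (d * y) ≤ 1 := min_le_left _ _
    have hb : min 1 (d * y) ≤ d * y := min_le_right _ _
    have hc : 0 ≤ min 1 (d * y) := by positivity
    nlinarith
  have key : y⁻¹ * (min 1 (x ^ 2) * min 1 (y ^ 2)) ≤ hh x * hh y := by
    rcases le_total x 1 with hx1 | hx1
    · have hX1 : X ≤ 1 := by rw [hX]; exact Real.sqrt_le_one.mpr hx1
      have e1 : X ≤ hh x := le_min le_rfl (hX1.trans (one_le_inv_iff₀.mpr ⟨hX0, hX1⟩))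
      rcases le_total y 1 with hy1 | hy1
      · have hY1 : Y ≤ 1 := by rw [hY]; exact Real.sqrt_le_one.mpr hy1
        have e2 : Y ≤ hh y := le_min le_rfl (hY1.trans (one_le_inv_iff₀.mpr ⟨hY0, hY1⟩))
        calc y⁻¹ * (min 1 (x ^ 2) * min 1 (y ^ 2)) ≤ y⁻¹ * (x ^ 2 * y ^ 2) := by
              gcongr; exacts [min_le_right _ _, min_le_right _ _]
          _ = (X * X ^ 3) * (Y * Y) := by field_simp; rw [hyY, hxX]; ring
          _ ≤ (X * 1) * (Y * 1) := by gcongr; exact pow_le_one₀ hX0.le hX1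
          _ ≤ _ := by rw [mul_one, mul_one]; gcongr
      · have hY1 : 1 ≤ Y := by rw [hY]; exact Real.one_le_sqrt.mpr hy1
        have e2 : Y⁻¹ ≤ hh y := le_min ((inv_le_one_of_one_le₀ hY1).trans hY1) le_rfl
        calc y⁻¹ * (min 1 (x ^ 2) * min 1 (y ^ 2)) ≤ y⁻¹ * (x ^ 2 * 1) := by
              gcongr; exacts [min_le_right _ _, min_le_left _ _]
          _ = (X * X ^ 3) * (Y ^ 2)⁻¹ := by rw [hyY, hxX]; ring
          _ ≤ (X * 1) * (Y ^ 1)⁻¹ := by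
            gcongr
            · exact pow_le_one₀ hX0.le hX1
            · norm_num
          _ ≤ _ := by rw [mul_one, pow_one]; gcongr
    · have hX1 : 1 ≤ X := by rw [hX]; exact Real.one_le_sqrt.mpr hx1
      have hY1 : 1 ≤ Y := hX1.trans hXY
      have e1 : X⁻¹ ≤ hh x := le_min ((inv_le_one_of_one_le₀ hX1).trans hX1) le_rfl
      have e2 : Y⁻¹ ≤ hh y := le_min ((inv_le_one_of_one_le₀ hY1).trans hY1) le_rfl
      calc y⁻¹ * (min 1 (x ^ 2) * min 1 (y ^ 2)) ≤ y⁻¹ * (1 * 1) := by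
            gcongr; exacts [min_le_left _ _, min_le_left _ _]
        _ = Y⁻¹ * Y⁻¹ := by rw [hyY]; ring
        _ ≤ X⁻¹ * Y⁻¹ := by gcongr
        _ ≤ _ := by gcongr
  calc _ ≤ (y ^ 2)⁻¹ * (d * y) * (min 1 (x ^ 2) * min 1 (y ^ 2)) := by gcongr
    _ = d * (y⁻¹ * (min 1 (x ^ 2) * min 1 (y ^ 2))) := by field_simp
    _ ≤ _ := by gcongr

theorem scalar_caseD {y d : ℝ} (hy : 0 < y) (hd : 0 < d) :
    y⁻¹ * min 1 (d * y) ^ 2 ≤ d * hh (d * y) := by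
  have hz : 0 < d * y := by positivity
  set Z := √(d * y) with hZ
  have hZ0 : 0 < Z := Real.sqrt_pos.mpr hz
  have hzZ : d * y = Z ^ 2 := (Real.sq_sqrt hz.le).symm
  have key : (d * y)⁻¹ * min 1 (d * y) ^ 2 ≤ hh (d * y) := by
    rcases le_total Z 1 with h | h
    · have e2 : Z ≤ hh (d * y) := le_min le_rfl (h.trans (one_le_inv_iff₀.mpr ⟨hZ0, h⟩))
      refine le_trans ?_ e2
      calc (d * y)⁻¹ * min 1 (d * y) ^ 2 ≤ (d * y)⁻¹ * (d * y) ^ 2 := by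
            gcongr; exact min_le_right _ _
        _ = Z * Z := by rw [hzZ]; field_simp
        _ ≤ Z * 1 := by gcongr
        _ = Z := mul_one _
    · have e2 : Z⁻¹ ≤ hh (d * y) := le_min ((inv_le_one_of_one_le₀ h).trans h) le_rfl
      refine le_trans ?_ e2
      calc (d * y)⁻¹ * min 1 (d * y) ^ 2 ≤ (d * y)⁻¹ * 1 ^ 2 := by
            gcongr; exact min_le_left _ _
        _ = (Z ^ 2)⁻¹ := by rw [hzZ]; ring
        _ ≤ (Z ^ 1)⁻¹ := by
            gcongr
            · norm_num
        _ = _ := by rw [pow_one]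
  calc y⁻¹ * min 1 (d * y) ^ 2 = d * ((d * y)⁻¹ * min 1 (d * y) ^ 2) := by field_simp
    _ ≤ _ := by gcongr

/-! ### Multiplier bounds -/

/-- The multiplier `∫₁² exp(i(αt+βt^b)) dt`. -/
def EE (b α β : ℝ) : ℂ := ∫ t in (1:ℝ)..2, osc b α β t

theorem norm_EE_le_one (b α β : ℝ) : ‖EE b α β‖ ≤ 1 := by
  have := norm_integral_osc_le_len b α β one_le_two
  norm_num at this
  exact this

theorem EE_decay {b : ℝ} (hb : 1 < b) : ∃ C, 0 < C ∧ ∀ α β : ℝ, α ≠ 0 → β ≠ 0 →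
    ‖EE b α β‖ ^ 2 ≤ C * ((√|α|)⁻¹ * (√|β|)⁻¹) := by
  set D := 2 + 8 / vm b with hD
  have hD0 : 0 < D := by have := vm_pos hb; positivity
  have hc0 := one_lt_c0 hb
  refine ⟨D ^ 2 * √(c0 b) + 8, by positivity, fun α β hα hβ => ?_⟩
  have hα' : 0 < |α| := abs_pos.mpr hα
  have hβ' : 0 < |β| := abs_pos.mpr hβ
  set X := √|α| with hX
  set Y := √|β| with hY
  have hX0 : 0 < X := Real.sqrt_pos.mpr hα'
  have hY0 : 0 < Y := Real.sqrt_pos.mpr hβ'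
  have hxX : |α| = X ^ 2 := (Real.sq_sqrt hα'.le).symm
  have hyY : |β| = Y ^ 2 := (Real.sq_sqrt hβ'.le).symm
  rcases le_total (c0 b * |β|) |α| with h | h
  · have h1 := vdc_nonstat1 hb hα h one_le_two le_rfl
    have h2 := norm_EE_le_one b α β
    have hYX : Y ≤ X := Real.sqrt_le_sqrt (by nlinarith)
    change ‖EE b α β‖ ≤ _ at h1
    calc ‖EE b α β‖ ^ 2 = ‖EE b α β‖ * ‖EE b α β‖ := sq _
      _ ≤ 8 / |α| * 1 := by gcongr
      _ = 8 * (X⁻¹ * X⁻¹) := by rw [hxX]; ring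
      _ ≤ (D ^ 2 * √(c0 b) + 8) * (X⁻¹ * Y⁻¹) := by
        gcongr
        have : 0 ≤ D ^ 2 * √(c0 b) := by positivity
        linarith
  · have h1 := vdc_second (α := α) hb hβ one_le_two le_rfl
    have hXY : X ≤ √(c0 b) * Y := by
      rw [hX, hY, ← Real.sqrt_mul (by linarith)]; exact Real.sqrt_le_sqrt h
    have hy2 : |β| ^ (-(1/2) : ℝ) = Y⁻¹ := by
      rw [Real.rpow_neg hβ'.le, ← Real.sqrt_eq_rpow]
    rw [hy2] at h1
    change ‖EE b α β‖ ≤ D * Y⁻¹ at h1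
    calc ‖EE b α β‖ ^ 2 ≤ (D * Y⁻¹) ^ 2 := by gcongr
      _ = D ^ 2 * (X * (X⁻¹ * Y⁻¹)) * Y⁻¹ := by field_simp
      _ ≤ D ^ 2 * ((√(c0 b) * Y) * (X⁻¹ * Y⁻¹)) * Y⁻¹ := by gcongr
      _ = D ^ 2 * √(c0 b) * (X⁻¹ * Y⁻¹) := by field_simp
      _ ≤ _ := by gcongr; linarith

theorem EE_sub_le {b α β β' W : ℝ} (hb : 1 < b)
    (h : ∀ s ∈ Icc (1:ℝ) 2, ‖∫ t in (1:ℝ)..s, osc b α β t‖ ≤ W) :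
    ‖EE b α β' - EE b α β‖ ≤ W * (2 * c0 b * |β' - β|) := by
  set w := β' - β with hw
  set g : ℝ → ℂ := osc b 0 w with hg
  set V : ℝ → ℂ := fun s => ∫ t in (1:ℝ)..s, osc b α β t with hV
  have hu : uIcc (1:ℝ) 2 = Icc 1 2 := uIcc_of_le one_le_two
  have hpos : ∀ t ∈ Icc (1:ℝ) 2, 0 < t := fun t ht => by linarith [ht.1]
  have hprod : ∀ t, osc b α β' t = osc b α β t * g t := fun t => by
    simp only [hg, osc, phs]
    rw [← Complex.exp_add]
    congr 1
    simp only [hw]; push_cast; ring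
  have hVd : ∀ t ∈ uIcc (1:ℝ) 2, HasDerivAt V (osc b α β t) t := fun t ht => by
    rw [hu] at ht
    exact intervalIntegral.integral_hasDerivAt_right (intervalIntegrable_osc b α β 1 t)
      ((measurable_osc b α β).stronglyMeasurable.stronglyMeasurableAtFilter)
      (hasDerivAt_osc b α β (hpos t ht)).continuousAt
  set g' : ℝ → ℂ := fun t => osc b 0 w t * (((0 + w * (b * t ^ (b - 1)) : ℝ) : ℂ) * Complex.I) with hg'
  have hgd : ∀ t ∈ uIcc (1:ℝ) 2, HasDerivAt (fun t => g t - 1) (g' t) t := fun t ht => by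
    rw [hu] at ht
    exact (hasDerivAt_osc b 0 w (hpos t ht)).sub_const 1
  have hg'c : ContinuousOn g' (uIcc 1 2) := by
    rw [hu]
    have h1 : ContinuousOn (osc b 0 w) (Icc 1 2) := (continuousOn_osc b 0 w).mono hpos
    have h2 : ContinuousOn (fun t : ℝ => t ^ (b - 1)) (Icc 1 2) := fun t ht =>
      (Real.continuousAt_rpow_const t _ (Or.inl (hpos t ht).ne')).continuousWithinAt
    refine h1.mul (ContinuousOn.mul (Complex.continuous_ofReal.comp_continuousOn ?_)
      continuousOn_const)
    exact continuousOn_const.add (continuousOn_const.mul (continuousOn_const.mul h2))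
  have hparts := intervalIntegral.integral_mul_deriv_eq_deriv_mul hgd hVd
    hg'c.intervalIntegrable (intervalIntegrable_osc b α β 1 2)
  have hI : EE b α β' - EE b α β = ∫ t in (1:ℝ)..2, (g t - 1) * osc b α β t := by
    rw [EE, EE, ← intervalIntegral.integral_sub (intervalIntegrable_osc b α β' 1 2)
      (intervalIntegrable_osc b α β 1 2)]
    congr 1 with t
    rw [hprod]; ring
  have hV1 : V 1 = 0 := intervalIntegral.integral_same
  have hb2 : b * 2 ^ (b - 1) ≤ c0 b := by
    unfold c0
    have : (2:ℝ) ^ (b - 1) ≤ 2 ^ b := Real.rpow_le_rpow_of_exponent_le one_le_two (by linarith)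
    have : 0 < b := by linarith
    gcongr
  have hg2 : ‖g 2 - 1‖ ≤ c0 b * |w| := by
    have := Real.norm_exp_I_mul_ofReal_sub_one_le (x := phs b 0 w 2)
    rw [mul_comm] at this
    refine this.trans ?_
    rw [phs, Real.norm_eq_abs, zero_mul, zero_add, abs_mul, mul_comm]
    gcongr
    rw [abs_of_pos (by positivity), c0]
    exact le_mul_of_one_le_left (by positivity) hb.le
  have hint : ‖∫ t in (1:ℝ)..2, g' t * V t‖ ≤ c0 b * |w| * W := by
    have := intervalIntegral.norm_integral_le_of_norm_le_const (a := (1:ℝ)) (b := 2)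
      (C := c0 b * |w| * W) (f := fun t => g' t * V t) fun t ht => by
        rw [uIoc_of_le one_le_two] at ht
        rw [norm_mul]
        have h1 : ‖g' t‖ ≤ c0 b * |w| := by
          simp only [hg', norm_mul, norm_osc, Complex.norm_real, Complex.norm_I, one_mul, mul_one,
            zero_add, Real.norm_eq_abs]
          rw [mul_comm]
          gcongr
          rw [abs_of_pos (by linarith), abs_of_nonneg (Real.rpow_nonneg (by linarith [ht.1]) _)]
          refine le_trans ?_ hb2
          have := (rpow_le_on hb ht.1.le ht.2).2
          have : 0 < b := by linarith
          gcongr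
        have h2 := h t ⟨ht.1.le, ht.2⟩
        have : 0 ≤ c0 b * |w| := (norm_nonneg _).trans h1
        gcongr
    norm_num at this
    exact this
  rw [hI, hparts, hV1, mul_zero, sub_zero]
  refine (norm_sub_le _ _).trans ?_
  rw [norm_mul]
  have hV2 := h 2 ⟨one_le_two, le_rfl⟩
  have : ‖g 2 - 1‖ * ‖V 2‖ ≤ c0 b * |w| * W := by
    have : 0 ≤ c0 b * |w| := (norm_nonneg _).trans hg2
    gcongr
  linarith

theorem EE_diff {b K : ℝ} (hb : 1 < b) (hK : 1 ≤ K) : ∃ C, 0 < C ∧ ∀ α β β' y d : ℝ, α ≠ 0 →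
    0 < y → 0 < d → y / K ≤ |β| → |β| ≤ K * y → y / K ≤ |β'| → |β'| ≤ K * y →
    |β' - β| ≤ K * (d * y) →
    ‖EE b α β' - EE b α β‖ ^ 2 * (min 1 (α ^ 2) * min 1 (y ^ 2)) ≤
      C * d * (hh |α| * hh y + hh (|α| / y) * hh (d * y)) := by
  set D := 2 + 8 / vm b with hD
  have hD0 : 0 < D := by have := vm_pos hb; positivity
  have hc0 := one_lt_c0 hb
  set C1 := c0 b * K with hC1
  have hC11 : 2 ≤ C1 := by nlinarith
  have hK0 : 0 < K := by linarith
  set N := 2 + 2 * c0 b * K with hN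
  have hN0 : 0 < N := by positivity
  set C2 := N ^ 2 * (64 * K ^ 2 + D ^ 2 * K * √C1) with hC2
  refine ⟨C2, by positivity, ?_⟩
  intro α β β' y d hα hy hd hβ1 hβ2 hβ'1 hβ'2 hββ
  have hβ0 : 0 < |β| := lt_of_lt_of_le (by positivity) hβ1
  have hβ'0 : 0 < |β'| := lt_of_lt_of_le (by positivity) hβ'1
  set x := |α| with hx
  have hx0 : 0 < x := abs_pos.mpr hα
  have hα2 : α ^ 2 = x ^ 2 := (sq_abs α).symm
  rw [hα2]
  have gen : ∀ W, 0 ≤ W → (∀ s ∈ Icc (1:ℝ) 2, ‖∫ t in (1:ℝ)..s, osc b α β t‖ ≤ W) →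
      (∀ s ∈ Icc (1:ℝ) 2, ‖∫ t in (1:ℝ)..s, osc b α β' t‖ ≤ W) →
      ‖EE b α β' - EE b α β‖ ^ 2 ≤ N ^ 2 * (W ^ 2 * min 1 (d * y) ^ 2) := by
    intro W hW h1 h2
    have k1 := EE_sub_le hb h1 (β' := β')
    have k2 : ‖EE b α β' - EE b α β‖ ≤ 2 * W := by
      have := norm_sub_le (EE b α β') (EE b α β)
      have a1 := h1 2 ⟨one_le_two, le_rfl⟩
      have a2 := h2 2 ⟨one_le_two, le_rfl⟩
      change ‖EE b α β‖ ≤ W at a1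
      change ‖EE b α β'‖ ≤ W at a2
      linarith
    have k3 : ‖EE b α β' - EE b α β‖ ≤ N * (W * min 1 (d * y)) := by
      rcases min_choice 1 (d * y) with h | h
      · rw [h]
        refine k2.trans ?_
        have : 0 ≤ 2 * c0 b * K * W := by positivity
        rw [hN]; linarith
      · rw [h]
        refine k1.trans ?_
        have h0 : 0 ≤ 2 * (W * (d * y)) := by positivity
        calc W * (2 * c0 b * |β' - β|) ≤ W * (2 * c0 b * (K * (d * y))) := by gcongr
          _ = 2 * c0 b * K * (W * (d * y)) := by ring
          _ ≤ _ := by rw [hN]; linarith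
    calc _ ≤ (N * (W * min 1 (d * y))) ^ 2 := by gcongr
      _ = _ := by ring
  have hA0 : 0 ≤ hh x * hh y := mul_nonneg (hh_nonneg _) (hh_nonneg _)
  have hB0 : 0 ≤ hh (x / y) * hh (d * y) := mul_nonneg (hh_nonneg _) (hh_nonneg _)
  have hm0 : 0 ≤ min 1 (x ^ 2) * min 1 (y ^ 2) := by positivity
  rcases le_total (C1 * y) x with h | h
  · have hA : ∀ β, |β| ≤ K * y → ∀ s ∈ Icc (1:ℝ) 2, ‖∫ t in (1:ℝ)..s, osc b α β t‖ ≤ 8 / x :=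
      fun β hβ s hs => vdc_nonstat1 hb hα (le_trans (by
        rw [hC1] at h
        calc c0 b * |β| ≤ c0 b * (K * y) := by gcongr
          _ = c0 b * K * y := by ring) h) hs.1 hs.2
    have := gen (8 / x) (by positivity) (hA β hβ2) (hA β' hβ'2)
    calc _ ≤ N ^ 2 * ((8 / x) ^ 2 * min 1 (d * y) ^ 2) * (min 1 (x ^ 2) * min 1 (y ^ 2)) := by gcongr
      _ = N ^ 2 * (64 * 1 ^ 2) *
          ((x ^ 2)⁻¹ * min 1 (d * y) ^ 2 * (min 1 (x ^ 2) * min 1 (y ^ 2))) := by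
        field_simp; norm_num
      _ ≤ N ^ 2 * (64 * K ^ 2) * (d * (hh x * hh y)) := by
        have := scalar_caseA (d := d) hy (by nlinarith : y ≤ x) hd
        gcongr
      _ = N ^ 2 * (64 * K ^ 2 + 0) * d * (hh x * hh y + 0) := by ring
      _ ≤ _ := by rw [hC2]; gcongr; positivity
  rcases le_total (C1 * x) y with h' | h'
  · have hA : ∀ β, y / K ≤ |β| → ∀ s ∈ Icc (1:ℝ) 2,
        ‖∫ t in (1:ℝ)..s, osc b α β t‖ ≤ 8 * K / y := by
      intro β hβ s hs
      have hβ0 : 0 < |β| := lt_of_lt_of_le (by positivity) hβ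
      refine (vdc_nonstat2 (α := α) (β := β) hb (abs_pos.mp hβ0) (le_trans ?_ hβ) hs.1 hs.2).trans ?_
      · rw [le_div_iff₀ hK0]
        rw [hC1] at h'
        calc c0 b * |α| * K = c0 b * K * x := by ring
          _ ≤ y := h'
      · rw [div_le_div_iff₀ hβ0 hy]
        rw [div_le_iff₀ hK0] at hβ
        linarith
    have := gen (8 * K / y) (by positivity) (hA β hβ1) (hA β' hβ'1)
    calc _ ≤ N ^ 2 * ((8 * K / y) ^ 2 * min 1 (d * y) ^ 2) *
            (min 1 (x ^ 2) * min 1 (y ^ 2)) := by gcongr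
      _ = N ^ 2 * (64 * K ^ 2) *
          ((y ^ 2)⁻¹ * min 1 (d * y) ^ 2 * (min 1 (x ^ 2) * min 1 (y ^ 2))) := by
        field_simp; norm_num
      _ ≤ N ^ 2 * (64 * K ^ 2) * (d * (hh x * hh y)) := by
        have := scalar_caseB (d := d) hx0 (by nlinarith : x ≤ y) hd
        gcongr
      _ = N ^ 2 * (64 * K ^ 2 + 0) * d * (hh x * hh y + 0) := by ring
      _ ≤ _ := by rw [hC2]; gcongr; positivity
  · have hA : ∀ β, y / K ≤ |β| → ∀ s ∈ Icc (1:ℝ) 2,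
        ‖∫ t in (1:ℝ)..s, osc b α β t‖ ≤ D * √K * (√y)⁻¹ := by
      intro β hβ s hs
      have hβ0 : 0 < |β| := lt_of_lt_of_le (by positivity) hβ
      refine (vdc_second (α := α) (β := β) hb (abs_pos.mp hβ0) hs.1 hs.2).trans ?_
      rw [Real.rpow_neg hβ0.le, ← Real.sqrt_eq_rpow, mul_assoc]
      gcongr
      have h1 : √y ≤ √K * √|β| := by
        rw [← Real.sqrt_mul hK0.le]
        refine Real.sqrt_le_sqrt ?_
        rw [div_le_iff₀ hK0] at hβ; linarith
      have h2 : 0 < √|β| := Real.sqrt_pos.mpr hβ0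
      have h3 : 0 < √y := Real.sqrt_pos.mpr hy
      rw [← div_eq_mul_inv, inv_eq_one_div, div_le_div_iff₀ h2 h3]
      linarith
    have := gen (D * √K * (√y)⁻¹) (by positivity) (hA β hβ1) (hA β' hβ'1)
    have hW2 : (D * √K * (√y)⁻¹) ^ 2 = D ^ 2 * K * y⁻¹ := by
      rw [mul_pow, mul_pow, inv_pow, Real.sq_sqrt hK0.le, Real.sq_sqrt hy.le]
    have hr : 1 ≤ √C1 * hh (x / y) := by
      have hxy : 0 < x / y := by positivity
      have h1 : √(x / y) ≤ √C1 := Real.sqrt_le_sqrt (by rw [div_le_iff₀ hy]; exact h)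
      have h2 : 1 ≤ √C1 * √(x / y) := by
        rw [← Real.sqrt_mul (by positivity), Real.one_le_sqrt, mul_div_assoc', le_div_iff₀ hy]
        linarith
      rw [hh, mul_min_of_nonneg _ _ (Real.sqrt_nonneg _)]
      refine le_min h2 ?_
      have : 0 < √(x / y) := Real.sqrt_pos.mpr hxy
      rw [← div_eq_mul_inv, le_div_iff₀ this, one_mul]; exact h1
    have hcD := scalar_caseD hy hd
    calc _ ≤ N ^ 2 * ((D * √K * (√y)⁻¹) ^ 2 * min 1 (d * y) ^ 2) * (1 * 1) := by
          gcongr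
          · exact min_le_left _ _
          · exact min_le_left _ _
      _ = N ^ 2 * (D ^ 2 * K) * (y⁻¹ * min 1 (d * y) ^ 2) * 1 := by rw [hW2]; ring
      _ ≤ N ^ 2 * (D ^ 2 * K) * (d * hh (d * y)) * (√C1 * hh (x / y)) := by
          have := hh_nonneg (d * y)
          gcongr
      _ = N ^ 2 * (0 + D ^ 2 * K * √C1) * d * (0 + hh (x / y) * hh (d * y)) := by ring
      _ ≤ _ := by rw [hC2]; gcongr; positivity

/-! ### Fourier transform and Plancherel's theorem -/

section plancherel
open FourierTransform SchwartzMap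
variable {V : Type*} [NormedAddCommGroup V] [InnerProductSpace ℝ V] [FiniteDimensional ℝ V]
  [MeasurableSpace V] [BorelSpace V]

theorem continuous_fourier_of_integrable {f : V → ℂ} (hf : Integrable f) : Continuous (𝓕 f) :=
  VectorFourier.fourierIntegral_continuous Real.continuous_fourierChar
    (by exact continuous_inner) hf

theorem toLp_fourier_ae_eq {f : V → ℂ} (hf : Integrable f) (h2 : MemLp f 2) :
    ((𝓕 (h2.toLp f) : Lp (α := V) ℂ 2 volume) : V → ℂ) =ᵐ[volume] 𝓕 f := by
  refine ae_eq_of_integral_contDiff_smul_eq ((Lp.memLp _).locallyIntegrable (by norm_num))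
    (continuous_fourier_of_integrable hf).locallyIntegrable ?_
  intro g g_smooth g_cpt
  have hg₁ : HasCompactSupport (Complex.ofRealCLM ∘ g) := g_cpt.comp_left rfl
  have hg₂ : ContDiff ℝ (⊤ : ℕ∞) (Complex.ofRealCLM ∘ g) := by fun_prop
  set G : 𝓢(V, ℂ) := hg₁.toSchwartzMap hg₂ with hG
  have hGv : ∀ x, G x = (g x : ℂ) := fun x => by simp [hG]
  have key := congrArg (fun T => T G) (Lp.fourier_toTemperedDistribution_eq (h2.toLp f))
  simp only [TemperedDistribution.fourier_apply, Lp.toTemperedDistribution_apply] at key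
  have e1 : ∫ x, g x • (𝓕 (h2.toLp f) : Lp (α := V) ℂ 2 volume) x =
      ∫ x, G x • (𝓕 (h2.toLp f) : Lp (α := V) ℂ 2 volume) x := by
    congr 1
  have e2 : ∫ x, (𝓕 G) x • (h2.toLp f) x ∂volume = ∫ x, (𝓕 (G : V → ℂ)) x • f x ∂volume := by
    refine integral_congr_ae ?_
    filter_upwards [h2.coeFn_toLp] with x hx
    rw [hx, SchwartzMap.fourier_coe]
  have e3 : ∫ x, (𝓕 (G : V → ℂ)) x • f x ∂volume = ∫ x, G x • 𝓕 f x ∂volume := by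
    have := VectorFourier.integral_fourierIntegral_smul_eq_flip (μ := (volume : Measure V))
      (ν := (volume : Measure V)) (L := innerₗ V) (f := (G : V → ℂ)) (g := f)
      Real.continuous_fourierChar (by exact continuous_inner) G.integrable hf
    rw [flip_innerₗ] at this
    exact this
  rw [e1, ← key, e2, e3]
  congr 1

theorem plancherel_of_integrable {f : V → ℂ} (hf : Integrable f) (h2 : MemLp f 2) :
    eLpNorm (𝓕 f) 2 = eLpNorm f 2 := by
  have h := congrArg ENNReal.ofReal (Lp.norm_fourier_eq (h2.toLp f))
  rw [Lp.norm_def, Lp.norm_def, ENNReal.ofReal_toReal (Lp.eLpNorm_ne_top _),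
    ENNReal.ofReal_toReal (Lp.eLpNorm_ne_top _), eLpNorm_congr_ae (toLp_fourier_ae_eq hf h2),
    eLpNorm_congr_ae h2.coeFn_toLp] at h
  exact h

end plancherel

/-- The character of `ℝ × ℝ`. -/
def chr (ξ x : ℝ × ℝ) : ℂ := Complex.exp ((-(2 * Real.pi * (x.1 * ξ.1 + x.2 * ξ.2)) : ℝ) * Complex.I)

/-- The Fourier transform of a real function on the plane. -/
def ft (f : ℝ × ℝ → ℝ) (ξ : ℝ × ℝ) : ℂ := ∫ x, chr ξ x * f x

/-- The Fourier transform of a measure on the plane. -/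
def fm (μ : Measure (ℝ × ℝ)) (ξ : ℝ × ℝ) : ℂ := ∫ x, chr ξ x ∂μ

theorem norm_chr (ξ x : ℝ × ℝ) : ‖chr ξ x‖ = 1 := Complex.norm_exp_ofReal_mul_I _

theorem continuous_chr (ξ : ℝ × ℝ) : Continuous (chr ξ) := by unfold chr; fun_prop

theorem chr_add (ξ x y : ℝ × ℝ) : chr ξ (x + y) = chr ξ x * chr ξ y := by
  simp only [chr, ← Complex.exp_add]
  congr 1
  simp only [Prod.fst_add, Prod.snd_add]
  push_cast; ring

theorem lintegral_ft {f : ℝ × ℝ → ℝ} (hf : Integrable f) (h2 : MemLp f 2) :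
    ∫⁻ ξ, ‖ft f ξ‖ₑ ^ 2 = ∫⁻ x, ‖f x‖ₑ ^ 2 := by
  have mp := WithLp.volume_preserving_ofLp (U := ℝ) (V := ℝ)
  set g : WithLp 2 (ℝ × ℝ) → ℂ := fun v => (f v.ofLp : ℂ) with hg
  have hgi : Integrable g := (mp.integrable_comp_of_integrable hf.ofReal : _)
  have hg2 : MemLp g 2 := (h2.ofReal (K := ℂ)).comp_measurePreserving mp
  have hfou : ∀ v : WithLp 2 (ℝ × ℝ), FourierTransform.fourier g v = ft f v.ofLp := by
    intro v
    rw [Real.fourier_eq', ft, ← mp.integral_comp (MeasurableEquiv.toLp 2 (ℝ × ℝ)).symm.measurableEmbedding]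
    congr 1 with w
    simp only [chr, hg, smul_eq_mul, WithLp.prod_inner_apply]
    congr 3
    simp
    ring
  have h := plancherel_of_integrable hgi hg2
  have h' := congrArg (· ^ (2:ℝ)) h
  simp only [eLpNorm_eq_lintegral_rpow_enorm_toReal (p := 2) two_ne_zero ENNReal.ofNat_ne_top] at h'
  simp only [ENNReal.toReal_ofNat, ← ENNReal.rpow_mul] at h'
  norm_num at h'
  have hen : ∀ r : ℝ, ‖(r : ℂ)‖ₑ = ‖r‖ₑ := fun r => by
    rw [enorm_eq_nnnorm, Complex.nnnorm_real, enorm_eq_nnnorm]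
  simp only [hfou] at h'
  simp only [hg, hen] at h'
  rw [mp.lintegral_comp_emb (MeasurableEquiv.toLp 2 (ℝ × ℝ)).symm.measurableEmbedding
    (fun x => ‖ft f x‖ₑ ^ 2), mp.lintegral_comp_emb
    (MeasurableEquiv.toLp 2 (ℝ × ℝ)).symm.measurableEmbedding (fun x => ‖f x‖ₑ ^ 2)] at h'
  exact h'


theorem BM.memLp_two {α : Type*} [MeasurableSpace α] {μ : Measure α} {f : α → ℝ} (hf : BM f)
    (hi : Integrable f μ) : MemLp f 2 μ := by
  obtain ⟨C, hC⟩ := hf.2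
  rw [memLp_two_iff_integrable_sq hf.1.aestronglyMeasurable]
  simp only [sq]
  exact hi.bdd_mul hf.1.aestronglyMeasurable (Eventually.of_forall hC)

theorem integrable_chr_mul (ξ : ℝ × ℝ) {f : ℝ × ℝ → ℝ} (hi : Integrable f) :
    Integrable (fun x => chr ξ x * (f x : ℂ)) :=
  hi.ofReal.bdd_mul (continuous_chr ξ).aestronglyMeasurable
    (Eventually.of_forall fun x => (norm_chr ξ x).le)

theorem measurable_ft {f : ℝ × ℝ → ℝ} (hf : BM f) : Measurable (ft f) := by
  have : Measurable fun z : (ℝ × ℝ) × (ℝ × ℝ) => chr z.1 z.2 * (f z.2 : ℂ) := by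
    refine Measurable.mul ?_ (Complex.measurable_ofReal.comp (hf.1.measurable.comp measurable_snd))
    have : Continuous fun z : (ℝ × ℝ) × (ℝ × ℝ) => chr z.1 z.2 := by unfold chr; fun_prop
    exact this.measurable
  exact (this.stronglyMeasurable.integral_prod_right').measurable

theorem ft_sub {f g : ℝ × ℝ → ℝ} (hf : Integrable f) (hg : Integrable g) (ξ : ℝ × ℝ) :
    ft (fun x => f x - g x) ξ = ft f ξ - ft g ξ := by
  rw [ft, ft, ft, ← integral_sub (integrable_chr_mul ξ hf) (integrable_chr_mul ξ hg)]
  congr 1 with x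
  push_cast; ring

theorem ft_conv (μ : Measure (ℝ × ℝ)) [IsProbabilityMeasure μ] {f : ℝ × ℝ → ℝ}
    (hi : Integrable f) (ξ : ℝ × ℝ) : ft (conv μ f) ξ = fm μ ξ * ft f ξ := by
  have h1 : Integrable (fun z : (ℝ × ℝ) × (ℝ × ℝ) => f (z.1 - z.2)) (volume.prod μ) := by
    have := Integrable.convolution_integrand (ContinuousLinearMap.mul ℝ ℝ) (μ := volume) (ν := μ)
      (integrable_const (1:ℝ)) hi
    simpa using this
  have h2 : Integrable (Function.uncurry fun x y : ℝ × ℝ => chr ξ x * (f (x - y) : ℂ))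
      (volume.prod μ) := by
    refine h1.ofReal.bdd_mul (c := 1)
      ((continuous_chr ξ).comp continuous_fst).aestronglyMeasurable
      (Eventually.of_forall fun x => (norm_chr ξ x.1).le)
  calc ft (conv μ f) ξ = ∫ x, ∫ y, chr ξ x * (f (x - y) : ℂ) ∂μ := by
        rw [ft]
        congr 1 with x
        rw [conv, integral_const_mul, integral_complex_ofReal]
    _ = ∫ y, (∫ x, chr ξ x * (f (x - y) : ℂ)) ∂μ := integral_integral_swap h2
    _ = ∫ y, chr ξ y * ft f ξ ∂μ := by
        congr 1 with y
        rw [ft, ← integral_const_mul, ← integral_add_right_eq_self _ y]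
        congr 1 with x
        rw [add_sub_cancel_right, chr_add]; ring
    _ = _ := by rw [integral_mul_const, fm]

/-- `T` acts on bounded integrable functions as the Fourier multiplier `m`. -/
def HasMult (T : (ℝ × ℝ → ℝ) → ℝ × ℝ → ℝ) (m : ℝ × ℝ → ℂ) : Prop :=
  ∀ f, BM f → Integrable f → BM (T f) ∧ Integrable (T f) ∧ ∀ ξ, ft (T f) ξ = m ξ * ft f ξ

theorem hasMult_id : HasMult (fun f => f) fun _ => 1 := fun f hf hi => ⟨hf, hi, fun ξ => by simp⟩

theorem hasMult_conv (μ : Measure (ℝ × ℝ)) [IsProbabilityMeasure μ] :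
    HasMult (conv μ) (fm μ) := fun _ hf hi =>
  ⟨hf.conv μ, integrable_conv μ _ hf hi, ft_conv μ hi⟩

theorem HasMult.comp {T S : (ℝ × ℝ → ℝ) → ℝ × ℝ → ℝ} {m n : ℝ × ℝ → ℂ} (hT : HasMult T m)
    (hS : HasMult S n) : HasMult (fun f => T (S f)) fun ξ => m ξ * n ξ := fun f hf hi => by
  obtain ⟨h1, h2, h3⟩ := hS f hf hi
  obtain ⟨h4, h5, h6⟩ := hT _ h1 h2
  exact ⟨h4, h5, fun ξ => by rw [h6, h3, mul_assoc]⟩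

theorem HasMult.sub {T S : (ℝ × ℝ → ℝ) → ℝ × ℝ → ℝ} {m n : ℝ × ℝ → ℂ} (hT : HasMult T m)
    (hS : HasMult S n) : HasMult (fun f x => T f x - S f x) fun ξ => m ξ - n ξ := fun f hf hi => by
  obtain ⟨h1, h2, h3⟩ := hS f hf hi
  obtain ⟨h4, h5, h6⟩ := hT f hf hi
  exact ⟨h4.sub h1, h5.sub h2, fun ξ => by rw [ft_sub h5 h2, h3, h6, sub_mul]⟩

theorem ae_ne_zero_prod : ∀ᵐ ξ : ℝ × ℝ, ξ.1 ≠ 0 ∧ ξ.2 ≠ 0 := by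
  have h1 : ∀ᵐ x : ℝ, x ≠ 0 := by simp [ae_iff]
  exact (Measure.quasiMeasurePreserving_fst.ae h1).and (Measure.quasiMeasurePreserving_snd.ae h1)

theorem HasMult.sum_lintegral_le {ι : Type*} (J : Finset ι)
    {T : ι → (ℝ × ℝ → ℝ) → ℝ × ℝ → ℝ} {m : ι → ℝ × ℝ → ℂ} (hT : ∀ j, HasMult (T j) (m j))
    {K : ℝ} (hK : ∀ ξ : ℝ × ℝ, ξ.1 ≠ 0 → ξ.2 ≠ 0 → ∑ j ∈ J, ‖m j ξ‖ ^ 2 ≤ K)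
    {f : ℝ × ℝ → ℝ} (hf : BM f) (hi : Integrable f) :
    ∫⁻ x, ∑ j ∈ J, ‖T j f x‖ₑ ^ 2 ≤ ENNReal.ofReal K * ∫⁻ x, ‖f x‖ₑ ^ 2 := by
  have hm : ∀ j ∈ J, Measurable fun x => ‖T j f x‖ₑ ^ 2 := fun j _ =>
    ((hT j f hf hi).1.1.measurable.enorm).pow_const 2
  have hm' : ∀ j ∈ J, Measurable fun x => ‖ft (T j f) x‖ₑ ^ 2 := fun j _ =>
    ((measurable_ft (hT j f hf hi).1).enorm).pow_const 2
  rw [lintegral_finsetSum _ hm]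
  calc ∑ j ∈ J, ∫⁻ x, ‖T j f x‖ₑ ^ 2 = ∑ j ∈ J, ∫⁻ ξ, ‖ft (T j f) ξ‖ₑ ^ 2 := by
        refine Finset.sum_congr rfl fun j _ => ?_
        obtain ⟨h1, h2, -⟩ := hT j f hf hi
        rw [lintegral_ft h2 (h1.memLp_two h2)]
    _ = ∫⁻ ξ, ∑ j ∈ J, ‖ft (T j f) ξ‖ₑ ^ 2 := (lintegral_finsetSum _ hm').symm
    _ ≤ ∫⁻ ξ, ENNReal.ofReal K * ‖ft f ξ‖ₑ ^ 2 := by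
        refine lintegral_mono_ae ?_
        filter_upwards [ae_ne_zero_prod] with ξ hξ
        have h := hK ξ hξ.1 hξ.2
        calc ∑ j ∈ J, ‖ft (T j f) ξ‖ₑ ^ 2 = ∑ j ∈ J, ENNReal.ofReal (‖m j ξ‖ ^ 2) * ‖ft f ξ‖ₑ ^ 2 := by
              refine Finset.sum_congr rfl fun j _ => ?_
              rw [(hT j f hf hi).2.2, enorm_mul, mul_pow, ENNReal.ofReal_pow (norm_nonneg _),
                ofReal_norm]
          _ = ENNReal.ofReal (∑ j ∈ J, ‖m j ξ‖ ^ 2) * ‖ft f ξ‖ₑ ^ 2 := by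
              rw [← Finset.sum_mul, ENNReal.ofReal_sum_of_nonneg fun _ _ => by positivity]
          _ ≤ _ := by gcongr
    _ = _ := by
        rw [lintegral_const_mul _ ((measurable_ft hf).enorm.pow_const 2),
          lintegral_ft hi (hf.memLp_two hi)]

/-! ### `L²` estimates for the curve averages -/

/-- The normalized measure on a dyadic piece of the curve. -/
def cm (b : ℝ) (k i : ℤ) (ρ : ℝ) : Measure (ℝ × ℝ) :=
  (volume.restrict (Icc (1:ℝ) 2)).map fun t => (2 ^ k * t, 2 ^ i * ρ * t ^ b)

theorem measurable_curve_param (b : ℝ) (k i : ℤ) (ρ : ℝ) :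
    Measurable fun t : ℝ => ((2:ℝ) ^ k * t, (2:ℝ) ^ i * ρ * t ^ b) := by fun_prop

instance (b : ℝ) (k i : ℤ) (ρ : ℝ) : IsProbabilityMeasure (cm b k i ρ) := by
  have : IsProbabilityMeasure (volume.restrict (Icc (1:ℝ) 2)) :=
    ⟨by rw [Measure.restrict_apply_univ, Real.volume_Icc]; norm_num⟩
  exact Measure.isProbabilityMeasure_map (measurable_curve_param b k i ρ).aemeasurable

theorem fm_cm (b : ℝ) (k i : ℤ) (ρ : ℝ) (ξ : ℝ × ℝ) :
    fm (cm b k i ρ) ξ = EE b (-(2 ^ k * (2 * Real.pi * ξ.1))) (-(2 ^ i * (2 * Real.pi * ξ.2)) * ρ) := by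
  rw [fm, cm, integral_map (measurable_curve_param b k i ρ).aemeasurable
    (continuous_chr ξ).aestronglyMeasurable, integral_Icc_eq_integral_Ioc, EE,
    intervalIntegral.integral_of_le one_le_two]
  congr 1 with t
  simp only [chr, osc, phs]
  congr 3
  ring

theorem norm_fm_le_one (μ : Measure (ℝ × ℝ)) [IsProbabilityMeasure μ] (ξ : ℝ × ℝ) :
    ‖fm μ ξ‖ ≤ 1 := by
  have := norm_integral_le_of_norm_le_const (μ := μ) (f := chr ξ) (C := 1)
    (Eventually.of_forall fun x => (norm_chr ξ x).le)
  simpa [fm] using this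

theorem norm_one_sub_fm_le (μ : Measure (ℝ × ℝ)) [IsProbabilityMeasure μ] (ξ : ℝ × ℝ) {R : ℝ}
    (h : ∀ᵐ x ∂μ, |x.1 * ξ.1 + x.2 * ξ.2| ≤ R) : ‖1 - fm μ ξ‖ ≤ 2 * Real.pi * R := by
  have hi : Integrable (chr ξ) μ := Integrable.of_bound (continuous_chr ξ).aestronglyMeasurable 1
    (Eventually.of_forall fun x => (norm_chr ξ x).le)
  have h1 : 1 - fm μ ξ = ∫ x, (1 - chr ξ x) ∂μ := by
    rw [integral_sub (integrable_const _) hi, fm]; simp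
  have := norm_integral_le_of_norm_le_const (μ := μ) (f := fun x => 1 - chr ξ x)
    (C := 2 * Real.pi * R) (by
      filter_upwards [h] with x hx
      rw [norm_sub_rev, chr, mul_comm]
      refine (Real.norm_exp_I_mul_ofReal_sub_one_le).trans ?_
      rw [Real.norm_eq_abs, abs_neg, abs_mul, abs_of_pos (by positivity : 0 < 2 * Real.pi)]
      gcongr)
  rw [h1]
  simpa using this

theorem ae_tr_mem (k : ℤ) : ∀ᵐ t ∂(tr k), |t| ≤ 2 * 2 ^ k := by
  have hm : MeasurableSet {t : ℝ | |t| ≤ 2 * 2 ^ k} := measurableSet_le (by fun_prop) (by fun_prop)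
  rw [tr, Measure.conv, ae_map_iff (by fun_prop) hm]
  have h1 := (Measure.quasiMeasurePreserving_fst (μ := bx k) (ν := bx k)).ae (ae_bx_mem k)
  have h2 := (Measure.quasiMeasurePreserving_snd (μ := bx k) (ν := bx k)).ae (ae_bx_mem k)
  filter_upwards [h1, h2] with z h1 h2
  exact (abs_add_le _ _).trans (by linarith)

theorem norm_one_sub_fm_ax1_le (k : ℤ) (ξ : ℝ × ℝ) :
    ‖1 - fm (ax1 (tr k)) ξ‖ ≤ 2 * min 1 (2 ^ k * |2 * Real.pi * ξ.1|) := by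
  rw [mul_min_of_nonneg _ _ two_pos.le]
  refine le_min ((norm_sub_le _ _).trans ?_) ((norm_one_sub_fm_le (R := 2 * 2 ^ k * |ξ.1|) _ ξ ?_).trans ?_)
  · have := norm_fm_le_one (ax1 (tr k)) ξ
    rw [norm_one]; linarith
  · have hm : MeasurableSet {x : ℝ × ℝ | |x.1 * ξ.1 + x.2 * ξ.2| ≤ 2 * 2 ^ k * |ξ.1|} :=
      measurableSet_le (by fun_prop) (by fun_prop)
    rw [ax1, ae_map_iff measurable_axis1.aemeasurable hm]
    filter_upwards [ae_tr_mem k] with t ht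
    simp only [zero_mul, add_zero, abs_mul]
    gcongr
  · rw [abs_mul, abs_of_pos (by positivity : 0 < 2 * Real.pi)]
    apply le_of_eq; ring

theorem norm_one_sub_fm_ax2_le (k : ℤ) (ξ : ℝ × ℝ) :
    ‖1 - fm (ax2 (tr k)) ξ‖ ≤ 2 * min 1 (2 ^ k * |2 * Real.pi * ξ.2|) := by
  rw [mul_min_of_nonneg _ _ two_pos.le]
  refine le_min ((norm_sub_le _ _).trans ?_) ((norm_one_sub_fm_le (R := 2 * 2 ^ k * |ξ.2|) _ ξ ?_).trans ?_)
  · have := norm_fm_le_one (ax2 (tr k)) ξ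
    rw [norm_one]; linarith
  · have hm : MeasurableSet {x : ℝ × ℝ | |x.1 * ξ.1 + x.2 * ξ.2| ≤ 2 * 2 ^ k * |ξ.2|} :=
      measurableSet_le (by fun_prop) (by fun_prop)
    rw [ax2, ae_map_iff measurable_axis2.aemeasurable hm]
    filter_upwards [ae_tr_mem k] with t ht
    simp only [zero_mul, zero_add, abs_mul]
    gcongr
  · rw [abs_mul, abs_of_pos (by positivity : 0 < 2 * Real.pi)]
    apply le_of_eq; ring

/-- The part of `f` oscillating at scales finer than `2^k` in the first variable. -/
def hi1 (k : ℤ) (f : ℝ × ℝ → ℝ) (x : ℝ × ℝ) : ℝ := f x - conv (ax1 (tr k)) f x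

/-- The part of `f` oscillating at scales finer than `2^k` in the second variable. -/
def hi2 (k : ℤ) (f : ℝ × ℝ → ℝ) (x : ℝ × ℝ) : ℝ := f x - conv (ax2 (tr k)) f x

theorem hasMult_hi1 (k : ℤ) : HasMult (hi1 k) fun ξ => 1 - fm (ax1 (tr k)) ξ :=
  hasMult_id.sub (hasMult_conv _)

theorem hasMult_hi2 (k : ℤ) : HasMult (hi2 k) fun ξ => 1 - fm (ax2 (tr k)) ξ :=
  hasMult_id.sub (hasMult_conv _)

theorem hasMult_df1 (L : ℕ) (k : ℤ) :
    HasMult (df1 L k) fun ξ => fm (ax1 (tr (k - L))) ξ - fm (ax1 (tr k)) ξ :=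
  (hasMult_conv _).sub (hasMult_conv _)

theorem hasMult_df2 (L : ℕ) (k : ℤ) :
    HasMult (df2 L k) fun ξ => fm (ax2 (tr (k - L))) ξ - fm (ax2 (tr k)) ξ :=
  (hasMult_conv _).sub (hasMult_conv _)

theorem norm_sub_le_of_one_sub {z w : ℂ} {a : ℝ} {k : ℤ} {L : ℕ} (ha : 0 ≤ a)
    (hz : ‖1 - z‖ ≤ 2 * min 1 (2 ^ (k - L) * a)) (hw : ‖1 - w‖ ≤ 2 * min 1 (2 ^ k * a)) :
    ‖z - w‖ ≤ 4 * min 1 (2 ^ k * a) := by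
  have h1 : z - w = (1 - w) - (1 - z) := by ring
  have h2 : min 1 ((2:ℝ) ^ (k - L) * a) ≤ min 1 (2 ^ k * a) := by
    gcongr
    · exact one_le_two
    · omega
  rw [h1]
  refine (norm_sub_le _ _).trans ?_
  linarith

theorem sq_min_one_le {z : ℝ} (hz : 0 < z) : min 1 z ^ 2 ≤ √z * hh z := by
  refine le_trans ?_ (min_one_div_sqrt_le hz)
  have h1 : min 1 z ≤ 1 := min_le_left _ _
  have h0 : 0 ≤ min 1 z := by positivity
  nlinarith

theorem sum_hh_prod_le {J : Finset (ℤ × ℤ)} (x y : ℝ) (hx : 0 < x) (hy : 0 < y) :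
    ∑ j ∈ J, hh (2 ^ j.1 * x) * hh (2 ^ j.2 * y) ≤ cG * cG := by
  have hsub : J ⊆ (J.image Prod.fst) ×ˢ (J.image Prod.snd) := by
    intro j hj
    rw [Finset.mem_product]
    exact ⟨Finset.mem_image_of_mem _ hj, Finset.mem_image_of_mem _ hj⟩
  refine (Finset.sum_le_sum_of_subset_of_nonneg hsub fun j _ _ =>
    mul_nonneg (hh_nonneg _) (hh_nonneg _)).trans ?_
  rw [Finset.sum_product]
  dsimp only
  rw [← Finset.sum_mul_sum]
  exact mul_le_mul (sum_hh_le _ hx) (sum_hh_le _ hy)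
    (Finset.sum_nonneg fun _ _ => hh_nonneg _) cG_nonneg

theorem sum_hh_div_le {J : Finset (ℤ × ℤ)} (x y d : ℝ) (hx : 0 < x) (hy : 0 < y) (hd : 0 < d) :
    ∑ j ∈ J, hh (2 ^ j.1 * x / (2 ^ j.2 * y)) * hh (d * (2 ^ j.2 * y)) ≤ cG * cG := by
  have hsub : J ⊆ (J.image Prod.fst) ×ˢ (J.image Prod.snd) := by
    intro j hj
    rw [Finset.mem_product]
    exact ⟨Finset.mem_image_of_mem _ hj, Finset.mem_image_of_mem _ hj⟩
  refine (Finset.sum_le_sum_of_subset_of_nonneg hsub fun j _ _ =>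
    mul_nonneg (hh_nonneg _) (hh_nonneg _)).trans ?_
  rw [Finset.sum_product_right]
  calc _ ≤ ∑ i ∈ J.image Prod.snd, cG * hh (2 ^ i * (d * y)) := by
        refine Finset.sum_le_sum fun i _ => ?_
        dsimp only
        rw [← Finset.sum_mul]
        have e : d * (2 ^ i * y) = 2 ^ i * (d * y) := by ring
        rw [e]
        refine mul_le_mul_of_nonneg_right ?_ (hh_nonneg _)
        have := sum_hh_le (J.image Prod.fst) (x := x / (2 ^ i * y)) (by positivity)
        simpa only [mul_div_assoc] using this
    _ ≤ _ := by
        rw [← Finset.mul_sum]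
        exact mul_le_mul_of_nonneg_left (sum_hh_le _ (by positivity)) cG_nonneg

theorem l2_block {b c1 : ℝ} (hb : 1 < b) (hc1 : 0 < c1) : ∃ C, 0 < C ∧ ∀ ρ : ℤ × ℤ → ℝ,
    (∀ j, c1 ≤ |ρ j|) → ∀ (L : ℕ) (s1 s2 : ℤ) (J : Finset (ℤ × ℤ)) (f : ℝ × ℝ → ℝ), BM f →
    Integrable f →
    ∫⁻ x, ∑ j ∈ J, ‖conv (cm b j.1 j.2 (ρ j)) (df1 L (j.1 - s1) (df2 L (j.2 - s2) f)) x‖ₑ ^ 2 ≤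
      ENNReal.ofReal (C * (√(2 ^ (-s1)) * √(2 ^ (-s2)))) * ∫⁻ x, ‖f x‖ₑ ^ 2 := by
  obtain ⟨C, hC, hE⟩ := EE_decay hb
  refine ⟨C * (√c1)⁻¹ * 256 * (cG * cG + 1), by have := cG_nonneg; positivity, ?_⟩
  intro ρ hρ L s1 s2 J f hf hi
  refine HasMult.sum_lintegral_le J
    (T := fun j f => conv (cm b j.1 j.2 (ρ j)) (df1 L (j.1 - s1) (df2 L (j.2 - s2) f)))
    (fun j => (hasMult_conv (cm b j.1 j.2 (ρ j))).comp
      ((hasMult_df1 L (j.1 - s1)).comp (hasMult_df2 L (j.2 - s2)))) ?_ hf hi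
  intro ξ hξ1 hξ2
  set x := |2 * Real.pi * ξ.1| with hx
  set y := |2 * Real.pi * ξ.2| with hy
  have hpi := Real.pi_pos
  have hx0 : 0 < x := abs_pos.mpr (by positivity)
  have hy0 : 0 < y := abs_pos.mpr (by positivity)
  have hterm : ∀ j ∈ J, ‖fm (cm b j.1 j.2 (ρ j)) ξ *
      ((fm (ax1 (tr (j.1 - s1 - L))) ξ - fm (ax1 (tr (j.1 - s1))) ξ) *
      (fm (ax2 (tr (j.2 - s2 - L))) ξ - fm (ax2 (tr (j.2 - s2))) ξ))‖ ^ 2 ≤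
      C * (√c1)⁻¹ * 256 * (√(2 ^ (-s1)) * √(2 ^ (-s2))) *
        (hh (2 ^ j.1 * (2 ^ (-s1) * x)) * hh (2 ^ j.2 * (2 ^ (-s2) * y))) := by
    intro j _
    have h1 := norm_sub_le_of_one_sub hx0.le (norm_one_sub_fm_ax1_le (j.1 - s1 - L) ξ)
      (norm_one_sub_fm_ax1_le (j.1 - s1) ξ)
    have h2 := norm_sub_le_of_one_sub hy0.le (norm_one_sub_fm_ax2_le (j.2 - s2 - L) ξ)
      (norm_one_sub_fm_ax2_le (j.2 - s2) ξ)
    have hρ0 : ρ j ≠ 0 := abs_pos.mp (hc1.trans_le (hρ j))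
    have h3 := hE (-(2 ^ j.1 * (2 * Real.pi * ξ.1))) (-(2 ^ j.2 * (2 * Real.pi * ξ.2)) * ρ j)
      (by simp only [neg_ne_zero]; positivity)
      (mul_ne_zero (by simp only [neg_ne_zero]; positivity) hρ0)
    have hα : |-(2 ^ j.1 * (2 * Real.pi * ξ.1))| = 2 ^ j.1 * x := by
      rw [abs_neg, abs_mul, abs_of_pos (by positivity : (0:ℝ) < 2 ^ j.1)]
    have hβ : |-(2 ^ j.2 * (2 * Real.pi * ξ.2)) * ρ j| = 2 ^ j.2 * y * |ρ j| := by
      rw [abs_mul, abs_neg, abs_mul (2 ^ j.2), abs_of_pos (by positivity : (0:ℝ) < 2 ^ j.2)]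
    rw [← fm_cm, hα, hβ] at h3
    set X := 2 ^ j.1 * x with hX
    set Y := 2 ^ j.2 * y with hY
    have hX0 : 0 < X := by positivity
    have hY0 : 0 < Y := by positivity
    have e1 : (2:ℝ) ^ (j.1 - s1) * x = 2 ^ (-s1) * X := by
      rw [sub_eq_add_neg, zpow_add₀ two_ne_zero]; ring
    have e2 : (2:ℝ) ^ (j.2 - s2) * y = 2 ^ (-s2) * Y := by
      rw [sub_eq_add_neg, zpow_add₀ two_ne_zero]; ring
    have e3 : (2:ℝ) ^ j.1 * (2 ^ (-s1) * x) = 2 ^ (-s1) * X := by ring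
    have e4 : (2:ℝ) ^ j.2 * (2 ^ (-s2) * y) = 2 ^ (-s2) * Y := by ring
    rw [e1] at h1
    rw [e2] at h2
    rw [e3, e4, norm_mul, norm_mul, mul_pow, mul_pow]
    have h1' := sq_min_one_le (z := 2 ^ (-s1) * X) (by positivity)
    have h2' := sq_min_one_le (z := 2 ^ (-s2) * Y) (by positivity)
    rw [Real.sqrt_mul (by positivity)] at h1' h2'
    have h3' : (√(Y * |ρ j|))⁻¹ ≤ (√Y)⁻¹ * (√c1)⁻¹ := by
      rw [← mul_inv, ← Real.sqrt_mul hY0.le]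
      have : 0 < √(Y * c1) := Real.sqrt_pos.mpr (by positivity)
      have := hρ j
      gcongr
    have hhx := hh_nonneg (2 ^ (-s1) * X)
    have hhy := hh_nonneg (2 ^ (-s2) * Y)
    have hsX : 0 < √X := Real.sqrt_pos.mpr hX0
    have hsY : 0 < √Y := Real.sqrt_pos.mpr hY0
    calc _ ≤ (C * ((√X)⁻¹ * ((√Y)⁻¹ * (√c1)⁻¹))) * ((4 * min 1 (2 ^ (-s1) * X)) ^ 2 *
          (4 * min 1 (2 ^ (-s2) * Y)) ^ 2) := by
          refine mul_le_mul (h3.trans ?_) (mul_le_mul ?_ ?_ ?_ ?_) ?_ ?_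
          · gcongr
          · gcongr
          · gcongr
          · positivity
          · positivity
          · positivity
          · positivity
      _ = (C * ((√X)⁻¹ * ((√Y)⁻¹ * (√c1)⁻¹))) * 256 * ((min 1 (2 ^ (-s1) * X)) ^ 2 *
          (min 1 (2 ^ (-s2) * Y)) ^ 2) := by ring
      _ ≤ (C * ((√X)⁻¹ * ((√Y)⁻¹ * (√c1)⁻¹))) * 256 *
          ((√(2 ^ (-s1)) * √X * hh (2 ^ (-s1) * X)) * (√(2 ^ (-s2)) * √Y * hh (2 ^ (-s2) * Y))) := by
          gcongr
      _ = _ := by field_simp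
  refine (Finset.sum_le_sum hterm).trans ?_
  rw [← Finset.mul_sum]
  have := sum_hh_prod_le (J := J) (2 ^ (-s1) * x) (2 ^ (-s2) * y) (by positivity) (by positivity)
  calc _ ≤ C * (√c1)⁻¹ * 256 * (√(2 ^ (-s1)) * √(2 ^ (-s2))) * (cG * cG + 1) := by
        gcongr; linarith
    _ = _ := by ring

theorem l2_diff {b c1 c2 : ℝ} (hb : 1 < b) (hc1 : 0 < c1) : ∃ C, 0 < C ∧ ∀ d : ℝ, 0 < d →
    ∀ ρ ρ' : ℤ × ℤ → ℝ, (∀ j, c1 ≤ |ρ j| ∧ |ρ j| ≤ c2) → (∀ j, c1 ≤ |ρ' j| ∧ |ρ' j| ≤ c2) →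
    (∀ j, |ρ j - ρ' j| ≤ d) → ∀ (J : Finset (ℤ × ℤ)) (f : ℝ × ℝ → ℝ), BM f → Integrable f →
    ∫⁻ x, ∑ j ∈ J, ‖conv (cm b j.1 j.2 (ρ j)) (hi1 j.1 (hi2 j.2 f)) x -
        conv (cm b j.1 j.2 (ρ' j)) (hi1 j.1 (hi2 j.2 f)) x‖ₑ ^ 2 ≤
      ENNReal.ofReal (C * d) * ∫⁻ x, ‖f x‖ₑ ^ 2 := by
  set K := max 1 (max c1⁻¹ c2) with hK
  have hK1 : 1 ≤ K := le_max_left _ _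
  have hKc1 : c1⁻¹ ≤ K := (le_max_left _ _).trans (le_max_right _ _)
  have hKc2 : c2 ≤ K := (le_max_right _ _).trans (le_max_right _ _)
  have hK0 : 0 < K := by linarith
  have hc1K : 1 / K ≤ c1 := by
    rw [one_div]; exact inv_le_of_inv_le₀ hc1 hKc1
  obtain ⟨C, hC, hE⟩ := EE_diff hb hK1
  refine ⟨C * 16 * (2 * (cG * cG) + 1), by have := cG_nonneg; positivity, ?_⟩
  intro d hd ρ ρ' hρ hρ' hρρ J f hf hi
  refine HasMult.sum_lintegral_le J
    (T := fun j f x => conv (cm b j.1 j.2 (ρ j)) (hi1 j.1 (hi2 j.2 f)) x -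
        conv (cm b j.1 j.2 (ρ' j)) (hi1 j.1 (hi2 j.2 f)) x)
    (fun j => ((hasMult_conv (cm b j.1 j.2 (ρ j))).comp
      ((hasMult_hi1 j.1).comp (hasMult_hi2 j.2))).sub ((hasMult_conv (cm b j.1 j.2 (ρ' j))).comp
      ((hasMult_hi1 j.1).comp (hasMult_hi2 j.2)))) ?_ hf hi
  intro ξ hξ1 hξ2
  set x := |2 * Real.pi * ξ.1| with hx
  set y := |2 * Real.pi * ξ.2| with hy
  have hpi := Real.pi_pos
  have hx0 : 0 < x := abs_pos.mpr (by positivity)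
  have hy0 : 0 < y := abs_pos.mpr (by positivity)
  have hterm : ∀ j ∈ J, ‖fm (cm b j.1 j.2 (ρ j)) ξ *
      ((1 - fm (ax1 (tr j.1)) ξ) * (1 - fm (ax2 (tr j.2)) ξ)) - fm (cm b j.1 j.2 (ρ' j)) ξ *
      ((1 - fm (ax1 (tr j.1)) ξ) * (1 - fm (ax2 (tr j.2)) ξ))‖ ^ 2 ≤
      C * 16 * d * (hh (2 ^ j.1 * x) * hh (2 ^ j.2 * y) +
        hh (2 ^ j.1 * x / (2 ^ j.2 * y)) * hh (d * (2 ^ j.2 * y))) := by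
    intro j _
    have h1 := norm_one_sub_fm_ax1_le j.1 ξ
    have h2 := norm_one_sub_fm_ax2_le j.2 ξ
    rw [← hx] at h1
    rw [← hy] at h2
    set X := 2 ^ j.1 * x with hX
    set Y := 2 ^ j.2 * y with hY
    have hX0 : 0 < X := by positivity
    have hY0 : 0 < Y := by positivity
    set α := -(2 ^ j.1 * (2 * Real.pi * ξ.1)) with hα
    have hαX : |α| = X := by
      rw [hα, abs_neg, abs_mul, abs_of_pos (by positivity : (0:ℝ) < 2 ^ j.1)]
    set β := -(2 ^ j.2 * (2 * Real.pi * ξ.2)) with hβ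
    have hβY : |β| = Y := by
      rw [hβ, abs_neg, abs_mul, abs_of_pos (by positivity : (0:ℝ) < 2 ^ j.2)]
    have lo : ∀ r, c1 ≤ |r| → Y / K ≤ |β * r| := fun r hr => by
      rw [abs_mul, hβY]
      calc Y / K = Y * (1 / K) := by ring
        _ ≤ _ := by gcongr; exact hc1K.trans hr
    have up : ∀ r, |r| ≤ c2 → |β * r| ≤ K * Y := fun r hr => by
      rw [abs_mul, hβY, mul_comm]
      gcongr; exact hr.trans hKc2
    have h3 := hE α (β * ρ' j) (β * ρ j) Y d (abs_pos.mp (hαX ▸ hX0)) hY0 hd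
      (lo _ (hρ' j).1) (up _ (hρ' j).2) (lo _ (hρ j).1) (up _ (hρ j).2) (by
        rw [← mul_sub, abs_mul, hβY]
        calc Y * |ρ j - ρ' j| ≤ Y * d := by gcongr; exact hρρ j
          _ = 1 * (d * Y) := by ring
          _ ≤ _ := by gcongr)
    rw [← sq_abs α, hαX, hα, hβ, ← fm_cm, ← fm_cm] at h3
    have hsq : ∀ z : ℝ, 0 < z → min 1 z ^ 2 = min 1 (z ^ 2) := fun z hz => by
      rcases le_total 1 z with h | h
      · rw [min_eq_left h, min_eq_left (one_le_pow₀ h), one_pow]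
      · rw [min_eq_right h, min_eq_right (pow_le_one₀ hz.le h)]
    rw [← sub_mul, norm_mul, norm_mul, mul_pow, mul_pow]
    calc _ ≤ ‖fm (cm b j.1 j.2 (ρ j)) ξ - fm (cm b j.1 j.2 (ρ' j)) ξ‖ ^ 2 *
          ((2 * min 1 X) ^ 2 * (2 * min 1 Y) ^ 2) := by gcongr
      _ = 16 * (‖fm (cm b j.1 j.2 (ρ j)) ξ - fm (cm b j.1 j.2 (ρ' j)) ξ‖ ^ 2 *
          (min 1 (X ^ 2) * min 1 (Y ^ 2))) := by rw [← hsq X hX0, ← hsq Y hY0]; ring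
      _ ≤ 16 * (C * d * (hh X * hh Y + hh (X / Y) * hh (d * Y))) := by gcongr
      _ = _ := by ring
  refine (Finset.sum_le_sum hterm).trans ?_
  rw [← Finset.mul_sum, Finset.sum_add_distrib]
  have k1 := sum_hh_prod_le (J := J) x y hx0 hy0
  have k2 := sum_hh_div_le (J := J) x y d hx0 hy0 hd
  calc _ ≤ C * 16 * d * (2 * (cG * cG) + 1) :=
        mul_le_mul_of_nonneg_left (by linarith) (by positivity)
    _ = _ := by ring

/-! ### Domination of the low frequency parts -/

theorem convP_cm (b : ℝ) (k i : ℤ) (ρ : ℝ) {g : ℝ × ℝ → ℝ≥0∞} (hg : Measurable g) (x : ℝ × ℝ) :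
    convP (cm b k i ρ) g x =
      ∫⁻ t in Icc (1:ℝ) 2, g (x.1 - 2 ^ k * t, x.2 - 2 ^ i * ρ * t ^ b) := by
  rw [convP, cm, lintegral_map (by fun_prop) (measurable_curve_param b k i ρ)]
  rfl

theorem lintegral_curve_le {a b : ℝ} (hb : 1 ≤ b) (ha : a ≠ 0) {m : ℤ}
    (hm : |a| * 2 ^ b ≤ 2 ^ m) (G : ℝ → ℝ≥0∞) (x : ℝ) :
    ∫⁻ t in Icc (1:ℝ) 2, G (x - a * t ^ b) ≤
      ENNReal.ofReal (2 * 2 ^ m / |a|) * convP (bx m) G x := by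
  have ha' : 0 < |a| := abs_pos.mpr ha
  have hder : ∀ t ∈ Icc (1:ℝ) 2, HasDerivWithinAt (fun t : ℝ => x - a * t ^ b)
      (-(a * (b * t ^ (b - 1)))) (Icc 1 2) t := fun t ht =>
    (((Real.hasDerivAt_rpow_const (Or.inl (by linarith [ht.1]))).const_mul a).const_sub
      x).hasDerivWithinAt
  have hinj : InjOn (fun t : ℝ => x - a * t ^ b) (Icc 1 2) := by
    intro s hs t ht hst
    have h1 : s ^ b = t ^ b := by
      have : a * s ^ b = a * t ^ b := by simpa using hst
      exact mul_left_cancel₀ ha this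
    exact (Real.rpow_left_inj (by linarith [hs.1]) (by linarith [ht.1]) (by linarith)).mp h1
  have h := lintegral_image_eq_lintegral_abs_deriv_mul measurableSet_Icc hder hinj G
  have hlow : ENNReal.ofReal |a| * ∫⁻ t in Icc (1:ℝ) 2, G (x - a * t ^ b) ≤
      ∫⁻ y in Metric.closedBall x (2 ^ m), G y := by
    rw [← lintegral_const_mul' _ _ ENNReal.ofReal_ne_top]
    calc _ ≤ ∫⁻ t in Icc (1:ℝ) 2, ENNReal.ofReal |(-(a * (b * t ^ (b - 1))))| *
          G (x - a * t ^ b) := by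
          refine setLIntegral_mono' measurableSet_Icc fun t ht => ?_
          refine mul_le_mul_left (ENNReal.ofReal_le_ofReal ?_) _
          rw [abs_neg, abs_mul]
          have h1 : 1 ≤ t ^ (b - 1) := Real.one_le_rpow ht.1 (by linarith)
          have h2 : 1 ≤ b * t ^ (b - 1) := by nlinarith
          rw [abs_of_nonneg (by linarith : 0 ≤ b * t ^ (b - 1))]
          nlinarith
      _ = _ := h.symm
      _ ≤ _ := by
          refine lintegral_mono_set ?_
          rintro _ ⟨t, ht, rfl⟩
          rw [Metric.mem_closedBall, Real.dist_eq, sub_sub_cancel_left, abs_neg, abs_mul]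
          refine le_trans ?_ hm
          have h1 : t ^ b ≤ 2 ^ b := Real.rpow_le_rpow (by linarith [ht.1]) ht.2 (by linarith)
          rw [abs_of_nonneg (Real.rpow_nonneg (by linarith [ht.1]) _)]
          gcongr
  rw [convP_bx, ← mul_assoc]
  have e : ENNReal.ofReal (2 * 2 ^ m / |a|) * (ENNReal.ofReal (2 * 2 ^ m))⁻¹ =
      (ENNReal.ofReal |a|)⁻¹ := by
    rw [div_eq_mul_inv, ENNReal.ofReal_mul (by positivity), mul_right_comm,
      ENNReal.mul_inv_cancel (by simp; positivity) ENNReal.ofReal_ne_top, one_mul,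
      ENNReal.ofReal_inv_of_pos ha']
  rw [e, ← ENNReal.div_eq_inv_mul, ENNReal.le_div_iff_mul_le (Or.inl (by simpa using ha))
    (Or.inl ENNReal.ofReal_ne_top), mul_comm]
  exact hlow

theorem convP_bx_scale_le (k : ℤ) (N : ℕ) (w : ℝ → ℝ≥0∞) (x : ℝ) :
    convP (bx k) w x ≤ 2 ^ N * convP (bx (k + N)) w x := by
  rw [convP_bx, convP_bx, ← mul_assoc]
  have h2 : (0:ℝ) < 2 * 2 ^ k := by positivity
  have e : (2:ℝ≥0∞) ^ N * (ENNReal.ofReal (2 * 2 ^ (k + (N:ℤ))))⁻¹ =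
      (ENNReal.ofReal (2 * 2 ^ k))⁻¹ := by
    have h3 : (2:ℝ) * 2 ^ (k + (N:ℤ)) = 2 ^ N * (2 * 2 ^ k) := by
      rw [zpow_add₀ two_ne_zero, zpow_natCast]; ring
    rw [h3, ENNReal.ofReal_mul (by positivity), ENNReal.ofReal_pow two_pos.le,
      ENNReal.ofReal_ofNat, ENNReal.mul_inv (Or.inl (by simp)) (Or.inl (by simp)), ← mul_assoc,
      ENNReal.mul_inv_cancel (by simp) (by simp), one_mul]
  rw [e]
  gcongr
  · exact one_le_two
  · omega

theorem convP_tr_sub_le (k : ℤ) (N : ℕ) {w : ℝ → ℝ≥0∞} (hw : Measurable w) (x s : ℝ)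
    (hs : |s| ≤ 2 ^ (k + N)) :
    convP (tr k) w (x - s) ≤ 2 ^ N * 4 * convP (bx (k + N + 2)) w x := by
  rw [tr, convP_conv _ _ hw]
  have h : ∀ᵐ y ∂(bx k), convP (bx k) w (x - s - y) ≤
      2 ^ N * (4 * convP (bx (k + N + 2)) w x) := by
    filter_upwards [ae_bx_mem k] with y hy
    refine (convP_bx_scale_le k N w _).trans ?_
    gcongr
    rw [sub_sub]
    refine convP_bx_sub_le _ _ _ _ ((abs_add_le _ _).trans ?_)
    have : (2:ℝ) ^ k ≤ 2 ^ (k + (N:ℤ)) := zpow_le_zpow_right₀ one_le_two (by omega)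
    have : (0:ℝ) < 2 ^ k := by positivity
    linarith
  rw [convP]
  refine (lintegral_mono_ae h).trans ?_
  rw [lintegral_const, measure_univ, mul_one, mul_assoc]

theorem dom_low {b c1 c2 : ℝ} (hb : 1 < b) (hc1 : 0 < c1) : ∃ C, 0 < C ∧ ∀ ρ : ℝ, c1 ≤ |ρ| →
    |ρ| ≤ c2 → ∀ (k i : ℤ) (g : ℝ × ℝ → ℝ≥0∞), Measurable g → ∀ x,
    convP (cm b k i ρ) (convP (ax1 (tr k)) g) x ≤ ENNReal.ofReal C * HLM2 g x ∧
    convP (cm b k i ρ) (convP (ax2 (tr i)) g) x ≤ ENNReal.ofReal C * HLM2 g x ∧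
    convP (cm b k i ρ) (convP (ax1 (tr k)) (convP (ax2 (tr i)) g)) x ≤
      ENNReal.ofReal C * HLM2 g x := by
  obtain ⟨N, hN⟩ := pow_unbounded_of_one_lt (c2 * 2 ^ b) (one_lt_two (α := ℝ))
  refine ⟨8 * (2 * 2 ^ N / c1) + 2 ^ N * 4 * 4 + 8 * (2 ^ N * 4), by positivity, ?_⟩
  intro ρ hρ1 hρ2 k i g hg x
  have hρ0 : 0 < |ρ| := by linarith
  have hshift : ∀ t ∈ Icc (1:ℝ) 2, |2 ^ i * ρ * t ^ b| ≤ 2 ^ (i + (N:ℤ)) := fun t ht => by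
    have h1 : t ^ b ≤ 2 ^ b := Real.rpow_le_rpow (by linarith [ht.1]) ht.2 (by linarith)
    have h0 : 0 ≤ t ^ b := Real.rpow_nonneg (by linarith [ht.1]) _
    rw [abs_mul, abs_mul, abs_of_nonneg h0, abs_of_pos (by positivity : (0:ℝ) < 2 ^ i),
      zpow_add₀ two_ne_zero, zpow_natCast, mul_assoc]
    gcongr
    refine le_trans ?_ hN.le
    have := hρ0.le.trans hρ2
    gcongr
  have hshift1 : ∀ t ∈ Icc (1:ℝ) 2, |2 ^ k * t| ≤ 2 ^ (k + ((1:ℕ):ℤ)) := fun t ht => by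
    rw [abs_of_nonneg (by have := ht.1; positivity), zpow_add₀ two_ne_zero]
    have := ht.2
    gcongr
    simpa using ht.2
  have m1 : ∀ (μ : Measure ℝ) [IsProbabilityMeasure μ] (g : ℝ × ℝ → ℝ≥0∞), Measurable g →
      Measurable (convP (ax1 μ) g) := fun μ _ g hg => measurable_convP _ hg
  have m2 : ∀ (μ : Measure ℝ) [IsProbabilityMeasure μ] (g : ℝ × ℝ → ℝ≥0∞), Measurable g →
      Measurable (convP (ax2 μ) g) := fun μ _ g hg => measurable_convP _ hg
  have s1 : ∀ g : ℝ × ℝ → ℝ≥0∞, Measurable g → ∀ t ∈ Icc (1:ℝ) 2, ∀ c,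
      convP (ax1 (tr k)) g (x.1 - 2 ^ k * t, c) ≤ 8 * convP (ax1 (bx (k + (1:ℕ) + 2))) g (x.1, c) := by
    intro g hg t ht c
    rw [convP_ax1 _ hg, convP_ax1 _ hg]
    refine (convP_tr_sub_le k 1 (by fun_prop) _ _ (hshift1 t ht)).trans (le_of_eq ?_)
    norm_num
  have s2 : ∀ g : ℝ × ℝ → ℝ≥0∞, Measurable g → ∀ t ∈ Icc (1:ℝ) 2, ∀ c,
      convP (ax2 (tr i)) g (c, x.2 - 2 ^ i * ρ * t ^ b) ≤
        2 ^ N * 4 * convP (ax2 (bx (i + N + 2))) g (c, x.2) := by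
    intro g hg t ht c
    rw [convP_ax2 _ hg, convP_ax2 _ hg]
    exact convP_tr_sub_le i N (by fun_prop) _ _ (hshift t ht)
  have hsup : ∀ k i, convP (ax2 (bx i)) (convP (ax1 (bx k)) g) x ≤ HLM2 g x := fun k i => by
    rw [convP_comm _ _ hg]; exact convP_ax_le_HLM2 g k i x
  refine ⟨?_, ?_, ?_⟩
  · rw [convP_cm _ _ _ _ (m1 _ g hg)]
    calc _ ≤ ∫⁻ t in Icc (1:ℝ) 2, 8 * convP (ax1 (bx (k + (1:ℕ) + 2))) g
          (x.1, x.2 - 2 ^ i * ρ * t ^ b) :=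
          setLIntegral_mono' measurableSet_Icc fun t ht => s1 g hg t ht _
      _ = 8 * ∫⁻ t in Icc (1:ℝ) 2, convP (ax1 (bx (k + (1:ℕ) + 2))) g
          (x.1, x.2 - 2 ^ i * ρ * t ^ b) := lintegral_const_mul' _ _ (by norm_num)
      _ ≤ 8 * (ENNReal.ofReal (2 * 2 ^ (i + (N:ℤ)) / |2 ^ i * ρ|) * convP (bx (i + N))
          (fun s => convP (ax1 (bx (k + (1:ℕ) + 2))) g (x.1, s)) x.2) := by
          gcongr
          refine lintegral_curve_le (G := fun s => convP (ax1 (bx (k + (1:ℕ) + 2))) g (x.1, s))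
            hb.le (mul_ne_zero (by positivity) (abs_pos.mp hρ0)) ?_ _
          have := hshift 2 (by norm_num)
          rwa [abs_mul, abs_of_nonneg (by positivity : (0:ℝ) ≤ 2 ^ b)] at this
      _ = 8 * (ENNReal.ofReal (2 * 2 ^ (i + (N:ℤ)) / |2 ^ i * ρ|) * convP (ax2 (bx (i + N)))
          (convP (ax1 (bx (k + (1:ℕ) + 2))) g) x) := by
          rw [convP_ax2 _ (m1 _ g hg)]
      _ ≤ 8 * (ENNReal.ofReal (2 * 2 ^ N / c1) * HLM2 g x) := by
          refine mul_le_mul_right (mul_le_mul' (ENNReal.ofReal_le_ofReal ?_) ?_) _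
          · rw [abs_mul, abs_of_pos (by positivity : (0:ℝ) < 2 ^ i), zpow_add₀ two_ne_zero,
              zpow_natCast]
            calc 2 * ((2:ℝ) ^ i * 2 ^ N) / (2 ^ i * |ρ|) = 2 * 2 ^ N / |ρ| := by field_simp
              _ ≤ _ := by gcongr
          · exact hsup _ _
      _ = ENNReal.ofReal (8 * (2 * 2 ^ N / c1)) * HLM2 g x := by
          rw [ENNReal.ofReal_mul (by norm_num), ENNReal.ofReal_ofNat, mul_assoc]
      _ ≤ _ := by
          gcongr
          rw [add_assoc]
          exact le_add_of_nonneg_right (by positivity)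
  · rw [convP_cm _ _ _ _ (m2 _ g hg)]
    calc _ ≤ ∫⁻ t in Icc (1:ℝ) 2, 2 ^ N * 4 * convP (ax2 (bx (i + N + 2))) g
          (x.1 - 2 ^ k * t, x.2) :=
          setLIntegral_mono' measurableSet_Icc fun t ht => s2 g hg t ht _
      _ = 2 ^ N * 4 * ∫⁻ t in Icc (1:ℝ) 2, convP (ax2 (bx (i + N + 2))) g
          (x.1 - 2 ^ k * t ^ (1:ℝ), x.2) := by
          simp only [Real.rpow_one]
          exact lintegral_const_mul' _ _ (ENNReal.mul_ne_top (by simp) (by simp))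
      _ ≤ 2 ^ N * 4 * (ENNReal.ofReal (2 * 2 ^ (k + 1) / |2 ^ k|) * convP (bx (k + 1))
          (fun s => convP (ax2 (bx (i + N + 2))) g (s, x.2)) x.1) := by
          gcongr
          refine lintegral_curve_le (G := fun s => convP (ax2 (bx (i + N + 2))) g (s, x.2))
            le_rfl (by positivity) ?_ _
          rw [abs_of_pos (by positivity : (0:ℝ) < 2 ^ k), Real.rpow_one, zpow_add₀ two_ne_zero,
            zpow_one]
      _ = 2 ^ N * 4 * (4 * convP (ax1 (bx (k + 1)))
          (convP (ax2 (bx (i + N + 2))) g) x) := by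
          rw [convP_ax1 _ (m2 _ g hg), abs_of_pos (by positivity : (0:ℝ) < 2 ^ k)]
          have : 2 * (2:ℝ) ^ (k + 1) / 2 ^ k = 4 := by
            rw [zpow_add₀ two_ne_zero]; field_simp; norm_num
          rw [this, ENNReal.ofReal_ofNat]
      _ ≤ 2 ^ N * 4 * (4 * HLM2 g x) := by
          gcongr
          exact convP_ax_le_HLM2 _ _ _ _
      _ = ENNReal.ofReal (2 ^ N * 4 * 4) * HLM2 g x := by
          rw [ENNReal.ofReal_mul (by positivity), ENNReal.ofReal_mul (by positivity),
            ENNReal.ofReal_pow (by norm_num), ENNReal.ofReal_ofNat, ENNReal.ofReal_ofNat, mul_assoc]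
          ring
      _ ≤ _ := by
          gcongr
          have : 0 ≤ 8 * (2 * 2 ^ N / c1) := by positivity
          have : (0:ℝ) ≤ 8 * (2 ^ N * 4) := by positivity
          linarith
  · rw [convP_cm _ _ _ _ (m1 _ _ (m2 _ g hg))]
    calc _ ≤ ∫⁻ t in Icc (1:ℝ) 2, 8 * (2 ^ N * 4 * HLM2 g x) := by
          refine setLIntegral_mono' measurableSet_Icc fun t ht => (s1 _ (m2 _ g hg) t ht _).trans ?_
          gcongr
          rw [convP_ax1 _ (m2 _ g hg)]
          calc _ ≤ convP (bx (k + (1:ℕ) + 2)) (fun s => 2 ^ N * 4 *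
                convP (ax2 (bx (i + N + 2))) g (s, x.2)) x.1 :=
                convP_mono _ (fun s => s2 g hg t ht s) _
            _ = 2 ^ N * 4 * convP (ax1 (bx (k + (1:ℕ) + 2)))
                (convP (ax2 (bx (i + N + 2))) g) x := by
                rw [convP_ax1 _ (m2 _ g hg)]
                exact lintegral_const_mul' _ _ (ENNReal.mul_ne_top (by simp) (by simp))
            _ ≤ _ := by
                gcongr
                exact convP_ax_le_HLM2 _ _ _ _
      _ = ENNReal.ofReal (8 * (2 ^ N * 4)) * HLM2 g x := by
          rw [lintegral_const, Measure.restrict_apply_univ, Real.volume_Icc,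
            ENNReal.ofReal_mul (by positivity), ENNReal.ofReal_mul (by positivity),
            ENNReal.ofReal_pow (by norm_num), ENNReal.ofReal_ofNat, ENNReal.ofReal_ofNat,
            ENNReal.ofReal_ofNat]
          norm_num
          ring
      _ ≤ _ := by
          gcongr
          have : 0 ≤ 8 * (2 * 2 ^ N / c1) := by positivity
          have : (0:ℝ) ≤ 2 ^ N * 4 * 4 := by positivity
          linarith

/-! ### Basic properties of the `L^p` functional -/

theorem lpN_rpow (g : ℝ × ℝ → ℝ≥0∞) {p : ℝ} (hp : 0 < p) :
    lpN g p ^ p = ∫⁻ x, g x ^ p := by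
  rw [lpN, ← ENNReal.rpow_mul, one_div_mul_cancel hp.ne', ENNReal.rpow_one]

theorem lpN_mono_ae {g h : ℝ × ℝ → ℝ≥0∞} {p : ℝ} (hp : 0 < p) (hgh : ∀ᵐ x, g x ≤ h x) :
    lpN g p ≤ lpN h p := by
  unfold lpN
  refine ENNReal.rpow_le_rpow (lintegral_mono_ae ?_) (by positivity)
  filter_upwards [hgh] with x hx
  exact ENNReal.rpow_le_rpow hx hp.le

theorem lpN_mono {g h : ℝ × ℝ → ℝ≥0∞} {p : ℝ} (hp : 0 < p) (hgh : ∀ x, g x ≤ h x) :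
    lpN g p ≤ lpN h p := lpN_mono_ae hp (Eventually.of_forall hgh)

theorem lpN_const_mul {g : ℝ × ℝ → ℝ≥0∞} {p : ℝ} (hp : 0 < p) {c : ℝ≥0∞} (hc : c ≠ ∞) :
    lpN (fun x => c * g x) p = c * lpN g p := by
  unfold lpN
  have : ∀ x, (c * g x) ^ p = c ^ p * g x ^ p := fun x => ENNReal.mul_rpow_of_nonneg _ _ hp.le
  simp_rw [this]
  rw [lintegral_const_mul' _ _ (ENNReal.rpow_ne_top_of_nonneg hp.le hc),
    ENNReal.mul_rpow_of_nonneg _ _ (by positivity), ← ENNReal.rpow_mul, mul_one_div_cancel hp.ne',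
    ENNReal.rpow_one]

theorem lpN_le_of_lintegral {g h : ℝ × ℝ → ℝ≥0∞} {p : ℝ} (hp : 0 < p) {c : ℝ≥0∞}
    (H : ∫⁻ x, g x ^ p ≤ c ^ p * ∫⁻ x, h x ^ p) : lpN g p ≤ c * lpN h p := by
  rw [← ENNReal.rpow_le_rpow_iff hp, ENNReal.mul_rpow_of_nonneg _ _ hp.le, lpN_rpow g hp,
    lpN_rpow h hp]
  exact H

theorem lintegral_le_of_lpN {g h : ℝ × ℝ → ℝ≥0∞} {p : ℝ} (hp : 0 < p) {c : ℝ≥0∞}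
    (H : lpN g p ≤ c * lpN h p) : ∫⁻ x, g x ^ p ≤ c ^ p * ∫⁻ x, h x ^ p := by
  rw [← ENNReal.rpow_le_rpow_iff hp, ENNReal.mul_rpow_of_nonneg _ _ hp.le, lpN_rpow g hp,
    lpN_rpow h hp] at H
  exact H

theorem lpN_add_le {g h : ℝ × ℝ → ℝ≥0∞} {p : ℝ} (hp : 1 ≤ p) (hg : Measurable g)
    (hh : Measurable h) : lpN (fun x => g x + h x) p ≤ lpN g p + lpN h p :=
  ENNReal.lintegral_Lp_add_le hg.aemeasurable hh.aemeasurable hp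

theorem lpN_iSup {g : ℕ → ℝ × ℝ → ℝ≥0∞} {p : ℝ} (hp : 0 < p) (hg : ∀ n, Measurable (g n))
    (hm : ∀ x, Monotone fun n => g n x) : lpN (fun x => ⨆ n, g n x) p = ⨆ n, lpN (g n) p := by
  have hsup : ∀ {s : ℝ} (hs : 0 < s) (u : ℕ → ℝ≥0∞), (⨆ n, u n) ^ s = ⨆ n, u n ^ s :=
    fun hs u => (ENNReal.orderIsoRpow _ hs).map_iSup u
  unfold lpN
  simp_rw [hsup hp]
  rw [lintegral_iSup (fun n => (hg n).pow_const p)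
    (fun i j hij x => ENNReal.rpow_le_rpow (hm x hij) hp.le), hsup (by positivity)]

theorem lpN_zero {p : ℝ} (hp : 0 < p) : lpN (fun _ => 0) p = 0 := by
  simp [lpN, hp]

theorem lpN_sum_le {ι : Type*} (s : Finset ι) {g : ι → ℝ × ℝ → ℝ≥0∞} {p : ℝ} (hp : 1 ≤ p)
    (hg : ∀ i, Measurable (g i)) : lpN (fun x => ∑ i ∈ s, g i x) p ≤ ∑ i ∈ s, lpN (g i) p := by
  induction s using Finset.induction_on with
  | empty => simp [lpN_zero (by linarith : 0 < p)]
  | insert a s ha ih =>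
    simp only [Finset.sum_insert ha]
    refine (lpN_add_le hp (hg a) (Finset.measurable_fun_sum _ fun i _ => hg i)).trans ?_
    gcongr

theorem lpN_tsum_le {g : ℕ → ℝ × ℝ → ℝ≥0∞} {p : ℝ} (hp : 1 ≤ p) (hg : ∀ n, Measurable (g n)) :
    lpN (fun x => ∑' n, g n x) p ≤ ∑' n, lpN (g n) p := by
  have : (fun x => ∑' n, g n x) = fun x => ⨆ N, ∑ n ∈ Finset.range N, g n x := by
    funext x; exact ENNReal.tsum_eq_iSup_nat
  rw [this, lpN_iSup (by linarith) (fun N => Finset.measurable_fun_sum _ fun i _ => hg i)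
    (fun x => fun a b hab => Finset.sum_le_sum_of_subset (Finset.range_mono hab))]
  refine iSup_le fun N => (lpN_sum_le _ hp hg).trans (ENNReal.sum_le_tsum _)

theorem lpN_sup_le_card {ι : Type*} (J : Finset ι) (μ : ι → Measure (ℝ × ℝ))
    [∀ j, IsProbabilityMeasure (μ j)] {p : ℝ} (hp : 1 ≤ p) {g : ℝ × ℝ → ℝ≥0∞}
    (hg : Measurable g) : lpN (fun x => ⨆ j ∈ J, convP (μ j) g x) p ≤ J.card * lpN g p := by
  have hp0 : 0 < p := by linarith
  have hsingle : ∀ (g : ℝ × ℝ → ℝ≥0∞) (x : ℝ × ℝ), ∀ j ∈ J,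
      convP (μ j) g x ≤ ∑ j ∈ J, convP (μ j) g x := by
    intro g x j hj
    exact Finset.single_le_sum (f := fun j => convP (μ j) g x) (fun _ _ => bot_le) hj
  calc _ ≤ lpN (fun x => ∑ j ∈ J, convP (μ j) g x) p := lpN_mono hp0 fun x =>
        iSup₂_le fun j hj => hsingle g x j hj
    _ ≤ ∑ j ∈ J, lpN (convP (μ j) g) p := lpN_sum_le _ hp fun j => measurable_convP _ hg
    _ ≤ ∑ j ∈ J, lpN g p := Finset.sum_le_sum fun j _ => by
        rw [← one_mul (lpN g p)]
        refine lpN_le_of_lintegral hp0 ?_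
        rw [ENNReal.one_rpow, one_mul]
        exact lintegral_convP_rpow_le _ _ hp hg
    _ = _ := by simp

/-- It suffices to bound a finite supremum of averages on compactly supported continuous
functions. -/
theorem lpN_sup_of_compact_support {ι : Type*} [Countable ι] (J : Finset ι)
    (μ : ι → Measure (ℝ × ℝ)) [∀ j, IsProbabilityMeasure (μ j)] {p : ℝ} (hp : 1 ≤ p) {B : ℝ≥0∞}
    (hB : ∀ φ : ℝ × ℝ → ℝ, Continuous φ → HasCompactSupport φ → (∀ x, 0 ≤ φ x) →
      lpN (fun x => ⨆ j ∈ J, convP (μ j) (fun y => ‖φ y‖ₑ) x) p ≤ B * lpN (fun y => ‖φ y‖ₑ) p)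
    (hB0 : B ≠ 0) {g : ℝ × ℝ → ℝ≥0∞} (hg : Measurable g) :
    lpN (fun x => ⨆ j ∈ J, convP (μ j) g x) p ≤ B * lpN g p := by
  have hp0 : 0 < p := by linarith
  have hmeas : ∀ g : ℝ × ℝ → ℝ≥0∞, Measurable g →
      Measurable (fun x => ⨆ j ∈ J, convP (μ j) g x) := fun g hg =>
    Measurable.iSup fun j => Measurable.iSup fun _ => measurable_convP _ hg
  have htriv := fun g hg => lpN_sup_le_card J μ hp (g := g) hg
  by_cases hfin : lpN g p = ∞
  · rw [hfin, ENNReal.mul_top hB0]; exact le_top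
  by_cases hBtop : B = ∞
  · by_cases h0 : lpN g p = 0
    · refine (htriv g hg).trans ?_
      simp [h0]
    · rw [hBtop, ENNReal.top_mul h0]; exact le_top
  have hgp : ∫⁻ x, g x ^ p ≠ ∞ := by
    rw [← lpN_rpow g hp0]; exact ENNReal.rpow_ne_top_of_nonneg hp0.le hfin
  have hgfin : ∀ᵐ x, g x < ∞ := by
    filter_upwards [ae_lt_top (hg.pow_const p) hgp] with x hx
    exact (ENNReal.rpow_lt_top_iff_of_pos hp0).mp hx
  set G : ℝ × ℝ → ℝ := fun x => (g x).toReal with hG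
  have hGm : Measurable G := hg.ennreal_toReal
  have hGe : ∀ᵐ x, ‖G x‖ₑ = g x := by
    filter_upwards [hgfin] with x hx
    rw [hG, Real.enorm_of_nonneg ENNReal.toReal_nonneg, ENNReal.ofReal_toReal hx.ne]
  have hpe : (ENNReal.ofReal p).toReal = p := ENNReal.toReal_ofReal hp0.le
  have heL : ∀ f : ℝ × ℝ → ℝ, eLpNorm f (ENNReal.ofReal p) volume = lpN (fun x => ‖f x‖ₑ) p := by
    intro f
    rw [eLpNorm_eq_lintegral_rpow_enorm_toReal (by simpa using hp0) ENNReal.ofReal_ne_top, hpe, lpN]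
  have hGL : MemLp G (ENNReal.ofReal p) volume := by
    refine ⟨hGm.aestronglyMeasurable, ?_⟩
    rw [heL]
    exact (lpN_mono_ae hp0 (hGe.mono fun x hx => hx.le)).trans_lt (lt_top_iff_ne_top.mpr hfin)
  refine ENNReal.le_of_forall_pos_le_add fun ε hε _ => ?_
  set K : ℝ≥0∞ := J.card + B + 1 with hK
  have hKtop : K ≠ ∞ := by simp [hK, hBtop]
  have hK0 : K ≠ 0 := by simp [hK]
  obtain ⟨φ, hφs, hφ, hφc, -⟩ := hGL.exists_hasCompactSupport_eLpNorm_sub_le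
    ENNReal.ofReal_ne_top (ε := ε / K) (ENNReal.div_ne_zero.mpr ⟨by simpa using hε.ne', hKtop⟩)
  set ψ : ℝ × ℝ → ℝ := fun x => |φ x| with hψ
  have hψe : ∀ x, ‖ψ x‖ₑ = ‖φ x‖ₑ := fun x => by simp [hψ]
  set h : ℝ × ℝ → ℝ≥0∞ := fun x => g x - ‖ψ x‖ₑ with hh
  have hψm : Measurable fun x => ‖ψ x‖ₑ := (hφc.abs.measurable).enorm
  have hhm : Measurable h := hg.sub hψm
  have hhle : lpN h p ≤ ε / K := by
    refine le_trans (lpN_mono_ae hp0 ?_) ((heL _).symm.le.trans hφ)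
    filter_upwards [hGe] with x hx
    rw [hh]
    simp only [hψe]
    rw [← hx, tsub_le_iff_right]
    calc ‖G x‖ₑ = ‖(G x - φ x) + φ x‖ₑ := by rw [sub_add_cancel]
      _ ≤ _ := enorm_add_le _ _
  have hψle : lpN (fun x => ‖ψ x‖ₑ) p ≤ lpN g p + ε / K := by
    calc _ ≤ lpN (fun x => g x + ‖(G - φ) x‖ₑ) p := by
          refine lpN_mono_ae hp0 ?_
          filter_upwards [hGe] with x hx
          rw [hψe, ← hx]
          calc ‖φ x‖ₑ = ‖G x - (G x - φ x)‖ₑ := by rw [sub_sub_cancel]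
            _ ≤ _ := enorm_sub_le
      _ ≤ _ := by
          refine (lpN_add_le hp hg (hGm.sub hφc.measurable).enorm).trans ?_
          gcongr
          exact (heL _).symm.le.trans hφ
  calc _ ≤ lpN (fun x => (⨆ j ∈ J, convP (μ j) (fun y => ‖ψ y‖ₑ) x) +
        ⨆ j ∈ J, convP (μ j) h x) p := by
        refine lpN_mono hp0 fun x => iSup₂_le fun j hj => ?_
        calc convP (μ j) g x ≤ convP (μ j) (fun y => ‖ψ y‖ₑ + h y) x :=
              convP_mono _ (fun y => le_add_tsub) _
          _ = convP (μ j) (fun y => ‖ψ y‖ₑ) x + convP (μ j) h x := by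
              rw [convP, lintegral_add_left (by fun_prop)]; rfl
          _ ≤ _ := add_le_add (le_iSup₂ (f := fun j _ => convP (μ j) (fun y => ‖ψ y‖ₑ) x) j hj)
              (le_iSup₂ (f := fun j _ => convP (μ j) h x) j hj)
    _ ≤ B * (lpN g p + ε / K) + J.card * (ε / K) := by
        refine (lpN_add_le hp (hmeas _ hψm) (hmeas _ hhm)).trans ?_
        gcongr
        · refine (hB ψ hφc.abs (hφs.norm) fun x => abs_nonneg _).trans ?_
          gcongr
        · exact (htriv h hhm).trans (by gcongr)
    _ = B * lpN g p + (J.card + B) * (ε / K) := by ring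
    _ ≤ B * lpN g p + K * (ε / K) := by gcongr; exact le_self_add
    _ = _ := by rw [ENNReal.mul_div_cancel hK0 hKtop]

/-! ### Bounds for the frequency blocks -/

theorem BM.indicator {α : Type*} [MeasurableSpace α] {f : α → ℝ} (hf : BM f) {s : Set α}
    (hs : MeasurableSet s) : BM (s.indicator f) := by
  refine ⟨hf.1.indicator hs, ?_⟩
  obtain ⟨M, hM⟩ := hf.2
  exact ⟨M, fun x => (norm_indicator_le_norm_self f x).trans (hM x)⟩

theorem df1_add (L : ℕ) (k : ℤ) {f g : ℝ × ℝ → ℝ} (hf : BM f) (hg : BM g) :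
    df1 L k (fun x => f x + g x) = fun x => df1 L k f x + df1 L k g x := by
  funext x
  simp only [df1, conv_add _ hf hg]
  ring

theorem df2_add (L : ℕ) (k : ℤ) {f g : ℝ × ℝ → ℝ} (hf : BM f) (hg : BM g) :
    df2 L k (fun x => f x + g x) = fun x => df2 L k f x + df2 L k g x := by
  funext x
  simp only [df2, conv_add _ hf hg]
  ring

theorem sum_shift_le (J : Finset (ℤ × ℤ)) (s1 s2 : ℤ) (F : ℤ → ℤ → ℝ≥0∞) :
    ∑ j ∈ J, F (j.1 - s1) (j.2 - s2) ≤
      ∑ k ∈ J.image (fun j => j.1 - s1), ∑ i ∈ J.image (fun j => j.2 - s2), F k i := by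
  rw [← Finset.sum_product']
  have hinj : InjOn (fun j : ℤ × ℤ => (j.1 - s1, j.2 - s2)) J := by
    rintro ⟨a, b⟩ _ ⟨c, d⟩ _ h
    simpa using h
  rw [← Finset.sum_image (f := fun j : ℤ × ℤ => F j.1 j.2) hinj]
  refine Finset.sum_le_sum_of_subset ?_
  intro z hz
  obtain ⟨j, hj, rfl⟩ := Finset.mem_image.mp hz
  exact Finset.mem_product.mpr ⟨Finset.mem_image_of_mem _ hj, Finset.mem_image_of_mem _ hj⟩

theorem iSup_rpow_le_sum {ι : Type*} (J : Finset ι) (a : ι → ℝ≥0∞) {q : ℝ} (hq : 0 < q) :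
    (⨆ j ∈ J, a j) ^ q ≤ (∑ j ∈ J, a j ^ 2) ^ (q / 2) := by
  have h : (⨆ j ∈ J, a j) ^ (2:ℝ) ≤ ∑ j ∈ J, a j ^ 2 := by
    rw [← ENNReal.rpow_le_rpow_iff (z := 1 / 2) (by norm_num), ← ENNReal.rpow_mul]
    norm_num
    intro j hj
    rw [one_div, ENNReal.le_rpow_inv_iff two_pos, ENNReal.rpow_two]
    exact Finset.single_le_sum (f := fun j => a j ^ 2) (fun _ _ => bot_le) hj
  calc _ = ((⨆ j ∈ J, a j) ^ (2:ℝ)) ^ (q / 2) := by rw [← ENNReal.rpow_mul]; congr 1; ring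
    _ ≤ _ := ENNReal.rpow_le_rpow h (by positivity)

/-- The maximal function over one frequency block. -/
def blk (b : ℝ) (ρ : ℤ × ℤ → ℝ) (J : Finset (ℤ × ℤ)) (L : ℕ) (s1 s2 : ℤ) (f : ℝ × ℝ → ℝ)
    (x : ℝ × ℝ) : ℝ≥0∞ :=
  ⨆ j ∈ J, ‖conv (cm b j.1 j.2 (ρ j)) (df1 L (j.1 - s1) (df2 L (j.2 - s2) f)) x‖ₑ

theorem measurable_blk (b : ℝ) (ρ : ℤ × ℤ → ℝ) (J : Finset (ℤ × ℤ)) (L : ℕ) (s1 s2 : ℤ)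
    {f : ℝ × ℝ → ℝ} (hf : BM f) : Measurable (blk b ρ J L s1 s2 f) :=
  Measurable.iSup fun j => Measurable.iSup fun _ =>
    (((hf.df2 L _).df1 L _).conv (cm b j.1 j.2 (ρ j))).1.measurable.enorm

theorem blk_add_le (b : ℝ) (ρ : ℤ × ℤ → ℝ) (J : Finset (ℤ × ℤ)) (L : ℕ) (s1 s2 : ℤ)
    {f g : ℝ × ℝ → ℝ} (hf : BM f) (hg : BM g) (x : ℝ × ℝ) :
    blk b ρ J L s1 s2 (fun x => f x + g x) x ≤
      blk b ρ J L s1 s2 f x + blk b ρ J L s1 s2 g x := by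
  refine iSup₂_le fun j hj => ?_
  rw [df2_add L _ hf hg, df1_add L _ (hf.df2 L _) (hg.df2 L _),
    conv_add _ ((hf.df2 L _).df1 L _) ((hg.df2 L _).df1 L _)]
  refine (enorm_add_le _ _).trans (add_le_add ?_ ?_)
  · exact le_iSup₂ (f := fun (j : ℤ × ℤ) _ => ‖conv (cm b j.1 j.2 (ρ j))
      (df1 L (j.1 - s1) (df2 L (j.2 - s2) f)) x‖ₑ) j hj
  · exact le_iSup₂ (f := fun (j : ℤ × ℤ) _ => ‖conv (cm b j.1 j.2 (ρ j))
      (df1 L (j.1 - s1) (df2 L (j.2 - s2) g)) x‖ₑ) j hj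

theorem blk_lq {b : ℝ} {p q : ℝ} (hp : 1 < p) (hq : q = 2 * p / (p + 1))
    (ρ : ℤ × ℤ → ℝ) (J : Finset (ℤ × ℤ)) {B : ℝ} (hB1 : 1 ≤ B)
    (hB : ∀ g : ℝ × ℝ → ℝ≥0∞, Measurable g →
      lpN (fun x => ⨆ j ∈ J, convP (cm b j.1 j.2 (ρ j)) g x) p ≤ ENNReal.ofReal B * lpN g p)
    {L : ℕ} (hL : 1 ≤ L) (s1 s2 : ℤ) {f : ℝ × ℝ → ℝ} (hf : BM f) :
    ∫⁻ x, blk b ρ J L s1 s2 f x ^ q ≤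
      ENNReal.ofReal (√B ^ q) * (ENNReal.ofReal (640 / (q - 1)) * (L : ℝ≥0∞) ^ (q / 2)) ^ 2 *
        ∫⁻ x, ‖f x‖ₑ ^ q := by
  have hq1 : 1 < q := by rw [hq, lt_div_iff₀ (by linarith)]; linarith
  have hq2 : q ≤ 2 := by rw [hq, div_le_iff₀ (by linarith)]; linarith
  calc _ ≤ ∫⁻ x, (∑ j ∈ J, convP (cm b j.1 j.2 (ρ j))
        (fun y => ‖df1 L (j.1 - s1) (df2 L (j.2 - s2) f) y‖ₑ) x ^ 2) ^ (q / 2) := by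
        refine lintegral_mono fun x => (iSup_rpow_le_sum J _ (by linarith)).trans ?_
        refine ENNReal.rpow_le_rpow (Finset.sum_le_sum fun j _ => ?_) (by linarith)
        gcongr
        exact enorm_conv_le _ _ _
    _ ≤ (ENNReal.ofReal B ^ p) ^ (q / (2 * p)) *
        ∫⁻ x, (∑ j ∈ J, ‖df1 L (j.1 - s1) (df2 L (j.2 - s2) f) x‖ₑ ^ 2) ^ (q / 2) :=
        vec_conv volume hp hq J (fun j => cm b j.1 j.2 (ρ j))
          (fun g hg => lintegral_le_of_lpN (by linarith) (hB g hg))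
          (fun j y => ‖df1 L (j.1 - s1) (df2 L (j.2 - s2) f) y‖ₑ)
          (fun j => ((hf.df2 L _).df1 L _).1.measurable.enorm) (fun j x => enorm_ne_top)
    _ ≤ ENNReal.ofReal (√B ^ q) * ((ENNReal.ofReal (640 / (q - 1)) *
          (L : ℝ≥0∞) ^ (q / 2)) ^ 2 * ∫⁻ x, ‖f x‖ₑ ^ q) := by
        refine mul_le_mul' (le_of_eq ?_) ?_
        · rw [← ENNReal.rpow_mul, Real.sqrt_eq_rpow, ← Real.rpow_mul (by linarith),
            ENNReal.ofReal_rpow_of_pos (by linarith)]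
          congr 2
          field_simp
        · refine le_trans (lintegral_mono fun x => ENNReal.rpow_le_rpow
            (sum_shift_le J s1 s2 fun k i => ‖df1 L k (df2 L i f) x‖ₑ ^ 2) (by linarith)) ?_
          exact square_function2 hq1 hq2 hL hf _ _
    _ = _ := by rw [mul_assoc]

theorem blk_lp {b c1 : ℝ} (hb : 1 < b) (hc1 : 0 < c1) : ∃ C : ℝ, 0 < C ∧ ∀ p : ℝ, 1 < p → p ≤ 2 →
    ∀ ρ : ℤ × ℤ → ℝ, (∀ j, c1 ≤ |ρ j|) → ∀ (J : Finset (ℤ × ℤ)) (B : ℝ), 1 ≤ B →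
    (∀ g : ℝ × ℝ → ℝ≥0∞, Measurable g →
      lpN (fun x => ⨆ j ∈ J, convP (cm b j.1 j.2 (ρ j)) g x) p ≤ ENNReal.ofReal B * lpN g p) →
    ∀ (n1 n2 : ℕ) (f : ℝ × ℝ → ℝ), BM f → Integrable f →
    lpN (blk b ρ J ⌈(p - 1)⁻¹⌉₊ (n1 * ⌈(p - 1)⁻¹⌉₊ : ℕ) (n2 * ⌈(p - 1)⁻¹⌉₊ : ℕ) f) p ≤
      ENNReal.ofReal (C * ((p - 1)⁻¹) ^ 3 * √B * (2 ^ (-(1/4) : ℝ)) ^ n1 * (2 ^ (-(1/4) : ℝ)) ^ n2) *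
        lpN (fun x => ‖f x‖ₑ) p := by
  obtain ⟨C0, hC0, hL2⟩ := l2_block hb hc1
  set C1 := max 1 C0 with hC1
  have hC11 : 1 ≤ C1 := le_max_left _ _
  refine ⟨4 * C1 * (1920 ^ 2 * 2), by positivity, ?_⟩
  intro p hp hp2 ρ hρ J B hB1 hB n1 n2 f hf hi
  set e := (p - 1)⁻¹ with he
  have hp1 : 0 < p - 1 := by linarith
  have he1 : 1 ≤ e := by rw [he]; exact (one_le_inv₀ hp1).mpr (by linarith)
  set L := ⌈e⌉₊ with hLdef
  have hLe : e ≤ L := Nat.le_ceil e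
  have hLe2 : (L:ℝ) ≤ 2 * e := by
    have := Nat.ceil_lt_add_one (by linarith : 0 ≤ e)
    linarith
  have hL1 : 1 ≤ L := by exact_mod_cast he1.trans hLe
  set q := 2 * p / (p + 1) with hq
  have hq1 : 1 < q := by rw [hq, lt_div_iff₀ (by linarith)]; linarith
  have hqq : q - 1 = (p - 1) / (p + 1) := by rw [hq]; field_simp; ring
  set η := p * (p - 1) / 2 with hη
  have hη0 : 0 < η := by positivity
  have hη1 : η ≤ 1 := by rw [hη]; nlinarith
  have hpη : p = (1 - η) * q + 2 * η := by rw [hη, hq]; field_simp; ring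
  set X := √B * (1920 ^ 2 * 2 * e ^ 3) with hX
  have hsB : 1 ≤ √B := Real.one_le_sqrt.mpr hB1
  have he3 : 1 ≤ e ^ 3 := one_le_pow₀ he1
  have hX1 : 1 ≤ X := by rw [hX]; nlinarith
  have hX0 : 0 < X := by linarith
  set w := √((2:ℝ) ^ (-((n1 * L : ℕ) : ℤ))) * √((2:ℝ) ^ (-((n2 * L : ℕ) : ℤ))) with hw
  have hw0 : 0 < w := by
    have h1 : (0:ℝ) < 2 ^ (-((n1 * L : ℕ) : ℤ)) := by positivity
    have h2 : (0:ℝ) < 2 ^ (-((n2 * L : ℕ) : ℤ)) := by positivity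
    exact mul_pos (Real.sqrt_pos.mpr h1) (Real.sqrt_pos.mpr h2)
  have hTq : ∀ f : ℝ × ℝ → ℝ, BM f → ∫⁻ x, blk b ρ J L (n1 * L : ℕ) (n2 * L : ℕ) f x ^ q ≤
      ENNReal.ofReal (X ^ q) * ∫⁻ x, ‖f x‖ₑ ^ q := by
    intro f hf
    refine (blk_lq hp hq ρ J hB1 hB hL1 _ _ hf).trans ?_
    refine mul_le_mul_left ?_ _
    rw [mul_pow, ← ENNReal.ofReal_natCast, ENNReal.ofReal_rpow_of_pos (by positivity),
      ← ENNReal.ofReal_pow (div_nonneg (by norm_num) (by linarith)),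
      ← ENNReal.ofReal_pow (by positivity), ← ENNReal.ofReal_mul (by positivity),
      ← ENNReal.ofReal_mul (by positivity)]
    apply ENNReal.ofReal_le_ofReal
    rw [hX, Real.mul_rpow (by positivity) (by positivity)]
    refine mul_le_mul_of_nonneg_left ?_ (by positivity)
    have h1 : (640 / (q - 1)) ^ 2 ≤ ((1920 * e) ^ 2) ^ q := by
      have h2 : 640 / (q - 1) ≤ 1920 * e := by
        rw [hqq, he]
        rw [div_div_eq_mul_div, div_le_iff₀ hp1, mul_assoc, inv_mul_cancel₀ hp1.ne']
        linarith
      have h3 : 0 ≤ 640 / (q - 1) := div_nonneg (by norm_num) (by linarith)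
      calc (640 / (q - 1)) ^ 2 ≤ (1920 * e) ^ 2 := by gcongr
        _ ≤ _ := Real.self_le_rpow_of_one_le (one_le_pow₀ (by linarith)) hq1.le
    have h2 : ((L:ℝ) ^ (q / 2)) ^ 2 ≤ (2 * e) ^ q := by
      rw [← Real.rpow_natCast, ← Real.rpow_mul (by positivity)]
      have : q / 2 * ((2:ℕ):ℝ) = q := by push_cast; ring
      rw [this]
      exact Real.rpow_le_rpow (by positivity) hLe2 (by linarith)
    calc _ ≤ ((1920 * e) ^ 2) ^ q * (2 * e) ^ q := by gcongr
      _ = (1920 ^ 2 * 2 * e ^ 3) ^ q := by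
          rw [← Real.mul_rpow (by positivity) (by positivity)]; congr 1; ring
  have hT2 : ∀ f : ℝ × ℝ → ℝ, BM f → Integrable f →
      ∫⁻ x, blk b ρ J L (n1 * L : ℕ) (n2 * L : ℕ) f x ^ 2 ≤
      ENNReal.ofReal (C1 * w) * ∫⁻ x, ‖f x‖ₑ ^ 2 := by
    intro f hf hi
    calc _ ≤ ∫⁻ x, ∑ j ∈ J, ‖conv (cm b j.1 j.2 (ρ j)) (df1 L (j.1 - (n1 * L : ℕ))
          (df2 L (j.2 - (n2 * L : ℕ)) f)) x‖ₑ ^ 2 := by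
          refine lintegral_mono fun x => ?_
          have := iSup_rpow_le_sum J (fun j => ‖conv (cm b j.1 j.2 (ρ j)) (df1 L (j.1 - (n1 * L : ℕ))
            (df2 L (j.2 - (n2 * L : ℕ)) f)) x‖ₑ) (q := 2) two_pos
          rwa [div_self two_ne_zero, ENNReal.rpow_one, ENNReal.rpow_two] at this
      _ ≤ _ := hL2 ρ hρ L _ _ J f hf hi
      _ ≤ _ := by
          gcongr
          exact le_max_right _ _
  have hmain : ∫⁻ x, blk b ρ J L (n1 * L : ℕ) (n2 * L : ℕ) f x ^ p ≤
      4 * ENNReal.ofReal ((X ^ q) ^ (1 - η) * (C1 * w) ^ η) * ∫⁻ x, ‖f x‖ₑ ^ p := by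
    rcases hp2.lt_or_eq with h2 | h2
    · refine interpolation volume (q := q) (P := fun f => BM f ∧ Integrable f)
        (by linarith) ?_ hη0 ?_ hpη (by positivity) (by positivity) _
        ?_ ?_ ?_ ?_ ?_ ?_ f ⟨hf, hi⟩
      · rw [hq, div_lt_iff₀ (by linarith)]; linarith
      · rw [hη]; nlinarith
      · exact fun f hf => hf.1.1.measurable
      · exact fun f s hf hs => ⟨hf.1.indicator hs, hf.2.indicator hs⟩
      · exact fun f hf => measurable_blk _ _ _ _ _ _ hf.1
      · intro f s x hf hs
        refine le_trans (le_of_eq ?_) (blk_add_le _ _ _ _ _ _ (hf.1.indicator hs)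
          (hf.1.indicator hs.compl) x)
        congr 1
        funext y
        exact (congrFun (indicator_self_add_compl s f) y).symm
      · exact fun f hf => hTq f hf.1
      · exact fun f hf => hT2 f hf.1 hf.2
    · have hη' : η = 1 := by rw [hη, h2]; norm_num
      have := hT2 f hf hi
      simp only [hη', h2, sub_self, Real.rpow_zero, one_mul, Real.rpow_one, ENNReal.rpow_two]
      refine this.trans ?_
      gcongr
      exact le_mul_of_one_le_left bot_le (by norm_num)
  refine lpN_le_of_lintegral (by linarith) (hmain.trans ?_)
  refine mul_le_mul_left ?_ _
  set r : ℝ := 2 ^ (-(1/4) : ℝ) with hr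
  have hr0 : 0 < r := by positivity
  rw [ENNReal.ofReal_rpow_of_pos (by positivity), ← ENNReal.ofReal_ofNat,
    ← ENNReal.ofReal_mul (by norm_num)]
  apply ENNReal.ofReal_le_ofReal
  have e1 : (X ^ q) ^ (1 - η) ≤ X ^ p := by
    rw [← Real.rpow_mul hX0.le]
    exact Real.rpow_le_rpow_of_exponent_le hX1 (by nlinarith)
  have e2 : w ^ η ≤ (r ^ n1 * r ^ n2) ^ p := by
    have a1 : w = 2 ^ (-(((n1:ℝ) + n2) * L / 2)) := by
      rw [hw, Real.sqrt_eq_rpow, Real.sqrt_eq_rpow, ← Real.rpow_intCast, ← Real.rpow_intCast,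
        ← Real.rpow_mul two_pos.le, ← Real.rpow_mul two_pos.le, ← Real.rpow_add two_pos]
      congr 1
      push_cast
      ring
    have a2 : r ^ n1 * r ^ n2 = 2 ^ (-(((n1:ℝ) + n2) / 4)) := by
      rw [hr, ← pow_add, ← Real.rpow_natCast, ← Real.rpow_mul two_pos.le]
      congr 1
      push_cast
      ring
    rw [a1, a2, ← Real.rpow_mul two_pos.le, ← Real.rpow_mul two_pos.le]
    refine Real.rpow_le_rpow_of_exponent_le one_le_two ?_
    have h1 : 1 ≤ L * (p - 1) := by
      calc 1 = e * (p - 1) := by rw [he, inv_mul_cancel₀ hp1.ne']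
        _ ≤ _ := by gcongr
    have h2 : 0 ≤ ((n1:ℝ) + n2) * p / 4 := by positivity
    have : -(((n1:ℝ) + n2) * L / 2) * η = -(((n1:ℝ) + n2) * p / 4 * (L * (p - 1))) := by
      rw [hη]; ring
    rw [this]
    nlinarith
  have e3 : C1 ^ η ≤ C1 := by
    simpa using Real.rpow_le_rpow_of_exponent_le hC11 hη1
  calc 4 * ((X ^ q) ^ (1 - η) * (C1 * w) ^ η)
      = 4 * ((X ^ q) ^ (1 - η) * (C1 ^ η * w ^ η)) := by
        rw [Real.mul_rpow (by positivity) hw0.le]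
    _ ≤ 4 * (X ^ p * (C1 * (r ^ n1 * r ^ n2) ^ p)) := by gcongr
    _ = (4 * C1) * (X ^ p * (r ^ n1 * r ^ n2) ^ p) := by ring
    _ ≤ (4 * C1) ^ p * (X ^ p * (r ^ n1 * r ^ n2) ^ p) := by
        gcongr
        exact Real.self_le_rpow_of_one_le (by linarith) hp.le
    _ = (4 * C1 * (1920 ^ 2 * 2) * e ^ 3 * √B * r ^ n1 * r ^ n2) ^ p := by
        rw [← Real.mul_rpow (by positivity) (by positivity),
          ← Real.mul_rpow (by positivity) (by positivity)]
        congr 1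
        rw [hX]; ring

/-! ### Frequency decomposition and the bound for lacunary families of curves -/

theorem abs_conv_sub_le {G : Type*} [AddCommGroup G] [MeasurableSpace G] [MeasurableAdd₂ G]
    [MeasurableNeg G] (μ : Measure G)
    [IsProbabilityMeasure μ] {f g : G → ℝ} (hf : BM f) (hg : BM g) {d : ℝ}
    (h : ∀ y, |f y - g y| ≤ d) (x : G) : |conv μ f x - conv μ g x| ≤ d := by
  rw [← conv_sub μ hf hg, conv, ← Real.norm_eq_abs]
  refine (norm_integral_le_of_norm_le_const (C := d) (Eventually.of_forall fun y => ?_)).trans ?_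
  · exact h _
  · simp

theorem conv_tr_approx {f : ℝ → ℝ} (hf : BM f) {d : ℝ} {e : ℝ}
    (he : ∀ x y, |x - y| < e → |f x - f y| ≤ d) {m : ℤ} (hm : 2 * 2 ^ m < e) (x : ℝ) :
    |conv (tr m) f x - f x| ≤ d := by
  have h1 : conv (tr m) f x - f x = ∫ y, (f (x - y) - f x) ∂(tr m) := by
    rw [integral_sub ((hf.sub_left x).integrable _) (integrable_const _)]
    simp [conv]
  rw [h1, ← Real.norm_eq_abs]
  refine (norm_integral_le_of_norm_le_const (C := d) ?_).trans ?_
  · filter_upwards [ae_tr_mem m] with t ht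
    refine he _ _ ?_
    rw [sub_sub_cancel_left, abs_neg]
    linarith
  · simp

theorem exists_zpow_lt {e : ℝ} (he : 0 < e) : ∃ m0 : ℤ, ∀ m ≤ m0, 2 * (2:ℝ) ^ m < e := by
  obtain ⟨n, hn⟩ := exists_pow_lt_of_lt_one (half_pos he) (show (1/2 : ℝ) < 1 by norm_num)
  refine ⟨-n, fun m hm => ?_⟩
  have h1 : (2:ℝ) ^ m ≤ 2 ^ (-(n:ℤ)) := zpow_le_zpow_right₀ one_le_two hm
  have h2 : (2:ℝ) ^ (-(n:ℤ)) = (1/2) ^ n := by simp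
  linarith

theorem ax_approx {φ : ℝ × ℝ → ℝ} (hφ : BM φ) (hu : UniformContinuous φ) {d : ℝ} (hd : 0 < d) :
    ∃ m0 : ℤ, ∀ m ≤ m0, (∀ y, |conv (ax1 (tr m)) φ y - φ y| ≤ d) ∧
      ∀ y, |conv (ax2 (tr m)) φ y - φ y| ≤ d := by
  obtain ⟨e, he, h⟩ := Metric.uniformContinuous_iff.mp hu d hd
  obtain ⟨m0, hm0⟩ := exists_zpow_lt he
  refine ⟨m0, fun m hm => ⟨fun y => ?_, fun y => ?_⟩⟩
  · rw [conv_ax1 _ hφ]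
    refine conv_tr_approx (f := fun s => φ (s, y.2)) (hφ.comp (by fun_prop))
      (fun a b hab => ?_) (hm0 m hm) y.1
    have := h (a := (a, y.2)) (b := (b, y.2)) (by simpa [Prod.dist_eq, Real.dist_eq, he] using hab)
    exact this.le
  · rw [conv_ax2 _ hφ]
    refine conv_tr_approx (f := fun s => φ (y.1, s)) (hφ.comp (by fun_prop))
      (fun a b hab => ?_) (hm0 m hm) y.2
    have := h (a := (y.1, a)) (b := (y.1, b)) (by simpa [Prod.dist_eq, Real.dist_eq, he] using hab)
    exact this.le

theorem sum_range_block (F : ℕ → ℕ → ℝ) (N : ℕ) :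
    ∑ n1 ∈ Finset.range N, ∑ n2 ∈ Finset.range N,
      (F (n1 + 1) (n2 + 1) - F n1 (n2 + 1) - F (n1 + 1) n2 + F n1 n2) =
      F N N - F 0 N - F N 0 + F 0 0 := by
  have h : ∀ n1, ∑ n2 ∈ Finset.range N,
      (F (n1 + 1) (n2 + 1) - F n1 (n2 + 1) - F (n1 + 1) n2 + F n1 n2) =
      (F (n1 + 1) N - F (n1 + 1) 0) - (F n1 N - F n1 0) := by
    intro n1
    have := Finset.sum_range_sub (fun n => F (n1 + 1) n - F n1 n) N
    rw [show (F (n1 + 1) N - F (n1 + 1) 0) - (F n1 N - F n1 0) =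
      F (n1 + 1) N - F n1 N - (F (n1 + 1) 0 - F n1 0) by ring, ← this]
    exact Finset.sum_congr rfl fun _ _ => by ring
  simp only [h]
  rw [Finset.sum_range_sub (fun n => F n N - F n 0)]
  ring

theorem conv_block (μ : Measure (ℝ × ℝ)) [IsProbabilityMeasure μ] {f : ℝ × ℝ → ℝ} (hf : BM f)
    (L : ℕ) (k i : ℤ) (x : ℝ × ℝ) :
    conv μ (df1 L k (df2 L i f)) x =
      conv μ (conv (ax1 (tr (k - L))) (conv (ax2 (tr (i - L))) f)) x -
      conv μ (conv (ax1 (tr k)) (conv (ax2 (tr (i - L))) f)) x -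
      conv μ (conv (ax1 (tr (k - L))) (conv (ax2 (tr i)) f)) x +
      conv μ (conv (ax1 (tr k)) (conv (ax2 (tr i)) f)) x := by
  have h2 : ∀ i, BM (conv (ax2 (tr i)) f) := fun i => hf.conv _
  have h12 : ∀ k i, BM (conv (ax1 (tr k)) (conv (ax2 (tr i)) f)) := fun k i => (h2 i).conv _
  have e1 : ∀ k y, conv (ax1 (tr k)) (df2 L i f) y =
      conv (ax1 (tr k)) (conv (ax2 (tr (i - L))) f) y - conv (ax1 (tr k)) (conv (ax2 (tr i)) f) y :=
    fun k y => conv_sub _ (h2 _) (h2 _) y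
  have e2 : df1 L k (df2 L i f) = fun y =>
      (conv (ax1 (tr (k - L))) (conv (ax2 (tr (i - L))) f) y -
        conv (ax1 (tr (k - L))) (conv (ax2 (tr i)) f) y) -
      (conv (ax1 (tr k)) (conv (ax2 (tr (i - L))) f) y - conv (ax1 (tr k)) (conv (ax2 (tr i)) f) y) := by
    funext y
    rw [df1, e1, e1]
  rw [e2, conv_sub _ ((h12 _ _).sub (h12 _ _)) ((h12 _ _).sub (h12 _ _)),
    conv_sub _ (h12 _ _) (h12 _ _), conv_sub _ (h12 _ _) (h12 _ _)]
  ring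

theorem conv_hi (μ : Measure (ℝ × ℝ)) [IsProbabilityMeasure μ] {f : ℝ × ℝ → ℝ} (hf : BM f)
    (k i : ℤ) (x : ℝ × ℝ) :
    conv μ (hi1 k (hi2 i f)) x = conv μ f x - conv μ (conv (ax2 (tr i)) f) x -
      conv μ (conv (ax1 (tr k)) f) x + conv μ (conv (ax1 (tr k)) (conv (ax2 (tr i)) f)) x := by
  have h1 : BM (conv (ax1 (tr k)) f) := hf.conv _
  have h2 : BM (conv (ax2 (tr i)) f) := hf.conv _
  have h12 : BM (conv (ax1 (tr k)) (conv (ax2 (tr i)) f)) := h2.conv _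
  have e2 : hi1 k (hi2 i f) = fun y => (f y - conv (ax2 (tr i)) f y) -
      (conv (ax1 (tr k)) f y - conv (ax1 (tr k)) (conv (ax2 (tr i)) f) y) := by
    funext y
    rw [hi1, ← conv_sub _ hf h2]
    rfl
  rw [e2, conv_sub _ (hf.sub h2) (h1.sub h12), conv_sub _ hf h2, conv_sub _ h1 h12]
  ring

theorem enorm_conv_hi_le (μ : Measure (ℝ × ℝ)) [IsProbabilityMeasure μ] {φ : ℝ × ℝ → ℝ}
    (hφ : BM φ) (hu : UniformContinuous φ) {L : ℕ} (hL : 1 ≤ L) (k i : ℤ) (x : ℝ × ℝ) :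
    ‖conv μ (hi1 k (hi2 i φ)) x‖ₑ ≤ ∑' n1 : ℕ, ∑' n2 : ℕ,
      ‖conv μ (df1 L (k - (n1 * L : ℕ)) (df2 L (i - (n2 * L : ℕ)) φ)) x‖ₑ := by
  refine ENNReal.le_of_forall_pos_le_add fun δ hδ _ => ?_
  obtain ⟨m0, hm0⟩ := ax_approx hφ hu (show (0:ℝ) < δ / 4 by positivity)
  obtain ⟨N, hN⟩ : ∃ N : ℕ, k - (N * L : ℕ) ≤ m0 ∧ i - (N * L : ℕ) ≤ m0 := by
    refine ⟨(max (k - m0) (i - m0)).toNat, ?_⟩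
    have h1 : (max (k - m0) (i - m0)).toNat ≤ (max (k - m0) (i - m0)).toNat * L :=
      Nat.le_mul_of_pos_right _ hL
    omega
  set F : ℕ → ℕ → ℝ := fun n1 n2 =>
    conv μ (conv (ax1 (tr (k - (n1 * L : ℕ)))) (conv (ax2 (tr (i - (n2 * L : ℕ)))) φ)) x with hF
  have hblock : ∀ n1 n2 : ℕ,
      conv μ (df1 L (k - (n1 * L : ℕ)) (df2 L (i - (n2 * L : ℕ)) φ)) x =
        F (n1 + 1) (n2 + 1) - F n1 (n2 + 1) - F (n1 + 1) n2 + F n1 n2 := by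
    intro n1 n2
    have e : ∀ (k : ℤ) (n : ℕ), k - (n * L : ℕ) - L = k - ((n + 1) * L : ℕ) := by
      intro k n; push_cast; ring
    rw [conv_block μ hφ, e, e]
  have h2 : ∀ i, BM (conv (ax2 (tr i)) φ) := fun i => hφ.conv _
  have h1 : ∀ i, BM (conv (ax1 (tr i)) φ) := fun i => hφ.conv _
  have h12 : ∀ k i, BM (conv (ax1 (tr k)) (conv (ax2 (tr i)) φ)) := fun k i => (h2 i).conv _
  have a1 : |conv μ φ x - F N N| ≤ δ / 2 := by
    refine abs_conv_sub_le μ hφ (h12 _ _) (fun y => ?_) x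
    have b1 := (hm0 _ hN.1).1 y
    have b2 := abs_conv_sub_le (ax1 (tr (k - (N * L : ℕ)))) (h2 _) hφ (hm0 _ hN.2).2 y
    rw [abs_le] at b1 b2 ⊢
    constructor <;> linarith
  have a2 : |conv μ (conv (ax1 (tr k)) φ) x - F 0 N| ≤ δ / 4 := by
    simp only [hF, zero_mul, Nat.cast_zero, sub_zero]
    refine abs_conv_sub_le μ (h1 _) (h12 _ _) (fun y => ?_) x
    refine abs_conv_sub_le _ hφ (h2 _) (fun z => ?_) y
    rw [abs_sub_comm]
    exact (hm0 _ hN.2).2 z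
  have a3 : |conv μ (conv (ax2 (tr i)) φ) x - F N 0| ≤ δ / 4 := by
    simp only [hF, zero_mul, Nat.cast_zero, sub_zero]
    refine abs_conv_sub_le μ (h2 _) (h12 _ _) (fun y => ?_) x
    rw [conv_comm _ _ hφ]
    refine abs_conv_sub_le _ hφ (h1 _) (fun z => ?_) y
    rw [abs_sub_comm]
    exact (hm0 _ hN.1).1 z
  have a4 : F 0 0 = conv μ (conv (ax1 (tr k)) (conv (ax2 (tr i)) φ)) x := by
    simp [hF]
  have key : |conv μ (hi1 k (hi2 i φ)) x| ≤ (∑ n1 ∈ Finset.range N, ∑ n2 ∈ Finset.range N,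
      |conv μ (df1 L (k - (n1 * L : ℕ)) (df2 L (i - (n2 * L : ℕ)) φ)) x|) + δ := by
    have s1 : |F N N - F 0 N - F N 0 + F 0 0| ≤ ∑ n1 ∈ Finset.range N, ∑ n2 ∈ Finset.range N,
      |conv μ (df1 L (k - (n1 * L : ℕ)) (df2 L (i - (n2 * L : ℕ)) φ)) x| := by
      rw [← sum_range_block F N]
      refine (Finset.abs_sum_le_sum_abs _ _).trans (Finset.sum_le_sum fun n1 _ => ?_)
      refine (Finset.abs_sum_le_sum_abs _ _).trans (Finset.sum_le_sum fun n2 _ => ?_)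
      rw [hblock]
    rw [conv_hi μ hφ, ← a4]
    have s2 : |(conv μ φ x - conv μ (conv (ax2 (tr i)) φ) x - conv μ (conv (ax1 (tr k)) φ) x +
        F 0 0) - (F N N - F 0 N - F N 0 + F 0 0)| ≤ δ := by
      rw [abs_le] at a1 a2 a3 ⊢
      constructor <;> linarith
    have := abs_sub_abs_le_abs_sub (conv μ φ x - conv μ (conv (ax2 (tr i)) φ) x -
      conv μ (conv (ax1 (tr k)) φ) x + F 0 0) (F N N - F 0 N - F N 0 + F 0 0)
    linarith
  calc ‖conv μ (hi1 k (hi2 i φ)) x‖ₑ = ENNReal.ofReal |conv μ (hi1 k (hi2 i φ)) x| := by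
        rw [Real.enorm_eq_ofReal_abs]
    _ ≤ ENNReal.ofReal ((∑ n1 ∈ Finset.range N, ∑ n2 ∈ Finset.range N,
      |conv μ (df1 L (k - (n1 * L : ℕ)) (df2 L (i - (n2 * L : ℕ)) φ)) x|) + δ) :=
        ENNReal.ofReal_le_ofReal key
    _ = (∑ n1 ∈ Finset.range N, ∑ n2 ∈ Finset.range N,
      ‖conv μ (df1 L (k - (n1 * L : ℕ)) (df2 L (i - (n2 * L : ℕ)) φ)) x‖ₑ) + δ := by
        rw [ENNReal.ofReal_add (by positivity) (by positivity), ENNReal.ofReal_coe_nnreal,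
          ENNReal.ofReal_sum_of_nonneg fun _ _ => by positivity]
        congr 1
        refine Finset.sum_congr rfl fun n1 _ => ?_
        rw [ENNReal.ofReal_sum_of_nonneg fun _ _ => by positivity]
        simp only [Real.enorm_eq_ofReal_abs]
    _ ≤ _ := by
        gcongr
        refine (Finset.sum_le_sum fun n1 _ => ENNReal.sum_le_tsum _).trans (ENNReal.sum_le_tsum _)

theorem low_part {b c1 c2 : ℝ} (hb : 1 < b) (hc1 : 0 < c1) : ∃ C, 0 < C ∧ ∀ ρ : ℝ, c1 ≤ |ρ| →
    |ρ| ≤ c2 → ∀ (k i : ℤ) (f : ℝ × ℝ → ℝ), BM f → ∀ x,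
    ‖conv (cm b k i ρ) f x - conv (cm b k i ρ) (hi1 k (hi2 i f)) x‖ₑ ≤
      ENNReal.ofReal C * HLM2 (fun y => ‖f y‖ₑ) x := by
  obtain ⟨C, hC, h⟩ := dom_low (c2 := c2) hb hc1
  refine ⟨3 * C, by positivity, fun ρ h1 h2 k i f hf x => ?_⟩
  obtain ⟨d1, d2, d3⟩ := h ρ h1 h2 k i (fun y => ‖f y‖ₑ) hf.1.measurable.enorm x
  have e : conv (cm b k i ρ) f x - conv (cm b k i ρ) (hi1 k (hi2 i f)) x =
      conv (cm b k i ρ) (conv (ax2 (tr i)) f) x + (conv (cm b k i ρ) (conv (ax1 (tr k)) f) x -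
        conv (cm b k i ρ) (conv (ax1 (tr k)) (conv (ax2 (tr i)) f)) x) := by
    rw [conv_hi _ hf]; ring
  have g1 : ‖conv (cm b k i ρ) (conv (ax1 (tr k)) f) x‖ₑ ≤ _ :=
    (enorm_conv_le _ _ _).trans ((convP_mono _ (fun y => enorm_conv_le _ _ _) _).trans d1)
  have g2 : ‖conv (cm b k i ρ) (conv (ax2 (tr i)) f) x‖ₑ ≤ _ :=
    (enorm_conv_le _ _ _).trans ((convP_mono _ (fun y => enorm_conv_le _ _ _) _).trans d2)
  have g3 : ‖conv (cm b k i ρ) (conv (ax1 (tr k)) (conv (ax2 (tr i)) f)) x‖ₑ ≤ _ :=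
    (enorm_conv_le _ _ _).trans ((convP_mono _ (fun y => (enorm_conv_le _ _ _).trans
      (convP_mono _ (fun z => enorm_conv_le _ _ _) _)) _).trans d3)
  rw [e, ENNReal.ofReal_mul (by norm_num), ENNReal.ofReal_ofNat, mul_assoc]
  refine (enorm_add_le _ _).trans ((add_le_add g2 (enorm_sub_le.trans (add_le_add g1 g3))).trans ?_)
  rw [← add_assoc]
  exact le_of_eq (by ring)

/-! ### Lacunary maximal functions -/

theorem lpN_HLM2_le {p : ℝ} (hp : 1 < p) (hp2 : p ≤ 2) {g : ℝ × ℝ → ℝ≥0∞} (hg : Measurable g) :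
    lpN (HLM2 g) p ≤ ENNReal.ofReal (1600 * ((p - 1)⁻¹) ^ 2) * lpN g p := by
  have hp1 : 0 < p - 1 := by linarith
  have he1 : 1 ≤ (p - 1)⁻¹ := (one_le_inv₀ hp1).mpr (by linarith)
  refine lpN_le_of_lintegral (by linarith) ((HLM2_rpow_le hp hp2 hg).trans ?_)
  refine mul_le_mul_left ?_ _
  rw [ENNReal.ofReal_rpow_of_pos (by positivity), ← ENNReal.ofReal_pow (by positivity)]
  apply ENNReal.ofReal_le_ofReal
  rw [div_eq_mul_inv, show (40 * (p - 1)⁻¹) ^ 2 = 1600 * ((p - 1)⁻¹) ^ 2 by ring]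
  exact Real.self_le_rpow_of_one_le (by nlinarith) hp.le

theorem tsum_tsum_geometric {r X : ℝ} (hr : 0 < r) (hr1 : r < 1) (hX : 0 ≤ X) :
    ∑' n1 : ℕ, ∑' n2 : ℕ, ENNReal.ofReal (X * r ^ n1 * r ^ n2) =
      ENNReal.ofReal (X * ((1 - r)⁻¹) ^ 2) := by
  have h : ∑' n : ℕ, ENNReal.ofReal r ^ n = ENNReal.ofReal ((1 - r)⁻¹) := by
    rw [ENNReal.tsum_geometric, ENNReal.ofReal_inv_of_pos (by linarith), ENNReal.ofReal_sub _ hr.le,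
      ENNReal.ofReal_one]
  have h2 : ∀ n1 n2 : ℕ, ENNReal.ofReal (X * r ^ n1 * r ^ n2) =
      ENNReal.ofReal X * ENNReal.ofReal r ^ n1 * ENNReal.ofReal r ^ n2 := by
    intro n1 n2
    rw [ENNReal.ofReal_mul (by positivity), ENNReal.ofReal_mul hX, ENNReal.ofReal_pow hr.le,
      ENNReal.ofReal_pow hr.le]
  simp only [h2, ENNReal.tsum_mul_left, ENNReal.tsum_mul_right, h]
  have : 0 < 1 - r := by linarith
  rw [ENNReal.ofReal_mul hX, ENNReal.ofReal_pow (by positivity)]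
  ring

theorem lac_step {b c1 c2 : ℝ} (hb : 1 < b) (hc1 : 0 < c1) : ∃ C, 1 ≤ C ∧ ∀ p : ℝ, 1 < p → p ≤ 2 →
    ∀ ρ : ℤ × ℤ → ℝ, (∀ j, c1 ≤ |ρ j| ∧ |ρ j| ≤ c2) → ∀ (J : Finset (ℤ × ℤ)) (B : ℝ), 1 ≤ B →
    (∀ g : ℝ × ℝ → ℝ≥0∞, Measurable g →
      lpN (fun x => ⨆ j ∈ J, convP (cm b j.1 j.2 (ρ j)) g x) p ≤ ENNReal.ofReal B * lpN g p) →
    ∀ g : ℝ × ℝ → ℝ≥0∞, Measurable g →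
      lpN (fun x => ⨆ j ∈ J, convP (cm b j.1 j.2 (ρ j)) g x) p ≤
        ENNReal.ofReal (C * ((p - 1)⁻¹) ^ 2 + C * ((p - 1)⁻¹) ^ 3 * √B) * lpN g p := by
  obtain ⟨Cl, hCl, hlow⟩ := low_part (c2 := c2) hb hc1
  obtain ⟨Cb, hCb, hblk⟩ := blk_lp hb hc1
  set r : ℝ := 2 ^ (-(1/4) : ℝ) with hr
  have hr0 : 0 < r := by positivity
  have hr1 : r < 1 := Real.rpow_lt_one_of_one_lt_of_neg one_lt_two (by norm_num)
  have hr2 : 0 < 1 - r := by linarith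
  refine ⟨max 1 (max (Cl * 1600) (Cb * ((1 - r)⁻¹) ^ 2)), le_max_left _ _,
    fun p hp hp2 ρ hρ J B hB1 hB => ?_⟩
  set C := max 1 (max (Cl * 1600) (Cb * ((1 - r)⁻¹) ^ 2)) with hC
  have hC1 : 1 ≤ C := le_max_left _ _
  have hCa : Cl * 1600 ≤ C := (le_max_left _ _).trans (le_max_right _ _)
  have hCd : Cb * ((1 - r)⁻¹) ^ 2 ≤ C := (le_max_right _ _).trans (le_max_right _ _)
  have hp0 : 0 < p := by linarith
  have hp1 : 0 < p - 1 := by linarith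
  set e := (p - 1)⁻¹ with he
  have he0 : 0 < e := by positivity
  intro g hg
  refine lpN_sup_of_compact_support J _ hp.le (fun φ hc hcs h0 => ?_) ?_ hg
  swap
  · rw [ne_eq, ENNReal.ofReal_eq_zero, not_le]; positivity
  have hBM : BM φ := by
    refine ⟨hc.stronglyMeasurable, ?_⟩
    obtain ⟨M, hM⟩ := hcs.exists_bound_of_continuous hc
    exact ⟨M, hM⟩
  have hint : Integrable φ := hc.integrable_of_hasCompactSupport hcs
  have hu : UniformContinuous φ := hcs.uniformContinuous_of_continuous hc
  have hφm : Measurable fun y => ‖φ y‖ₑ := hBM.1.measurable.enorm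
  have hL : 1 ≤ ⌈e⌉₊ := Nat.one_le_iff_ne_zero.mpr (Nat.ceil_pos.mpr he0).ne'
  set S : ℝ × ℝ → ℝ≥0∞ := fun x => ∑' n1 : ℕ, ∑' n2 : ℕ,
    blk b ρ J ⌈e⌉₊ (n1 * ⌈e⌉₊ : ℕ) (n2 * ⌈e⌉₊ : ℕ) φ x with hS
  have hbm : ∀ n1 n2 : ℕ, Measurable (blk b ρ J ⌈e⌉₊ (n1 * ⌈e⌉₊ : ℕ) (n2 * ⌈e⌉₊ : ℕ) φ) :=
    fun n1 n2 => measurable_blk b ρ J _ _ _ hBM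
  have hSm : Measurable S := Measurable.tsum fun n1 => Measurable.tsum fun n2 =>
    hbm n1 n2
  have hpt : ∀ x, ⨆ j ∈ J, convP (cm b j.1 j.2 (ρ j)) (fun y => ‖φ y‖ₑ) x ≤
      ENNReal.ofReal Cl * HLM2 (fun y => ‖φ y‖ₑ) x + S x := by
    intro x
    refine iSup₂_le fun j hj => ?_
    have e1 : convP (cm b j.1 j.2 (ρ j)) (fun y => ‖φ y‖ₑ) x =
        ‖conv (cm b j.1 j.2 (ρ j)) φ x‖ₑ := by
      rw [convP, conv, Real.enorm_eq_ofReal (integral_nonneg fun y => h0 _),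
        ofReal_integral_eq_lintegral_ofReal ((hBM.sub_left x).integrable _)
          (Eventually.of_forall fun y => h0 _)]
      exact lintegral_congr fun y => Real.enorm_eq_ofReal (h0 _)
    have e2 : conv (cm b j.1 j.2 (ρ j)) φ x =
        (conv (cm b j.1 j.2 (ρ j)) φ x - conv (cm b j.1 j.2 (ρ j)) (hi1 j.1 (hi2 j.2 φ)) x) +
        conv (cm b j.1 j.2 (ρ j)) (hi1 j.1 (hi2 j.2 φ)) x := by ring
    rw [e1, e2]
    refine (enorm_add_le _ _).trans (add_le_add (hlow _ (hρ j).1 (hρ j).2 _ _ φ hBM x) ?_)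
    refine (enorm_conv_hi_le _ hBM hu hL _ _ x).trans ?_
    refine ENNReal.tsum_le_tsum fun n1 => ENNReal.tsum_le_tsum fun n2 => ?_
    exact le_iSup₂_of_le j hj le_rfl
  have hSl : lpN S p ≤ ENNReal.ofReal (C * e ^ 3 * √B) * lpN (fun y => ‖φ y‖ₑ) p := by
    calc lpN S p ≤ ∑' n1 : ℕ, ∑' n2 : ℕ,
          lpN (blk b ρ J ⌈e⌉₊ (n1 * ⌈e⌉₊ : ℕ) (n2 * ⌈e⌉₊ : ℕ) φ) p := by
          refine (lpN_tsum_le hp.le fun n1 => Measurable.tsum fun n2 => hbm n1 n2).trans ?_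
          exact ENNReal.tsum_le_tsum fun n1 => lpN_tsum_le hp.le (hbm n1)
      _ ≤ ∑' n1 : ℕ, ∑' n2 : ℕ, ENNReal.ofReal (Cb * e ^ 3 * √B * r ^ n1 * r ^ n2) *
          lpN (fun y => ‖φ y‖ₑ) p :=
          ENNReal.tsum_le_tsum fun n1 => ENNReal.tsum_le_tsum fun n2 =>
            hblk p hp hp2 ρ (fun j => (hρ j).1) J B hB1 hB n1 n2 φ hBM hint
      _ = ENNReal.ofReal (Cb * e ^ 3 * √B * ((1 - r)⁻¹) ^ 2) * lpN (fun y => ‖φ y‖ₑ) p := by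
          simp only [ENNReal.tsum_mul_right]
          rw [tsum_tsum_geometric hr0 hr1 (by positivity)]
      _ ≤ _ := by
          refine mul_le_mul_left (ENNReal.ofReal_le_ofReal ?_) _
          calc Cb * e ^ 3 * √B * ((1 - r)⁻¹) ^ 2 = Cb * ((1 - r)⁻¹) ^ 2 * e ^ 3 * √B := by ring
            _ ≤ _ := by gcongr
  have hMl : lpN (fun x => ENNReal.ofReal Cl * HLM2 (fun y => ‖φ y‖ₑ) x) p ≤
      ENNReal.ofReal (C * e ^ 2) * lpN (fun y => ‖φ y‖ₑ) p := by
    rw [lpN_const_mul hp0 ENNReal.ofReal_ne_top]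
    refine (mul_le_mul_right (lpN_HLM2_le hp hp2 hφm) _).trans ?_
    rw [← mul_assoc, ← ENNReal.ofReal_mul hCl.le]
    refine mul_le_mul_left (ENNReal.ofReal_le_ofReal ?_) _
    rw [← mul_assoc]
    gcongr
  refine (lpN_mono hp0 hpt).trans ((lpN_add_le hp.le ((measurable_HLM2 hφm).const_mul _) hSm).trans ?_)
  rw [ENNReal.ofReal_add (by positivity) (by positivity), add_mul]
  exact add_le_add hMl hSl

theorem lac_finset {b c1 c2 : ℝ} (hb : 1 < b) (hc1 : 0 < c1) : ∃ C, 1 ≤ C ∧ ∀ p : ℝ, 1 < p → p ≤ 2 →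
    ∀ ρ : ℤ × ℤ → ℝ, (∀ j, c1 ≤ |ρ j| ∧ |ρ j| ≤ c2) → ∀ (J : Finset (ℤ × ℤ)),
    ∀ g : ℝ × ℝ → ℝ≥0∞, Measurable g →
      lpN (fun x => ⨆ j ∈ J, convP (cm b j.1 j.2 (ρ j)) g x) p ≤
        ENNReal.ofReal (C * ((p - 1)⁻¹) ^ 6) * lpN g p := by
  obtain ⟨C, hC, hstep⟩ := lac_step (c2 := c2) hb hc1
  refine ⟨4 * C + C ^ 2, by nlinarith, fun p hp hp2 ρ hρ J => ?_⟩
  have hp1 : 0 < p - 1 := by linarith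
  have he1 : 1 ≤ (p - 1)⁻¹ := (one_le_inv₀ hp1).mpr (by linarith)
  set e := (p - 1)⁻¹ with he
  set S : Set ℝ := {B | 1 ≤ B ∧ ∀ g : ℝ × ℝ → ℝ≥0∞, Measurable g →
      lpN (fun x => ⨆ j ∈ J, convP (cm b j.1 j.2 (ρ j)) g x) p ≤ ENNReal.ofReal B * lpN g p} with hS
  have hne : S.Nonempty := by
    refine ⟨J.card + 1, by simp, fun g hg => ?_⟩
    refine (lpN_sup_le_card J _ hp.le hg).trans (mul_le_mul_left ?_ _)
    rw [← ENNReal.ofReal_natCast]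
    exact ENNReal.ofReal_le_ofReal (by linarith)
  have hbdd : BddBelow S := ⟨1, fun B hB => hB.1⟩
  obtain ⟨B, hBS, hBlt⟩ := exists_lt_of_csInf_lt hne (lt_add_one (sInf S))
  have hCe : 1 ≤ C * e ^ 2 := one_le_mul_of_one_le_of_one_le hC (one_le_pow₀ he1)
  have hmem : C * e ^ 2 + C * e ^ 3 * √B ∈ S := by
    refine ⟨?_, hstep p hp hp2 ρ hρ J B hBS.1 hBS.2⟩
    have : 0 ≤ C * e ^ 3 * √B := by positivity
    linarith
  have h1 := csInf_le hbdd hmem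
  have hsq : √B ^ 2 = B := Real.sq_sqrt (by linarith [hBS.1])
  have h2 : B ≤ 2 * (C * e ^ 2 + 1) + (C * e ^ 3) ^ 2 := by
    nlinarith [sq_nonneg (√B - C * e ^ 3)]
  have h3 : B ≤ (4 * C + C ^ 2) * e ^ 6 := by
    have : e ^ 2 ≤ e ^ 6 := pow_le_pow_right₀ he1 (by norm_num)
    nlinarith
  intro g hg
  exact (hBS.2 g hg).trans (mul_le_mul_left (ENNReal.ofReal_le_ofReal h3) _)

theorem lac {b c1 c2 : ℝ} (hb : 1 < b) (hc1 : 0 < c1) : ∃ C, 1 ≤ C ∧ ∀ p : ℝ, 1 < p → p ≤ 2 →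
    ∀ ρ : ℤ × ℤ → ℝ, (∀ j, c1 ≤ |ρ j| ∧ |ρ j| ≤ c2) →
    ∀ g : ℝ × ℝ → ℝ≥0∞, Measurable g →
      lpN (fun x => ⨆ j : ℤ × ℤ, convP (cm b j.1 j.2 (ρ j)) g x) p ≤
        ENNReal.ofReal (C * ((p - 1)⁻¹) ^ 6) * lpN g p := by
  obtain ⟨C, hC, h⟩ := lac_finset (c2 := c2) hb hc1
  refine ⟨C, hC, fun p hp hp2 ρ hρ g hg => ?_⟩
  obtain ⟨e⟩ : Nonempty (ℕ ≃ ℤ × ℤ) := ⟨(Denumerable.eqv (ℤ × ℤ)).symm⟩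
  set J : ℕ → Finset (ℤ × ℤ) := fun n => (Finset.range n).map e.toEmbedding with hJ
  have hJm : Monotone J := fun m n hmn => Finset.map_subset_map.mpr (Finset.range_mono hmn)
  have e1 : (fun x => ⨆ j : ℤ × ℤ, convP (cm b j.1 j.2 (ρ j)) g x) = fun x =>
      ⨆ n, ⨆ j ∈ J n, convP (cm b j.1 j.2 (ρ j)) g x := by
    funext x
    refine le_antisymm (iSup_le fun j => ?_) (iSup_le fun n => iSup₂_le fun j _ => le_iSup
      (fun j : ℤ × ℤ => convP (cm b j.1 j.2 (ρ j)) g x) j)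
    refine le_iSup_of_le (e.symm j + 1) (le_iSup₂_of_le j ?_ le_rfl)
    rw [hJ, Finset.mem_map]
    exact ⟨e.symm j, by simp, by simp⟩
  rw [e1, lpN_iSup (by linarith)]
  · exact iSup_le fun n => h p hp hp2 ρ hρ (J n) g hg
  · intro n
    exact Measurable.biSup _ (J n).countable_toSet fun j _ => measurable_convP _ hg
  · intro x m n hmn
    exact biSup_mono (fun j hj => hJm hmn hj)

/-! ### Differences of maximal functions for nearby families of curves -/

/-- The maximal function of differences of high-frequency averages along two families of curves. -/
def dif (b : ℝ) (ρ ρ' : ℤ × ℤ → ℝ) (f : ℝ × ℝ → ℝ) (x : ℝ × ℝ) : ℝ≥0∞ :=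
  ⨆ j : ℤ × ℤ, ‖conv (cm b j.1 j.2 (ρ j)) (hi1 j.1 (hi2 j.2 f)) x -
    conv (cm b j.1 j.2 (ρ' j)) (hi1 j.1 (hi2 j.2 f)) x‖ₑ

theorem BM.hi1 (k : ℤ) {f : ℝ × ℝ → ℝ} (hf : BM f) : BM (hi1 k f) := hf.sub (hf.conv _)

theorem BM.hi2 (k : ℤ) {f : ℝ × ℝ → ℝ} (hf : BM f) : BM (hi2 k f) := hf.sub (hf.conv _)

theorem hi1_add (k : ℤ) {f g : ℝ × ℝ → ℝ} (hf : BM f) (hg : BM g) :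
    hi1 k (fun x => f x + g x) = fun x => hi1 k f x + hi1 k g x := by
  funext x
  simp only [hi1, conv_add _ hf hg]
  ring

theorem hi2_add (k : ℤ) {f g : ℝ × ℝ → ℝ} (hf : BM f) (hg : BM g) :
    hi2 k (fun x => f x + g x) = fun x => hi2 k f x + hi2 k g x := by
  funext x
  simp only [hi2, conv_add _ hf hg]
  ring

theorem measurable_dif (b : ℝ) (ρ ρ' : ℤ × ℤ → ℝ) {f : ℝ × ℝ → ℝ} (hf : BM f) :
    Measurable (dif b ρ ρ' f) :=
  Measurable.iSup fun j => ((((hf.hi2 j.2).hi1 j.1).conv (cm b j.1 j.2 (ρ j))).sub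
    (((hf.hi2 j.2).hi1 j.1).conv (cm b j.1 j.2 (ρ' j)))).1.measurable.enorm

theorem dif_add_le (b : ℝ) (ρ ρ' : ℤ × ℤ → ℝ) {f g : ℝ × ℝ → ℝ} (hf : BM f) (hg : BM g)
    (x : ℝ × ℝ) : dif b ρ ρ' (fun x => f x + g x) x ≤ dif b ρ ρ' f x + dif b ρ ρ' g x := by
  refine iSup_le fun j => ?_
  have hf' := (hf.hi2 j.2).hi1 j.1
  have hg' := (hg.hi2 j.2).hi1 j.1
  rw [hi2_add _ hf hg, hi1_add _ (hf.hi2 _) (hg.hi2 _), conv_add _ hf' hg', conv_add _ hf' hg',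
    add_sub_add_comm]
  exact (enorm_add_le _ _).trans (add_le_add
    (le_iSup (fun j : ℤ × ℤ => ‖conv (cm b j.1 j.2 (ρ j)) (hi1 j.1 (hi2 j.2 f)) x -
      conv (cm b j.1 j.2 (ρ' j)) (hi1 j.1 (hi2 j.2 f)) x‖ₑ) j)
    (le_iSup (fun j : ℤ × ℤ => ‖conv (cm b j.1 j.2 (ρ j)) (hi1 j.1 (hi2 j.2 g)) x -
      conv (cm b j.1 j.2 (ρ' j)) (hi1 j.1 (hi2 j.2 g)) x‖ₑ) j))

theorem dif_lac {b c1 c2 : ℝ} (hb : 1 < b) (hc1 : 0 < c1) : ∃ C, 1 ≤ C ∧ ∀ p : ℝ, 1 < p → p ≤ 2 →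
    ∀ ρ ρ' : ℤ × ℤ → ℝ, (∀ j, c1 ≤ |ρ j| ∧ |ρ j| ≤ c2) → (∀ j, c1 ≤ |ρ' j| ∧ |ρ' j| ≤ c2) →
    ∀ f : ℝ × ℝ → ℝ, BM f →
      lpN (dif b ρ ρ' f) p ≤ ENNReal.ofReal (C * ((p - 1)⁻¹) ^ 6) * lpN (fun x => ‖f x‖ₑ) p := by
  obtain ⟨Ca, hCa, hlac⟩ := lac (c2 := c2) hb hc1
  obtain ⟨Cl, hCl, hlow⟩ := low_part (c2 := c2) hb hc1
  refine ⟨2 * Ca + 2 * (Cl * 1600), by nlinarith, fun p hp hp2 ρ ρ' hρ hρ' f hf => ?_⟩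
  have hp0 : 0 < p := by linarith
  have hp1 : 0 < p - 1 := by linarith
  have he1 : 1 ≤ (p - 1)⁻¹ := (one_le_inv₀ hp1).mpr (by linarith)
  set e := (p - 1)⁻¹ with he
  have hfm : Measurable fun y => ‖f y‖ₑ := hf.1.measurable.enorm
  set A : (ℤ × ℤ → ℝ) → ℝ × ℝ → ℝ≥0∞ := fun ρ x =>
    ⨆ j : ℤ × ℤ, convP (cm b j.1 j.2 (ρ j)) (fun y => ‖f y‖ₑ) x with hA
  have hAm : ∀ ρ, Measurable (A ρ) := fun ρ => Measurable.iSup fun j => measurable_convP _ hfm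
  have hHm := measurable_HLM2 hfm
  have h1 : ∀ ρ : ℤ × ℤ → ℝ, (∀ j, c1 ≤ |ρ j| ∧ |ρ j| ≤ c2) → ∀ j x,
      ‖conv (cm b j.1 j.2 (ρ j)) (hi1 j.1 (hi2 j.2 f)) x‖ₑ ≤
        A ρ x + ENNReal.ofReal Cl * HLM2 (fun y => ‖f y‖ₑ) x := by
    intro ρ hρ j x
    have e2 : conv (cm b j.1 j.2 (ρ j)) (hi1 j.1 (hi2 j.2 f)) x =
        conv (cm b j.1 j.2 (ρ j)) f x -
        (conv (cm b j.1 j.2 (ρ j)) f x - conv (cm b j.1 j.2 (ρ j)) (hi1 j.1 (hi2 j.2 f)) x) := by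
      ring
    rw [e2]
    refine enorm_sub_le.trans (add_le_add ?_ (hlow _ (hρ j).1 (hρ j).2 _ _ f hf x))
    exact (enorm_conv_le _ _ _).trans
      (le_iSup (fun j : ℤ × ℤ => convP (cm b j.1 j.2 (ρ j)) (fun y => ‖f y‖ₑ) x) j)
  have hpt : ∀ x, dif b ρ ρ' f x ≤ (A ρ x + A ρ' x) +
      (2 * ENNReal.ofReal Cl) * HLM2 (fun y => ‖f y‖ₑ) x := by
    intro x
    refine iSup_le fun j => enorm_sub_le.trans
      ((add_le_add (h1 ρ hρ j x) (h1 ρ' hρ' j x)).trans (le_of_eq ?_))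
    ring
  have hCl' : ENNReal.ofReal Cl ≠ ∞ := ENNReal.ofReal_ne_top
  refine (lpN_mono hp0 hpt).trans ?_
  refine (lpN_add_le hp.le ((hAm ρ).add (hAm ρ')) (hHm.const_mul _)).trans ?_
  refine (add_le_add (lpN_add_le hp.le (hAm ρ) (hAm ρ')) le_rfl).trans ?_
  rw [lpN_const_mul hp0 (ENNReal.mul_ne_top ENNReal.ofNat_ne_top hCl')]
  refine (add_le_add (add_le_add (hlac p hp hp2 ρ hρ _ hfm) (hlac p hp hp2 ρ' hρ' _ hfm))
    (mul_le_mul_right (lpN_HLM2_le hp hp2 hfm) _)).trans ?_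
  have h2 : (2:ℝ≥0∞) * ENNReal.ofReal Cl = ENNReal.ofReal (2 * Cl) := by
    rw [ENNReal.ofReal_mul (by norm_num), ENNReal.ofReal_ofNat]
  rw [h2, ← mul_assoc, ← add_mul, ← add_mul, ← ENNReal.ofReal_mul (by positivity),
    ← ENNReal.ofReal_add (by positivity) (by positivity),
    ← ENNReal.ofReal_add (by positivity) (by positivity)]
  refine mul_le_mul_left (ENNReal.ofReal_le_ofReal ?_) _
  have : e ^ 2 ≤ e ^ 6 := pow_le_pow_right₀ he1 (by norm_num)
  nlinarith [mul_le_mul_of_nonneg_left this (show 0 ≤ 2 * Cl * 1600 by positivity)]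

theorem dif_l2 {b c1 c2 : ℝ} (hb : 1 < b) (hc1 : 0 < c1) : ∃ C, 1 ≤ C ∧ ∀ d : ℝ, 0 < d →
    ∀ ρ ρ' : ℤ × ℤ → ℝ, (∀ j, c1 ≤ |ρ j| ∧ |ρ j| ≤ c2) → (∀ j, c1 ≤ |ρ' j| ∧ |ρ' j| ≤ c2) →
    (∀ j, |ρ j - ρ' j| ≤ d) → ∀ f : ℝ × ℝ → ℝ, BM f → Integrable f →
      ∫⁻ x, dif b ρ ρ' f x ^ 2 ≤ ENNReal.ofReal (C * d) * ∫⁻ x, ‖f x‖ₑ ^ 2 := by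
  obtain ⟨C, hC, h⟩ := l2_diff (c2 := c2) hb hc1
  refine ⟨max 1 C, le_max_left _ _, fun d hd ρ ρ' hρ hρ' hd' f hf hi => ?_⟩
  set a : ℤ × ℤ → ℝ × ℝ → ℝ≥0∞ := fun j x =>
    ‖conv (cm b j.1 j.2 (ρ j)) (hi1 j.1 (hi2 j.2 f)) x -
      conv (cm b j.1 j.2 (ρ' j)) (hi1 j.1 (hi2 j.2 f)) x‖ₑ ^ 2 with ha
  have ham : ∀ j, Measurable (a j) := fun j => ((((hf.hi2 j.2).hi1 j.1).conv _).sub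
    (((hf.hi2 j.2).hi1 j.1).conv _)).1.measurable.enorm.pow_const 2
  calc ∫⁻ x, dif b ρ ρ' f x ^ 2 ≤ ∫⁻ x, ∑' j, a j x := by
        refine lintegral_mono fun x => ?_
        simp only
        rw [dif, ENNReal.iSup_pow]
        exact iSup_le fun j => ENNReal.le_tsum (f := fun j => a j x) j
    _ = ∑' j, ∫⁻ x, a j x := lintegral_tsum fun j => (ham j).aemeasurable
    _ ≤ _ := by
        rw [ENNReal.tsum_eq_iSup_sum]
        refine iSup_le fun J => ?_
        rw [← lintegral_finsetSum _ fun j _ => ham j]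
        refine (h d hd ρ ρ' hρ hρ' hd' J f hf hi).trans ?_
        refine mul_le_mul_left (ENNReal.ofReal_le_ofReal ?_) _
        exact mul_le_mul_of_nonneg_right (le_max_right _ _) hd.le

theorem inv_pow_six_le {p : ℝ} (hp : 1 < p) (hp2 : p ≤ 2) :
    ((p - 1)⁻¹) ^ 6 ≤ 9 ^ 6 * (p - 1) ^ (3 - 10 / p) := by
  have hp1 : 0 < p - 1 := by linarith
  rcases le_total p (10 / 9) with h | h
  · have h1 : 3 - 10 / p ≤ -6 := by
      have : 9 ≤ 10 / p := by rw [le_div_iff₀ (by linarith)]; linarith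
      linarith
    have h2 : (p - 1) ^ (-6 : ℝ) ≤ (p - 1) ^ (3 - 10 / p) :=
      Real.rpow_le_rpow_of_exponent_ge hp1 (by linarith) h1
    have h3 : (p - 1) ^ (-6 : ℝ) = ((p - 1)⁻¹) ^ 6 := by
      rw [Real.rpow_neg hp1.le, inv_pow]
      norm_cast
    have h4 : 0 < (p - 1) ^ (3 - 10 / p) := by positivity
    rw [← h3]
    linarith
  · have h1 : 3 - 10 / p ≤ 0 := by
      have : 3 ≤ 10 / p := by rw [le_div_iff₀ (by linarith)]; linarith
      linarith
    have h2 : 1 ≤ (p - 1) ^ (3 - 10 / p) :=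
      Real.one_le_rpow_of_pos_of_le_one_of_nonpos hp1 (by linarith) h1
    have h3 : (p - 1)⁻¹ ≤ 9 := by
      rw [inv_le_comm₀ hp1 (by norm_num)]; linarith
    calc ((p - 1)⁻¹) ^ 6 ≤ 9 ^ 6 := by gcongr
      _ ≤ _ := le_mul_of_one_le_right (by norm_num) h2

theorem natCast_rpow_le {l : ℕ} (hl : 2 ≤ l) : (l:ℝ) ^ (12 / ((l:ℝ) - 1)) ≤ 2 ^ 12 := by
  have hl' : (2:ℝ) ≤ l := by exact_mod_cast hl
  have h1 : (l:ℝ) ≤ 2 ^ ((l:ℝ) - 1) := by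
    have : l ≤ 2 ^ (l - 1) := by
      have := Nat.lt_two_pow_self (n := l - 1)
      omega
    calc (l:ℝ) ≤ ((2 ^ (l - 1) : ℕ) : ℝ) := by exact_mod_cast this
      _ = 2 ^ ((l:ℝ) - 1) := by
        push_cast
        rw [← Real.rpow_natCast, Nat.cast_sub (by omega)]
        simp
  calc (l:ℝ) ^ (12 / ((l:ℝ) - 1)) ≤ (2 ^ ((l:ℝ) - 1)) ^ (12 / ((l:ℝ) - 1)) :=
        Real.rpow_le_rpow (by linarith) h1 (div_nonneg (by norm_num) (by linarith))
    _ = 2 ^ 12 := by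
        rw [← Real.rpow_mul two_pos.le, mul_div_cancel₀ _ (by linarith : (l:ℝ) - 1 ≠ 0)]
        norm_cast

theorem interpolation_exponents {p q η : ℝ} (hp2 : p ≤ 2) {l : ℕ} (hl : 2 ≤ l)
    (hq : q = 1 + 1 / (l:ℝ)) (hqp : q < p) (hη : η = (p - q) / (2 - q)) {A B : ℝ} (hA : 1 ≤ A)
    (hB : 1 ≤ B) :
    4 * (((A * (l:ℝ) ^ 6) ^ q) ^ (1 - η) * (B * 2 ^ (-(l:ℝ))) ^ η) ≤
      (4 * (A ^ 2 * 2 ^ 12 * (B * 2)) * (l:ℝ) ^ (7 * (2 / p - 1)) *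
        (2 ^ (-(l:ℝ))) ^ (1 - 1 / p)) ^ p := by
  have hl' : (2:ℝ) ≤ l := by exact_mod_cast hl
  have hl0 : (0:ℝ) < l := by linarith
  have hl1 : (0:ℝ) < l - 1 := by linarith
  have hq1 : 1 < q := by rw [hq]; have : 0 < 1 / (l:ℝ) := by positivity
                         linarith
  have hq32 : q ≤ 3 / 2 := by
    rw [hq]
    have : 1 / (l:ℝ) ≤ 1 / 2 := one_div_le_one_div_of_le two_pos hl'
    linarith
  have hp0 : 0 < p := by linarith
  have h2q : 0 < 2 - q := by linarith
  have hη0 : 0 < η := by rw [hη]; exact div_pos (by linarith) h2q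
  have hη1 : η ≤ 1 := by rw [hη, div_le_one h2q]; linarith
  have h1η : 1 - η = (2 - p) / (2 - q) := by rw [hη]; field_simp; ring
  have e1 : ((A * (l:ℝ) ^ 6) ^ q) ^ (1 - η) ≤ A ^ 2 * 2 ^ 12 * (l:ℝ) ^ (7 * (2 - p)) := by
    have hAe : A ^ (q * (1 - η)) ≤ A ^ 2 := by
      rw [← Real.rpow_two]
      exact Real.rpow_le_rpow_of_exponent_le hA (by nlinarith)
    have hx : 6 * (q * (1 - η)) = 12 / ((l:ℝ) - 1) * (2 - p) + 6 * (2 - p) := by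
      rw [h1η, hq]
      have : 2 - (1 + 1 / (l:ℝ)) ≠ 0 := by rw [← hq]; exact h2q.ne'
      have h3 : (l:ℝ) * 2 - (l + 1) ≠ 0 := by nlinarith
      field_simp
      ring
    have hle : ((l:ℝ) ^ 6) ^ (q * (1 - η)) ≤ 2 ^ 12 * (l:ℝ) ^ (7 * (2 - p)) := by
      rw [← Real.rpow_natCast, ← Real.rpow_mul hl0.le]
      have : ((6:ℕ):ℝ) * (q * (1 - η)) = 12 / ((l:ℝ) - 1) * (2 - p) + 6 * (2 - p) := by
        rw [← hx]; norm_num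
      rw [this, Real.rpow_add hl0, Real.rpow_mul hl0.le]
      have k1 : ((l:ℝ) ^ (12 / ((l:ℝ) - 1))) ^ (2 - p) ≤ 2 ^ 12 := by
        calc ((l:ℝ) ^ (12 / ((l:ℝ) - 1))) ^ (2 - p) ≤ (2 ^ 12) ^ (2 - p) :=
              Real.rpow_le_rpow (by positivity) (natCast_rpow_le hl) (by linarith)
          _ ≤ (2 ^ 12) ^ (1:ℝ) :=
              Real.rpow_le_rpow_of_exponent_le (by norm_num) (by linarith)
          _ = 2 ^ 12 := Real.rpow_one _
      have k2 : (l:ℝ) ^ (6 * (2 - p)) ≤ (l:ℝ) ^ (7 * (2 - p)) :=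
        Real.rpow_le_rpow_of_exponent_le (by linarith) (by linarith)
      gcongr
    rw [← Real.rpow_mul (by positivity), Real.mul_rpow (by positivity) (by positivity), mul_assoc]
    gcongr
  have e2 : (B * 2 ^ (-(l:ℝ))) ^ η ≤ B * 2 * (2 ^ (-(l:ℝ))) ^ (p - 1) := by
    rw [Real.mul_rpow (by positivity) (by positivity), ← Real.rpow_mul two_pos.le,
      ← Real.rpow_mul two_pos.le, mul_assoc]
    have k1 : B ^ η ≤ B := by simpa using Real.rpow_le_rpow_of_exponent_le hB hη1
    have k2 : (2:ℝ) ^ (-(l:ℝ) * η) ≤ 2 * 2 ^ (-(l:ℝ) * (p - 1)) := by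
      nth_rewrite 2 [← Real.rpow_one (2:ℝ)]
      rw [← Real.rpow_add two_pos]
      refine Real.rpow_le_rpow_of_exponent_le one_le_two ?_
      have k3 : p - q ≤ η := by
        rw [hη, le_div_iff₀ h2q]
        nlinarith
      have k4 : (l:ℝ) * (p - q) ≤ l * η := by gcongr
      have k5 : (l:ℝ) * (p - q) = l * (p - 1) - 1 := by rw [hq]; field_simp; ring
      linarith
    gcongr
  have hc : 1 ≤ 4 * (A ^ 2 * 2 ^ 12 * (B * 2)) := by
    have : 1 ≤ A ^ 2 := one_le_pow₀ hA
    nlinarith [mul_le_mul this hB zero_le_one (by positivity)]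
  have e3 : (l:ℝ) ^ (7 * (2 - p)) = ((l:ℝ) ^ (7 * (2 / p - 1))) ^ p := by
    rw [← Real.rpow_mul hl0.le]; congr 1; field_simp
  have e4 : ((2:ℝ) ^ (-(l:ℝ))) ^ (p - 1) = ((2 ^ (-(l:ℝ))) ^ (1 - 1 / p)) ^ p := by
    have : p - 1 = (1 - 1 / p) * p := by field_simp
    rw [this, Real.rpow_mul (by positivity)]
  calc _ ≤ 4 * ((A ^ 2 * 2 ^ 12 * (l:ℝ) ^ (7 * (2 - p))) * (B * 2 * (2 ^ (-(l:ℝ))) ^ (p - 1))) := by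
        gcongr
    _ = (4 * (A ^ 2 * 2 ^ 12 * (B * 2))) *
        (((l:ℝ) ^ (7 * (2 / p - 1))) ^ p * ((2 ^ (-(l:ℝ))) ^ (1 - 1 / p)) ^ p) := by
        rw [e3, e4]; ring
    _ ≤ (4 * (A ^ 2 * 2 ^ 12 * (B * 2))) ^ p *
        (((l:ℝ) ^ (7 * (2 / p - 1))) ^ p * ((2 ^ (-(l:ℝ))) ^ (1 - 1 / p)) ^ p) := by
        refine mul_le_mul_of_nonneg_right ?_ (by positivity)
        exact Real.self_le_rpow_of_one_le hc (by linarith)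
    _ = _ := by
        rw [← Real.mul_rpow (by positivity) (by positivity),
          ← Real.mul_rpow (by positivity) (by positivity), ← mul_assoc]

theorem dif_lp {b c1 c2 c3 : ℝ} (hb : 1 < b) (hc1 : 0 < c1) : ∃ C, 1 ≤ C ∧ ∀ p : ℝ, 1 < p → p ≤ 2 →
    ∀ l : ℕ, 1 ≤ l →
    ∀ ρ ρ' : ℤ × ℤ → ℝ, (∀ j, c1 ≤ |ρ j| ∧ |ρ j| ≤ c2) → (∀ j, c1 ≤ |ρ' j| ∧ |ρ' j| ≤ c2) →
    (∀ j, |ρ j - ρ' j| ≤ c3 * 2 ^ (-(l:ℝ))) → ∀ f : ℝ × ℝ → ℝ, BM f → Integrable f →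
      lpN (dif b ρ ρ' f) p ≤
        ENNReal.ofReal (C * theta p l * (2 ^ (-(l:ℝ))) ^ (1 - 1 / p)) * lpN (fun x => ‖f x‖ₑ) p := by
  obtain ⟨Ca, hCa, hlac⟩ := dif_lac (c2 := c2) hb hc1
  obtain ⟨C2, hC2, hl2⟩ := dif_l2 (c2 := c2) hb hc1
  set B : ℝ := C2 * max 1 c3 with hBd
  have hB1 : 1 ≤ B := one_le_mul_of_one_le_of_one_le hC2 (le_max_left _ _)
  refine ⟨max (2 * 9 ^ 6 * Ca) (4 * (Ca ^ 2 * 2 ^ 12 * (B * 2))),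
    le_max_of_le_left (by nlinarith), fun p hp hp2 l hl1 ρ ρ' hρ hρ' hd f hf hi => ?_⟩
  set C := max (2 * 9 ^ 6 * Ca) (4 * (Ca ^ 2 * 2 ^ 12 * (B * 2))) with hC
  have hp0 : 0 < p := by linarith
  have hp1 : 0 < p - 1 := by linarith
  have hl0 : (1:ℝ) ≤ l := by exact_mod_cast hl1
  rcases le_or_gt (l:ℝ) (p - 1)⁻¹ with hl | hl
  · refine (hlac p hp hp2 ρ ρ' hρ hρ' f hf).trans (mul_le_mul_left (ENNReal.ofReal_le_ofReal ?_) _)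
    rw [theta, if_pos hl]
    have h1 : (1/2 : ℝ) ≤ (2 ^ (-(l:ℝ))) ^ (1 - 1 / p) := by
      have h2 : (l:ℝ) * (p - 1) ≤ 1 := by
        calc (l:ℝ) * (p - 1) ≤ (p - 1)⁻¹ * (p - 1) := by gcongr
          _ = 1 := inv_mul_cancel₀ hp1.ne'
      have h3 : (1/2:ℝ) = 2 ^ (-1:ℝ) := by rw [Real.rpow_neg_one]; norm_num
      rw [h3, ← Real.rpow_mul two_pos.le]
      refine Real.rpow_le_rpow_of_exponent_le one_le_two ?_
      have h4 : -(l:ℝ) * (1 - 1 / p) = -((l:ℝ) * (p - 1) / p) := by field_simp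
      rw [h4, neg_le_neg_iff, div_le_one hp0]
      linarith
    have h5 := inv_pow_six_le hp hp2
    have h6 : 0 < (p - 1) ^ (3 - 10 / p) := by positivity
    calc Ca * ((p - 1)⁻¹) ^ 6 ≤ Ca * (9 ^ 6 * (p - 1) ^ (3 - 10 / p)) := by gcongr
      _ = (2 * 9 ^ 6 * Ca) * (p - 1) ^ (3 - 10 / p) * (1 / 2) := by ring
      _ ≤ _ := by gcongr; exact le_max_left _ _
  · have hl2' : 2 ≤ l := by
      have : (1:ℝ) < l := lt_of_le_of_lt ((one_le_inv₀ hp1).mpr (by linarith)) hl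
      exact_mod_cast this
    set q : ℝ := 1 + 1 / (l:ℝ) with hq
    have hqi : (q - 1)⁻¹ = l := by rw [hq]; simp
    have hlpos : (0:ℝ) < l := by linarith
    have hq1 : 1 < q := by rw [hq]; have : 0 < 1 / (l:ℝ) := by positivity
                           linarith
    have hqp : q < p := by
      have := inv_lt_of_inv_lt₀ hp1 hl
      rw [hq, one_div]; linarith
    have hq2 : q < 2 := by linarith
    set η := (p - q) / (2 - q) with hη
    have h2q : 0 < 2 - q := by linarith
    have hη0 : 0 < η := div_pos (by linarith) h2q
    have hpη : p = (1 - η) * q + 2 * η := by rw [hη]; field_simp; ring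
    set w : ℝ := 2 ^ (-(l:ℝ)) with hw
    have hw0 : 0 < w := by positivity
    have hTq : ∀ f, BM f → ∫⁻ x, dif b ρ ρ' f x ^ q ≤
        ENNReal.ofReal ((Ca * (l:ℝ) ^ 6) ^ q) * ∫⁻ x, ‖f x‖ₑ ^ q := by
      intro f hf
      have := hlac q hq1 hq2.le ρ ρ' hρ hρ' f hf
      rw [hqi] at this
      have := lintegral_le_of_lpN (by linarith) this
      rwa [ENNReal.ofReal_rpow_of_pos (by positivity)] at this
    have hT2 : ∀ f : ℝ × ℝ → ℝ, BM f → Integrable f → ∫⁻ x, dif b ρ ρ' f x ^ 2 ≤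
        ENNReal.ofReal (B * w) * ∫⁻ x, ‖f x‖ₑ ^ 2 := by
      intro f hf hi
      have := hl2 (max 1 c3 * w) (by positivity) ρ ρ' hρ hρ'
        (fun j => (hd j).trans (by gcongr; exact le_max_right _ _)) f hf hi
      rwa [← mul_assoc] at this
    have hmain : ∫⁻ x, dif b ρ ρ' f x ^ p ≤
        4 * ENNReal.ofReal (((Ca * (l:ℝ) ^ 6) ^ q) ^ (1 - η) * (B * w) ^ η) *
          ∫⁻ x, ‖f x‖ₑ ^ p := by
      rcases hp2.lt_or_eq with h2 | h2
      · refine interpolation volume (q := q) (P := fun f => BM f ∧ Integrable f)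
          (by linarith) hq2 hη0 ?_ hpη (by positivity) (by positivity) _
          ?_ ?_ ?_ ?_ ?_ ?_ f ⟨hf, hi⟩
        · rw [hη, div_lt_one h2q]; linarith
        · exact fun f hf => hf.1.1.measurable
        · exact fun f s hf hs => ⟨hf.1.indicator hs, hf.2.indicator hs⟩
        · exact fun f hf => measurable_dif _ _ _ hf.1
        · intro f s x hf hs
          refine le_trans (le_of_eq ?_) (dif_add_le _ _ _ (hf.1.indicator hs)
            (hf.1.indicator hs.compl) x)
          congr 1
          funext y
          exact (congrFun (indicator_self_add_compl s f) y).symm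
        · exact fun f hf => hTq f hf.1
        · exact fun f hf => hT2 f hf.1 hf.2
      · have hη' : η = 1 := by rw [hη, h2]; exact div_self (by linarith)
        have := hT2 f hf hi
        simp only [hη', h2, sub_self, Real.rpow_zero, one_mul, Real.rpow_one, ENNReal.rpow_two]
        refine this.trans ?_
        gcongr
        exact le_mul_of_one_le_left bot_le (by norm_num)
    refine lpN_le_of_lintegral hp0 (hmain.trans ?_)
    refine mul_le_mul_left ?_ _
    rw [theta, if_neg (not_le.mpr hl)]
    rw [ENNReal.ofReal_rpow_of_pos (by positivity), ← ENNReal.ofReal_ofNat,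
      ← ENNReal.ofReal_mul (by norm_num)]
    apply ENNReal.ofReal_le_ofReal
    refine (interpolation_exponents hp2 hl2' hq hqp hη hCa hB1).trans ?_
    refine Real.rpow_le_rpow (by positivity) ?_ hp0.le
    gcongr
    exact le_max_right _ _

/-! ### Reduction to single scale averages and selection of grid points -/

theorem ofReal_iSup_le {ι : Sort*} {a : ι → ℝ} {B : ℝ≥0∞} (h : ∀ i, ENNReal.ofReal (a i) ≤ B) :
    ENNReal.ofReal (⨆ i, a i) ≤ B := by
  rcases eq_or_ne B ∞ with rfl | hB
  · exact le_top
  · refine ENNReal.ofReal_le_of_le_toReal (Real.iSup_le (fun i => ?_) ENNReal.toReal_nonneg)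
    exact (ENNReal.ofReal_le_iff_le_toReal hB).mp (h i)

theorem setLIntegral_dyadic (k : ℤ) (ψ : ℝ → ℝ≥0∞) :
    ∫⁻ t in Icc ((2:ℝ) ^ k) (2 ^ (k + 1)), ψ t =
      ENNReal.ofReal (2 ^ k) * ∫⁻ s in Icc (1:ℝ) 2, ψ (2 ^ k * s) := by
  have h2 : (0:ℝ) < 2 ^ k := by positivity
  have himg : (fun s : ℝ => 2 ^ k * s) '' Icc 1 2 = Icc ((2:ℝ) ^ k) (2 ^ (k + 1)) := by
    rw [image_mul_left_Icc h2.le one_le_two, mul_one, zpow_add_one₀ two_ne_zero]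
  rw [← himg, lintegral_image_eq_lintegral_abs_deriv_mul (f' := fun _ => 2 ^ k) measurableSet_Icc
    (fun x _ => by simpa using ((hasDerivAt_id x).const_mul ((2:ℝ) ^ k)).hasDerivWithinAt)
    (fun x _ y _ h => mul_left_cancel₀ h2.ne' h)]
  rw [abs_of_pos h2, lintegral_const_mul' _ _ ENNReal.ofReal_ne_top]

theorem setLIntegral_Ioc_le {ψ : ℝ → ℝ≥0∞} {B : ℝ≥0∞} {R : ℝ} (hR : 0 < R)
    (h : ∀ k : ℤ, ∫⁻ s in Icc (1:ℝ) 2, ψ (2 ^ k * s) ≤ B) :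
    ∫⁻ t in Ioc 0 R, ψ t ≤ ENNReal.ofReal (2 * R) * B := by
  obtain ⟨K, hK1, hK2⟩ := exists_mem_Ico_zpow hR one_lt_two
  have hsub : Ioc 0 R ⊆ ⋃ n : ℕ, Icc ((2:ℝ) ^ (K - n)) (2 ^ (K - n + 1)) := by
    intro t ht
    obtain ⟨k, hk1, hk2⟩ := exists_mem_Ico_zpow ht.1 one_lt_two
    have hkK : k ≤ K := by
      have : (2:ℝ) ^ k < 2 ^ (K + 1) := hk1.trans_lt (ht.2.trans_lt hK2)
      have := (zpow_lt_zpow_iff_right₀ one_lt_two).mp this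
      omega
    refine mem_iUnion.mpr ⟨(K - k).toNat, ?_⟩
    have : K - ((K - k).toNat : ℤ) = k := by omega
    rw [this]
    exact ⟨hk1, hk2.le⟩
  calc ∫⁻ t in Ioc 0 R, ψ t ≤ ∫⁻ t in ⋃ n : ℕ, Icc ((2:ℝ) ^ (K - n)) (2 ^ (K - n + 1)), ψ t :=
        lintegral_mono_set hsub
    _ ≤ ∑' n : ℕ, ∫⁻ t in Icc ((2:ℝ) ^ (K - n)) (2 ^ (K - n + 1)), ψ t := lintegral_iUnion_le _ _
    _ ≤ ∑' n : ℕ, ENNReal.ofReal (2 ^ K) * (2⁻¹ ^ n) * B := by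
        refine ENNReal.tsum_le_tsum fun n => ?_
        rw [setLIntegral_dyadic]
        refine mul_le_mul' (le_of_eq ?_) (h _)
        rw [zpow_sub₀ two_ne_zero, div_eq_mul_inv, ENNReal.ofReal_mul (by positivity),
          zpow_natCast, ← inv_pow, ENNReal.ofReal_pow (by norm_num),
          ENNReal.ofReal_inv_of_pos two_pos, ENNReal.ofReal_ofNat]
    _ = ENNReal.ofReal (2 ^ K) * 2 * B := by
        rw [ENNReal.tsum_mul_right, ENNReal.tsum_mul_left, ENNReal.tsum_geometric,
          ENNReal.one_sub_inv_two, inv_inv]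
    _ ≤ _ := by
        rw [← ENNReal.ofReal_ofNat, ← ENNReal.ofReal_mul (by positivity)]
        refine mul_le_mul_left (ENNReal.ofReal_le_ofReal ?_) _
        linarith

theorem enorm_calM_le (b c c' : ℝ) (U : Set ℝ) (f : ℝ × ℝ → ℝ) (x : ℝ × ℝ) {B : ℝ≥0∞}
    (hB : ∀ u ∈ U, ∀ k : ℤ, ∫⁻ s in Icc (1:ℝ) 2,
      ‖f (x.1 - 2 ^ k * s, x.2 - u * c * 2 ^ (k * b) * s ^ b)‖ₑ ≤ B) :
    ‖calM b c c' U f x‖ₑ ≤ 2 * B := by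
  have h0 : ∀ (u R : ℝ), 0 < R →
      0 ≤ R⁻¹ * ∫ t in (0:ℝ)..R, |f (x - (t, u * curve b c c' t))| := fun u R hR =>
    mul_nonneg (by positivity) (intervalIntegral.integral_nonneg hR.le fun t _ => abs_nonneg _)
  have h1 : 0 ≤ calM b c c' U f x :=
    Real.iSup_nonneg fun u => Real.iSup_nonneg fun R => h0 u R R.2
  rw [Real.enorm_eq_ofReal h1]
  refine ofReal_iSup_le fun u => ofReal_iSup_le fun R => ?_
  obtain ⟨R, hR⟩ := R
  simp only
  rw [ENNReal.ofReal_mul (by positivity), intervalIntegral.integral_of_le hR.le]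
  have h2 : ENNReal.ofReal (∫ t in Ioc 0 R, |f (x - (t, u * curve b c c' t))|) ≤
      ENNReal.ofReal (2 * R) * B := by
    have h3 : ∫⁻ t in Ioc 0 R, ‖f (x - (t, u * curve b c c' t))‖ₑ ≤ ENNReal.ofReal (2 * R) * B := by
      refine setLIntegral_Ioc_le hR fun k => ?_
      refine le_trans (le_of_eq ?_) (hB u u.2 k)
      refine setLIntegral_congr_fun measurableSet_Icc fun s hs => ?_
      have hs0 : 0 < s := lt_of_lt_of_le one_pos hs.1
      have hk : (0:ℝ) < 2 ^ k := by positivity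
      have e : (u:ℝ) * curve b c c' (2 ^ k * s) = u * c * 2 ^ (k * b) * s ^ b := by
        rw [curve, if_pos (by positivity), Real.mul_rpow hk.le hs0.le, ← Real.rpow_intCast,
          ← Real.rpow_mul two_pos.le]
        ring
      simp only [e]
      rfl
    refine le_trans ?_ h3
    rw [← Real.enorm_eq_ofReal (integral_nonneg fun t => abs_nonneg _)]
    refine (enorm_integral_le_lintegral_enorm _).trans (le_of_eq ?_)
    refine lintegral_congr fun t => ?_
    rw [← Real.norm_eq_abs, enorm_norm]
  refine (mul_le_mul_right h2 _).trans (le_of_eq ?_)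
  rw [← mul_assoc, ← ENNReal.ofReal_mul (by positivity),
    show R⁻¹ * (2 * R) = 2 by field_simp, ENNReal.ofReal_ofNat]

theorem covN_spec (U : Set ℝ) (r : ℝ) (m : ℕ) :
    covN (UrSet U r) (2 ^ (-(m:ℝ))) ≤ 2 ^ m ∧
    ∃ F : Finset ℝ, F.card = covN (UrSet U r) (2 ^ (-(m:ℝ))) ∧
      UrSet U r ⊆ ⋃ a ∈ F, Icc a (a + 2 ^ (-(m:ℝ))) := by
  set δ : ℝ := 2 ^ (-(m:ℝ)) with hδ
  have hδm : δ * 2 ^ m = 1 := by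
    rw [hδ, Real.rpow_neg two_pos.le, Real.rpow_natCast, inv_mul_cancel₀ (by positivity)]
  have hδ0 : 0 < δ := by positivity
  set F : Finset ℝ := (Finset.range (2 ^ m)).image fun a : ℕ => 1 + a * δ with hF
  have hFc : UrSet U r ⊆ ⋃ a ∈ F, Icc a (a + δ) := by
    rintro v ⟨⟨hv1, hv2⟩, -⟩
    rcases hv2.lt_or_eq with h | h
    · refine mem_iUnion₂.mpr ⟨1 + ⌊(v - 1) * 2 ^ m⌋₊ * δ, ?_, ?_, ?_⟩
      · refine Finset.mem_image.mpr ⟨⌊(v - 1) * 2 ^ m⌋₊, ?_, rfl⟩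
        rw [Finset.mem_range, Nat.floor_lt (mul_nonneg (by linarith) (by positivity))]
        push_cast
        have : (0:ℝ) < 2 ^ m := by positivity
        nlinarith
      · have := Nat.floor_le (mul_nonneg (sub_nonneg.mpr hv1) (by positivity : (0:ℝ) ≤ 2 ^ m))
        have h3 : (⌊(v - 1) * 2 ^ m⌋₊ : ℝ) * δ ≤ (v - 1) * 2 ^ m * δ := by gcongr
        have h4 : (v - 1) * 2 ^ m * δ = v - 1 := by rw [mul_assoc, mul_comm _ δ, hδm, mul_one]
        linarith
      · have := (Nat.lt_floor_add_one ((v - 1) * 2 ^ m)).le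
        have h3 : (v - 1) * 2 ^ m * δ ≤ (⌊(v - 1) * 2 ^ m⌋₊ + 1 : ℝ) * δ := by gcongr
        have h4 : (v - 1) * 2 ^ m * δ = v - 1 := by rw [mul_assoc, mul_comm _ δ, hδm, mul_one]
        linarith
    · have hm1 : 1 ≤ 2 ^ m := Nat.one_le_two_pow
      have e : ((2 ^ m - 1 : ℕ) : ℝ) * δ = 1 - δ := by
        rw [Nat.cast_sub hm1]; push_cast; linarith
      refine mem_iUnion₂.mpr ⟨1 + (2 ^ m - 1 : ℕ) * δ, ?_, ?_, ?_⟩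
      · exact Finset.mem_image.mpr ⟨2 ^ m - 1, Finset.mem_range.mpr (by omega), rfl⟩
      · rw [e]; linarith
      · rw [e]; linarith
  have hmem : F.card ∈ {n : ℕ | ∃ F : Finset ℝ, F.card = n ∧
      UrSet U r ⊆ ⋃ a ∈ F, Icc a (a + δ)} := ⟨F, rfl, hFc⟩
  refine ⟨(Nat.sInf_le hmem).trans (Finset.card_image_le.trans (Finset.card_range _).le), ?_⟩
  exact Nat.sInf_mem (s := {n : ℕ | ∃ F : Finset ℝ, F.card = n ∧
      UrSet U r ⊆ ⋃ a ∈ F, Icc a (a + δ)}) ⟨_, hmem⟩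

theorem covN_rpow_le_iSup (U : Set ℝ) {r p : ℝ} (hp : 0 < p) (hr : 0 < r) (m : ℕ) :
    (covN (UrSet U r) (2 ^ (-(m:ℝ))) : ℝ) ^ (1 / p) ≤
      ⨆ r : {r : ℝ // 0 < r}, ((covN (UrSet U (r : ℝ)) (2 ^ (-(m:ℝ))) : ℝ)) ^ (1 / p) := by
  refine le_ciSup (f := fun r : {r : ℝ // 0 < r} =>
    ((covN (UrSet U (r : ℝ)) (2 ^ (-(m:ℝ))) : ℝ)) ^ (1 / p)) ?_ ⟨r, hr⟩
  refine ⟨((2 ^ m : ℕ) : ℝ) ^ (1 / p), ?_⟩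
  rintro _ ⟨r, rfl⟩
  exact Real.rpow_le_rpow (by positivity) (by exact_mod_cast (covN_spec U r m).1) (by positivity)

theorem one_le_covN {U : Set ℝ} {u : ℝ} (hu : u ∈ U) (m : ℕ) :
    1 ≤ covN (UrSet U u) (2 ^ (-(m:ℝ))) := by
  obtain ⟨F, hF, hc⟩ := (covN_spec U u m).2
  rw [← hF, Nat.one_le_iff_ne_zero, Finset.card_ne_zero]
  have h1 : (1:ℝ) ∈ UrSet U u := ⟨⟨le_rfl, one_le_two⟩, by rwa [mul_one]⟩
  obtain ⟨a, ha, -⟩ := mem_iUnion₂.mp (hc h1)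
  exact ⟨a, ha⟩

theorem exists_grid (U : Set ℝ) {p : ℝ} (hp : 1 ≤ p) (m : ℕ) :
    ∃ (N : ℕ) (σ : ℤ → ℕ → ℤ), (∀ n s, 2 ^ m ≤ σ n s ∧ σ n s ≤ 2 * 2 ^ m) ∧
      (∀ n : ℤ, ∀ v : ℝ, 1 ≤ v → v < 2 → 2 ^ n * v ∈ U → ∃ s < N, σ n s = ⌊2 ^ m * v⌋) ∧
      (N : ℝ) ^ (1 / p) ≤ 2 * ⨆ r : {r : ℝ // 0 < r},
        ((covN (UrSet U (r : ℝ)) (2 ^ (-(m:ℝ))) : ℝ)) ^ (1 / p) := by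
  have hp0 : 0 < p := by linarith
  set Z : ℤ → Finset ℤ := fun n => (Finset.Icc (2 ^ m : ℤ) (2 * 2 ^ m)).filter fun a =>
    ∃ v : ℝ, 1 ≤ v ∧ v < 2 ∧ 2 ^ n * v ∈ U ∧ ⌊2 ^ m * v⌋ = a with hZ
  have hcard : ∀ n, (Z n).card ≤ 2 * covN (UrSet U (2 ^ n)) (2 ^ (-(m:ℝ))) := by
    intro n
    obtain ⟨F, hF, hc⟩ := (covN_spec U (2 ^ n) m).2
    have hsub : Z n ⊆ F.image (fun a => ⌊2 ^ m * a⌋) ∪ F.image (fun a => ⌊2 ^ m * a⌋ + 1) := by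
      intro z hz
      obtain ⟨-, v, hv1, hv2, hvU, rfl⟩ := Finset.mem_filter.mp hz
      obtain ⟨a, ha, h1, h2⟩ := mem_iUnion₂.mp (hc (show v ∈ UrSet U (2 ^ n) from ⟨⟨hv1, hv2.le⟩, hvU⟩))
      have h3 : ⌊2 ^ m * a⌋ ≤ ⌊2 ^ m * v⌋ := Int.floor_mono (by gcongr)
      have h4 : ⌊2 ^ m * v⌋ ≤ ⌊2 ^ m * a⌋ + 1 := by
        rw [← Int.floor_add_one]
        refine Int.floor_mono ?_
        have h5 : (2:ℝ) ^ m * v ≤ 2 ^ m * (a + 2 ^ (-(m:ℝ))) := by gcongr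
        have h6 : (2:ℝ) ^ m * 2 ^ (-(m:ℝ)) = 1 := by
          rw [Real.rpow_neg two_pos.le, Real.rpow_natCast, mul_inv_cancel₀ (by positivity)]
        linarith
      rw [Finset.mem_union, Finset.mem_image, Finset.mem_image]
      rcases h3.eq_or_lt with h | h
      · exact Or.inl ⟨a, ha, h⟩
      · exact Or.inr ⟨a, ha, by omega⟩
    rw [← hF]
    refine (Finset.card_le_card hsub).trans ((Finset.card_union_le _ _).trans ?_)
    have h1 := Finset.card_image_le (s := F) (f := fun a => ⌊2 ^ m * a⌋)
    have h2 := Finset.card_image_le (s := F) (f := fun a => ⌊2 ^ m * a⌋ + 1)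
    omega
  have hbdd : BddAbove (range fun n => (Z n).card) :=
    ⟨(Finset.Icc (2 ^ m : ℤ) (2 * 2 ^ m)).card, by
      rintro _ ⟨n, rfl⟩; exact Finset.card_filter_le _ _⟩
  obtain ⟨n0, hn0⟩ := Nat.sSup_mem (range_nonempty fun n => (Z n).card) hbdd
  refine ⟨(Z n0).card, fun n s => (Z n).toList.getD s (2 ^ m), fun n s => ?_, ?_, ?_⟩
  · rcases lt_or_ge s (Z n).toList.length with h | h
    · have : (Z n).toList.getD s (2 ^ m) ∈ Z n := by
        rw [← Finset.mem_toList, List.getD_eq_getElem _ _ h]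
        exact List.getElem_mem h
      exact Finset.mem_Icc.mp (Finset.mem_filter.mp this).1
    · simp only
      rw [List.getD_eq_default _ _ h]
      have : (0:ℤ) < 2 ^ m := by positivity
      exact ⟨le_rfl, by linarith⟩
  · intro n v hv1 hv2 hvU
    have hz : ⌊2 ^ m * v⌋ ∈ Z n := by
      refine Finset.mem_filter.mpr ⟨Finset.mem_Icc.mpr ⟨?_, ?_⟩, v, hv1, hv2, hvU, rfl⟩
      · rw [Int.le_floor]
        push_cast
        exact le_mul_of_one_le_right (by positivity) hv1
      · have h : (⌊2 ^ m * v⌋ : ℝ) ≤ 2 * 2 ^ m := by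
          refine (Int.floor_le _).trans ?_
          have : (0:ℝ) < 2 ^ m := by positivity
          nlinarith
        exact_mod_cast h
    obtain ⟨s, hs, hs'⟩ := List.getElem_of_mem (Finset.mem_toList.mpr hz)
    refine ⟨s, ?_, ?_⟩
    · rw [Finset.length_toList] at hs
      have : (Z n).card ≤ (Z n0).card := by
        simp only at hn0
        rw [hn0]
        exact le_csSup hbdd ⟨n, rfl⟩
      omega
    · simp only
      rw [List.getD_eq_getElem _ _ hs, hs']
  · have h1 := covN_rpow_le_iSup U hp0 (show (0:ℝ) < 2 ^ n0 by positivity) m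
    refine le_trans ?_ (mul_le_mul_of_nonneg_left h1 two_pos.le)
    have h2 : ((Z n0).card : ℝ) ≤ 2 * covN (UrSet U (2 ^ n0)) (2 ^ (-(m:ℝ))) := by
      exact_mod_cast hcard n0
    refine (Real.rpow_le_rpow (by positivity) h2 (by positivity)).trans ?_
    rw [Real.mul_rpow two_pos.le (by positivity)]
    refine mul_le_mul_of_nonneg_right ?_ (by positivity)
    calc (2:ℝ) ^ (1 / p) ≤ 2 ^ (1:ℝ) := by
          refine Real.rpow_le_rpow_of_exponent_le one_le_two ?_
          rw [div_le_one hp0]; exact hp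
      _ = 2 := Real.rpow_one _

/-! ### Chaining -/

theorem conv_cm (b : ℝ) (k i : ℤ) (ρ : ℝ) {f : ℝ × ℝ → ℝ} (hf : BM f) (x : ℝ × ℝ) :
    conv (cm b k i ρ) f x =
      ∫ t in Icc (1:ℝ) 2, f (x.1 - 2 ^ k * t, x.2 - 2 ^ i * ρ * t ^ b) := by
  have h : StronglyMeasurable fun y => f (x - y) :=
    hf.1.comp_measurable (measurable_const.sub measurable_id)
  rw [conv, cm, integral_map (measurable_curve_param b k i ρ).aemeasurable h.aestronglyMeasurable]
  rfl

theorem tendsto_conv_cm (b : ℝ) (k i : ℤ) {f : ℝ × ℝ → ℝ} (hf : BM f) (hc : Continuous f)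
    (x : ℝ × ℝ) {r : ℕ → ℝ} {ρ : ℝ} (hr : Tendsto r atTop (𝓝 ρ)) :
    Tendsto (fun m => conv (cm b k i (r m)) f x) atTop (𝓝 (conv (cm b k i ρ) f x)) := by
  obtain ⟨C, hC⟩ := hf.2
  simp only [conv_cm b k i _ hf]
  refine tendsto_integral_of_dominated_convergence (fun _ => C) (fun m => ?_) ?_ (fun m => ?_) ?_
  · exact (hf.1.comp_measurable (by fun_prop)).aestronglyMeasurable
  · exact integrable_const C
  · exact Eventually.of_forall fun t => hC _
  · refine Eventually.of_forall fun t => (hc.tendsto _).comp ?_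
    refine Tendsto.prodMk_nhds tendsto_const_nhds ?_
    exact tendsto_const_nhds.sub ((tendsto_const_nhds.mul hr).mul tendsto_const_nhds)

theorem enorm_le_telescope (a : ℕ → ℝ) (m : ℕ) :
    ‖a m‖ₑ ≤ ‖a 0‖ₑ + ∑' l : ℕ, ‖a (l + 1) - a l‖ₑ := by
  have h : ‖a m‖ₑ ≤ ‖a 0‖ₑ + ∑ l ∈ Finset.range m, ‖a (l + 1) - a l‖ₑ := by
    induction m with
    | zero => simp
    | succ m ih =>
      rw [Finset.sum_range_succ, ← add_assoc]
      calc ‖a (m + 1)‖ₑ = ‖a m + (a (m + 1) - a m)‖ₑ := by congr 1; ring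
        _ ≤ ‖a m‖ₑ + ‖a (m + 1) - a m‖ₑ := enorm_add_le _ _
        _ ≤ _ := by gcongr
  exact h.trans (by gcongr; exact ENNReal.sum_le_tsum _)

theorem tendsto_dyadic_floor (v : ℝ) :
    Tendsto (fun m : ℕ => (⌊2 ^ m * v⌋ : ℝ) / 2 ^ m) atTop (𝓝 v) := by
  have h : Tendsto (fun m : ℕ => v - (1 / 2 : ℝ) ^ m) atTop (𝓝 v) := by
    simpa using tendsto_const_nhds.sub
      (tendsto_pow_atTop_nhds_zero_of_lt_one (by norm_num : (0:ℝ) ≤ 1 / 2) (by norm_num))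
  refine tendsto_of_tendsto_of_tendsto_of_le_of_le h tendsto_const_nhds (fun m => ?_) (fun m => ?_)
  · have h2 : (0:ℝ) < 2 ^ m := by positivity
    simp only
    rw [le_div_iff₀ h2, sub_mul, ← mul_pow]
    have := (Int.lt_floor_add_one ((2:ℝ) ^ m * v)).le
    norm_num
    linarith
  · have h2 : (0:ℝ) < 2 ^ m := by positivity
    simp only
    rw [div_le_iff₀ h2, mul_comm]
    exact Int.floor_le _

theorem floor_half (v : ℝ) (l : ℕ) : ⌊2 ^ l * v⌋ = ⌊2 ^ (l + 1) * v⌋ / 2 := by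
  rw [Int.floor_eq_iff]
  have h1 := Int.floor_le ((2:ℝ) ^ (l + 1) * v)
  have h2 := Int.lt_floor_add_one ((2:ℝ) ^ (l + 1) * v)
  set z := ⌊(2:ℝ) ^ (l + 1) * v⌋
  have h3 : (2 * (z / 2 : ℤ) : ℝ) ≤ z := by exact_mod_cast (by omega : 2 * (z / 2) ≤ z)
  have h4 : (z : ℝ) + 1 ≤ 2 * ((z / 2 : ℤ) + 1) := by
    exact_mod_cast (by omega : z + 1 ≤ 2 * (z / 2 + 1))
  rw [pow_succ] at h1 h2
  constructor <;> nlinarith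

theorem one_le_dyadic_floor {v : ℝ} (hv1 : 1 ≤ v) (hv2 : v < 2) (m : ℕ) :
    1 ≤ (⌊2 ^ m * v⌋ : ℝ) / 2 ^ m ∧ (⌊2 ^ m * v⌋ : ℝ) / 2 ^ m ≤ 2 := by
  have h2 : (0:ℝ) < 2 ^ m := by positivity
  rw [le_div_iff₀ h2, div_le_iff₀ h2]
  refine ⟨?_, (Int.floor_le _).trans (by nlinarith)⟩
  have : ((2:ℤ) ^ m) ≤ ⌊(2:ℝ) ^ m * v⌋ := by
    rw [Int.le_floor]; push_cast; nlinarith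
  have : (2:ℝ) ^ m ≤ ⌊(2:ℝ) ^ m * v⌋ := by exact_mod_cast this
  linarith

theorem conv_cm_chain {b c1 c2 : ℝ} (hb : 1 < b) (hc1 : 0 < c1) : ∃ C, 0 < C ∧
    ∀ w : ℝ, c1 ≤ |w| → |w| ≤ c2 → ∀ v : ℝ, 1 ≤ v → v < 2 → ∀ f : ℝ × ℝ → ℝ, BM f →
    Continuous f → ∀ (k i : ℤ) (x : ℝ × ℝ),
    ‖conv (cm b k i (w * v)) f x‖ₑ ≤ 2 * ENNReal.ofReal C * HLM2 (fun y => ‖f y‖ₑ) x +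
      ‖conv (cm b k i w) f x‖ₑ +
      ∑' l : ℕ, ‖conv (cm b k i (w * ((⌊2 ^ (l + 1) * v⌋ : ℝ) / 2 ^ (l + 1)))) (hi1 k (hi2 i f)) x -
        conv (cm b k i (w * ((⌊2 ^ l * v⌋ : ℝ) / 2 ^ l))) (hi1 k (hi2 i f)) x‖ₑ := by
  obtain ⟨C, hC, h⟩ := low_part (c2 := 2 * c2) hb hc1
  refine ⟨C, hC, fun w hw1 hw2 v hv1 hv2 f hf hcont k i x => ?_⟩
  set r : ℕ → ℝ := fun m => (⌊2 ^ m * v⌋ : ℝ) / 2 ^ m with hr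
  have hr12 : ∀ m, 1 ≤ r m ∧ r m ≤ 2 := one_le_dyadic_floor hv1 hv2
  have hlow : ∀ m, ‖conv (cm b k i (w * r m)) f x -
      conv (cm b k i (w * r m)) (hi1 k (hi2 i f)) x‖ₑ ≤
        ENNReal.ofReal C * HLM2 (fun y => ‖f y‖ₑ) x := fun m => by
    refine h _ ?_ ?_ k i f hf x
    · rw [abs_mul, abs_of_pos (by linarith [(hr12 m).1] : 0 < r m)]
      nlinarith [(hr12 m).1]
    · rw [abs_mul, abs_of_pos (by linarith [(hr12 m).1] : 0 < r m)]
      nlinarith [(hr12 m).2, abs_nonneg w]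
  have hlim := tendsto_conv_cm b k i hf hcont x ((tendsto_dyadic_floor v).const_mul w)
  refine le_of_tendsto hlim.enorm (Eventually.of_forall fun m => ?_)
  have hr0 : r 0 = 1 := by
    have : ⌊v⌋ = 1 := by rw [Int.floor_eq_iff]; norm_num; exact ⟨hv1, by linarith⟩
    simp [hr, this]
  have h0 : ‖conv (cm b k i (w * r 0)) (hi1 k (hi2 i f)) x‖ₑ ≤
      ENNReal.ofReal C * HLM2 (fun y => ‖f y‖ₑ) x + ‖conv (cm b k i w) f x‖ₑ := by
    have e := hlow 0
    rw [enorm_sub_rev] at e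
    refine le_trans ?_ (add_le_add_left e _)
    rw [hr0, mul_one]
    refine le_trans (le_of_eq ?_) (enorm_add_le _ _)
    congr 1; ring
  have hm : ‖conv (cm b k i (w * r m)) f x‖ₑ ≤ ENNReal.ofReal C * HLM2 (fun y => ‖f y‖ₑ) x +
      ‖conv (cm b k i (w * r m)) (hi1 k (hi2 i f)) x‖ₑ := by
    refine le_trans ?_ (add_le_add_left (hlow m) _)
    refine le_trans (le_of_eq ?_) (enorm_add_le _ _)
    congr 1; ring
  have ht := enorm_le_telescope (fun m => conv (cm b k i (w * r m)) (hi1 k (hi2 i f)) x) m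
  refine hm.trans ((add_le_add_right (ht.trans (add_le_add_left h0 _)) _).trans (le_of_eq ?_))
  simp only [hr]
  ring

theorem lpN_biSup_range_le {p : ℝ} (hp : 1 ≤ p) {g : ℕ → ℝ × ℝ → ℝ≥0∞} (N : ℕ)
    (hg : ∀ s, Measurable (g s)) {B : ℝ≥0∞} (h : ∀ s, lpN (g s) p ≤ B) :
    lpN (fun x => ⨆ s ∈ Finset.range N, g s x) p ≤ ENNReal.ofReal ((N:ℝ) ^ (1 / p)) * B := by
  have hp0 : 0 < p := by linarith
  have h1 : ∫⁻ x, (⨆ s ∈ Finset.range N, g s x) ^ p ≤ N * B ^ p := by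
    calc _ ≤ ∫⁻ x, ∑ s ∈ Finset.range N, g s x ^ p := by
          refine lintegral_mono fun x => ?_
          rw [← ENNReal.orderIsoRpow_apply p hp0]
          simp only [OrderIso.map_iSup]
          exact iSup₂_le fun s hs => Finset.single_le_sum
            (f := fun s => g s x ^ p) (fun _ _ => zero_le) hs
      _ = ∑ s ∈ Finset.range N, lpN (g s) p ^ p := by
          rw [lintegral_finsetSum _ fun s _ => (hg s).pow_const p]
          simp only [lpN_rpow _ hp0]
      _ ≤ ∑ s ∈ Finset.range N, B ^ p := Finset.sum_le_sum fun s _ =>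
          ENNReal.rpow_le_rpow (h s) hp0.le
      _ = N * B ^ p := by simp
  rw [lpN]
  refine (ENNReal.rpow_le_rpow h1 (by positivity)).trans (le_of_eq ?_)
  rw [ENNReal.mul_rpow_of_nonneg _ _ (by positivity), ← ENNReal.rpow_mul,
    mul_one_div_cancel hp0.ne', ENNReal.rpow_one, ← ENNReal.ofReal_natCast,
    ENNReal.ofReal_rpow_of_nonneg (by positivity) (by positivity)]

theorem enorm_conv_cm (b : ℝ) (k i : ℤ) (ρ : ℝ) {f : ℝ × ℝ → ℝ} (hf : BM f) (h0 : ∀ x, 0 ≤ f x)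
    (x : ℝ × ℝ) : ‖conv (cm b k i ρ) f x‖ₑ =
      ∫⁻ t in Icc (1:ℝ) 2, ‖f (x.1 - 2 ^ k * t, x.2 - 2 ^ i * ρ * t ^ b)‖ₑ := by
  rw [conv_cm b k i ρ hf, Real.enorm_eq_ofReal (integral_nonneg fun t => h0 _),
    ofReal_integral_eq_lintegral_ofReal]
  · exact lintegral_congr fun t => (Real.enorm_eq_ofReal (h0 _)).symm
  · exact (hf.comp (by fun_prop)).integrable _
  · exact Eventually.of_forall fun t => h0 _

/-- The bounded weights `c 2^{{kb}}`. -/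
def wt (b c : ℝ) (j : ℤ × ℤ) : ℝ := c * 2 ^ Int.fract (j.1 * b)

/-- The dyadic range of the parameter `u` attached to the scales `2^k, 2^i`. -/
def uScale (b : ℝ) (j : ℤ × ℤ) : ℤ := j.2 - ⌊j.1 * b⌋

theorem wt_bounds (b c : ℝ) (j : ℤ × ℤ) : |c| ≤ |wt b c j| ∧ |wt b c j| ≤ 2 * |c| := by
  have h1 : (1:ℝ) ≤ 2 ^ Int.fract (j.1 * b) :=
    Real.one_le_rpow one_le_two (Int.fract_nonneg _)
  have h2 : (2:ℝ) ^ Int.fract (j.1 * b) ≤ 2 := by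
    calc (2:ℝ) ^ Int.fract (j.1 * b) ≤ 2 ^ (1:ℝ) :=
          Real.rpow_le_rpow_of_exponent_le one_le_two (Int.fract_lt_one _).le
      _ = 2 := Real.rpow_one _
  rw [wt, abs_mul, abs_of_pos (by linarith : (0:ℝ) < 2 ^ Int.fract (j.1 * b))]
  constructor <;> nlinarith [abs_nonneg c]

/-- The grid parameters at scale `2^{-m}`. -/
def gridPt (b c : ℝ) (m : ℕ) (z : ℤ → ℤ) (j : ℤ × ℤ) : ℝ :=
  wt b c j * ((z (uScale b j) : ℝ) / 2 ^ m)

theorem gridPt_bounds (b c : ℝ) (m : ℕ) {z : ℤ → ℤ} (hz : ∀ n, 2 ^ m ≤ z n ∧ z n ≤ 2 * 2 ^ m)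
    (j : ℤ × ℤ) : |c| ≤ |gridPt b c m z j| ∧ |gridPt b c m z j| ≤ 4 * |c| := by
  obtain ⟨h1, h2⟩ := wt_bounds b c j
  have h3 : (2:ℝ) ^ m ≤ z (uScale b j) := by exact_mod_cast (hz (uScale b j)).1
  have h4 : (z (uScale b j) : ℝ) ≤ 2 * 2 ^ m := by exact_mod_cast (hz (uScale b j)).2
  have hm : (0:ℝ) < 2 ^ m := by positivity
  have h5 : 1 ≤ (z (uScale b j) : ℝ) / 2 ^ m := by rw [le_div_iff₀ hm]; linarith
  have h6 : (z (uScale b j) : ℝ) / 2 ^ m ≤ 2 := by rw [div_le_iff₀ hm]; linarith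
  rw [gridPt, abs_mul, abs_of_pos (by linarith : (0:ℝ) < (z (uScale b j) : ℝ) / 2 ^ m)]
  constructor <;> nlinarith [abs_nonneg c]

theorem gridPt_sub_le (b c : ℝ) (l : ℕ) (z : ℤ → ℤ) (j : ℤ × ℤ) :
    |gridPt b c (l + 1) z j - gridPt b c l (fun n => z n / 2) j| ≤
      2 * |c| * 2 ^ (-((l + 1 : ℕ) : ℝ)) := by
  have hw := (wt_bounds b c j).2
  rw [gridPt, gridPt, ← mul_sub, abs_mul]
  have e : (2:ℝ) ^ (-((l + 1 : ℕ) : ℝ)) = 1 / 2 ^ (l + 1) := by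
    rw [Real.rpow_neg two_pos.le, Real.rpow_natCast, one_div]
  have h1 : |(z (uScale b j) : ℝ) / 2 ^ (l + 1) - ((z (uScale b j) / 2 : ℤ) : ℝ) / 2 ^ l| ≤
      1 / 2 ^ (l + 1) := by
    set y := z (uScale b j)
    have h2 : (0:ℝ) < 2 ^ (l + 1) := by positivity
    have e2 : (y : ℝ) / 2 ^ (l + 1) - ((y / 2 : ℤ) : ℝ) / 2 ^ l =
        (y - 2 * (y / 2 : ℤ)) / 2 ^ (l + 1) := by
      rw [pow_succ]; field_simp
    rw [e2, abs_div, abs_of_pos h2]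
    gcongr
    have h3 : (0:ℝ) ≤ y - 2 * (y / 2 : ℤ) := by
      have : (0:ℤ) ≤ y - 2 * (y / 2) := by omega
      exact_mod_cast this
    rw [abs_of_nonneg h3]
    have : y - 2 * (y / 2) ≤ 1 := by omega
    exact_mod_cast this
  rw [e]
  exact mul_le_mul hw h1 (abs_nonneg _) (by positivity)

theorem enorm_calM_le_chain {b c : ℝ} (hb : 1 < b) (hc : c ≠ 0) : ∃ C, 0 < C ∧
    ∀ (c' : ℝ) (U : Set ℝ), U ⊆ Ioi 0 → ∀ (N : ℕ → ℕ) (σ : ℕ → ℤ → ℕ → ℤ),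
    (∀ m, ∀ n : ℤ, ∀ v : ℝ, 1 ≤ v → v < 2 → 2 ^ n * v ∈ U → ∃ s < N m, σ m n s = ⌊2 ^ m * v⌋) →
    ∀ f : ℝ × ℝ → ℝ, BM f → Continuous f → (∀ x, 0 ≤ f x) → ∀ x,
    ‖calM b c c' U f x‖ₑ ≤ 2 * ((2 * ENNReal.ofReal C) * HLM2 (fun y => ‖f y‖ₑ) x +
      (⨆ j : ℤ × ℤ, convP (cm b j.1 j.2 (wt b c j)) (fun y => ‖f y‖ₑ) x) +
      ∑' l : ℕ, ⨆ s ∈ Finset.range (N (l + 1)), dif b (gridPt b c (l + 1) fun n => σ (l + 1) n s)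
        (gridPt b c l fun n => σ (l + 1) n s / 2) f x) := by
  obtain ⟨C, hC, h⟩ := conv_cm_chain (c2 := 2 * |c|) hb (abs_pos.mpr hc)
  refine ⟨C, hC, fun c' U hU N σ hσ f hf hcont h0 x => enorm_calM_le b c c' U f x fun u hu k => ?_⟩
  have hu0 : 0 < u := hU hu
  obtain ⟨n, hn1, hn2⟩ := exists_mem_Ico_zpow hu0 one_lt_two
  have h2n : (0:ℝ) < 2 ^ n := by positivity
  set v := u / 2 ^ n with hv
  have hvu : 2 ^ n * v = u := by rw [hv]; field_simp
  have hv1 : 1 ≤ v := by rw [hv, le_div_iff₀ h2n]; linarith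
  have hv2 : v < 2 := by
    rw [hv, div_lt_iff₀ h2n]; rwa [zpow_add_one₀ two_ne_zero, mul_comm] at hn2
  set i : ℤ := n + ⌊k * b⌋ with hi
  have hidx : uScale b (k, i) = n := by simp [uScale, hi]
  have key : u * c * 2 ^ (k * b) = 2 ^ i * (wt b c (k, i) * v) := by
    have e : (2:ℝ) ^ ((k:ℝ) * b) = 2 ^ ⌊k * b⌋ * 2 ^ Int.fract (k * b) := by
      rw [← Real.rpow_intCast, ← Real.rpow_add two_pos, Int.floor_add_fract]
    rw [e, wt, hi, zpow_add₀ two_ne_zero, ← hvu]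
    ring
  simp only [key]
  rw [← enorm_conv_cm b k i _ hf h0]
  obtain ⟨hw1, hw2⟩ := wt_bounds b c (k, i)
  refine (h _ hw1 hw2 v hv1 hv2 f hf hcont k i x).trans ?_
  gcongr with l
  · exact (enorm_conv_le _ _ _).trans
      (le_iSup (fun j : ℤ × ℤ => convP (cm b j.1 j.2 (wt b c j)) (fun y => ‖f y‖ₑ) x) (k, i))
  · obtain ⟨s, hs, hs'⟩ := hσ (l + 1) n v hv1 hv2 (by rwa [hvu])
    refine le_trans ?_ (le_iSup₂_of_le s (Finset.mem_range.mpr hs) le_rfl)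
    refine le_trans (le_of_eq ?_) (le_iSup _ (k, i))
    simp only [gridPt, hidx, hs', ← floor_half]

theorem eLpNorm_eN {g : ℝ × ℝ → ℝ} {p : ℝ} (hp : 0 < p) :
    eLpNorm g (eN p) volume = lpN (fun x => ‖g x‖ₑ) p := by
  rw [eLpNorm_eq_lintegral_rpow_enorm_toReal (by simp [eN, hp]) (by simp [eN]), eN,
    ENNReal.toReal_ofReal hp.le, lpN]

theorem calM_abs (b c c' : ℝ) (U : Set ℝ) (f : ℝ × ℝ → ℝ) :
    calM b c c' U (fun x => |f x|) = calM b c c' U f := by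
  funext x
  simp only [calM, Mu, abs_abs]

theorem half_le_Kp {U : Set ℝ} (hU : U.Nonempty) (hU0 : U ⊆ Ioi 0) {p : ℝ} (hp : 1 < p) :
    1 / 2 ≤ Kp U (2 ^ (-((1 : ℕ) : ℝ))) p := by
  obtain ⟨u, hu⟩ := hU
  have h1 := covN_rpow_le_iSup U (by linarith : 0 < p) (hU0 hu : 0 < u) 1
  have h2 : (1:ℝ) ≤ (covN (UrSet U u) (2 ^ (-((1:ℕ):ℝ))) : ℝ) ^ (1 / p) :=
    Real.one_le_rpow (by exact_mod_cast one_le_covN hu 1) (by positivity)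
  have h3 : (1:ℝ) / 2 ≤ ((2:ℝ) ^ (-((1 : ℕ) : ℝ))) ^ (1 - 1 / p) := by
    rw [← Real.rpow_mul two_pos.le, show (1:ℝ) / 2 = 2 ^ (-1 : ℝ) by
      rw [Real.rpow_neg_one]; norm_num]
    refine Real.rpow_le_rpow_of_exponent_le one_le_two ?_
    have : 0 < 1 / p := by positivity
    push_cast
    linarith
  rw [Kp]
  have := h2.trans h1
  nlinarith

theorem grid_lpN_le {b c : ℝ} (hb : 1 < b) (hc : c ≠ 0) : ∃ C, 0 ≤ C ∧ ∀ p : ℝ, 1 < p → p ≤ 2 →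
    ∀ (U : Set ℝ) (l N : ℕ) (σ : ℤ → ℕ → ℤ),
    (∀ n s, 2 ^ (l + 1) ≤ σ n s ∧ σ n s ≤ 2 * 2 ^ (l + 1)) →
    (N : ℝ) ^ (1 / p) ≤ 2 * ⨆ r : {r : ℝ // 0 < r},
        ((covN (UrSet U (r : ℝ)) (2 ^ (-((l + 1 : ℕ):ℝ))) : ℝ)) ^ (1 / p) →
    ∀ f : ℝ × ℝ → ℝ, BM f → Integrable f →
    lpN (fun x => ⨆ s ∈ Finset.range N, dif b (gridPt b c (l + 1) fun n => σ n s)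
        (gridPt b c l fun n => σ n s / 2) f x) p ≤
      ENNReal.ofReal C * ENNReal.ofReal (theta p (l + 1) * Kp U (2 ^ (-((l:ℝ) + 1))) p) *
        lpN (fun x => ‖f x‖ₑ) p := by
  obtain ⟨C, hC, h⟩ := dif_lp (c2 := 4 * |c|) (c3 := 2 * |c|) hb (abs_pos.mpr hc)
  refine ⟨2 * C, by linarith, fun p hp hp2 U l N σ hσ hN f hf hi => ?_⟩
  have hdif : ∀ s, lpN (dif b (gridPt b c (l + 1) fun n => σ n s)
      (gridPt b c l fun n => σ n s / 2) f) p ≤ _ := fun s =>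
    h p hp hp2 (l + 1) (by omega) _ _ (gridPt_bounds b c (l + 1) fun n => hσ n s)
      (gridPt_bounds b c l fun n => by
        have := hσ n s
        rw [pow_succ] at this
        constructor <;> omega)
      (gridPt_sub_le b c l fun n => σ n s) f hf hi
  refine (lpN_biSup_range_le hp.le N (fun s => measurable_dif b _ _ hf) hdif).trans ?_
  have hθ : 0 ≤ theta p (l + 1) := by
    have : 0 < p - 1 := by linarith
    rw [theta]; split_ifs <;> positivity
  rw [← mul_assoc, ← ENNReal.ofReal_mul (by positivity), ← ENNReal.ofReal_mul (by linarith)]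
  refine mul_le_mul_left (ENNReal.ofReal_le_ofReal ?_) _
  have hC0 : 0 ≤ C := by linarith
  rw [Kp]
  push_cast at hN ⊢
  have h0 : 0 ≤ C * theta p (l + 1) * ((2:ℝ) ^ (-((l:ℝ) + 1))) ^ (1 - 1 / p) := by positivity
  refine (mul_le_mul_of_nonneg_right hN h0).trans (le_of_eq ?_)
  ring

theorem base_le_KpSum {U : Set ℝ} (hU : U.Nonempty) (hU0 : U ⊆ Ioi 0) {p : ℝ} (hp : 1 < p)
    (hp2 : p ≤ 2) : ENNReal.ofReal (((p - 1)⁻¹) ^ 6) ≤ ENNReal.ofReal (2 * 9 ^ 6) * KpSum U p := by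
  have hp1 : 0 < p - 1 := by linarith
  have hθ : theta p 1 = (p - 1) ^ (3 - 10 / p) := by
    rw [theta, if_pos]
    rw [Nat.cast_one]; exact (one_le_inv₀ hp1).mpr (by linarith)
  have h1 : ENNReal.ofReal (theta p 1 * Kp U (2 ^ (-((1 : ℕ) : ℝ))) p) ≤ KpSum U p := by
    refine le_trans (le_of_eq ?_) (ENNReal.le_tsum 0)
    simp
  refine le_trans ?_ (mul_le_mul_right h1 _)
  rw [← ENNReal.ofReal_mul (by norm_num), hθ]
  refine ENNReal.ofReal_le_ofReal ((inv_pow_six_le hp hp2).trans ?_)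
  have h2 := half_le_Kp hU hU0 hp
  have h3 : 0 ≤ (p - 1) ^ (3 - 10 / p) := by positivity
  nlinarith

theorem lpN_calM_le {b c : ℝ} (hb : 1 < b) (hc : c ≠ 0) : ∃ C : ℝ, ∀ (c' p : ℝ), 1 < p → p ≤ 2 →
    ∀ U : Set ℝ, U.Nonempty → U ⊆ Ioi 0 → ∀ f : ℝ × ℝ → ℝ, BM f → Continuous f → Integrable f →
    (∀ x, 0 ≤ f x) →
    lpN (fun x => ‖calM b c c' U f x‖ₑ) p ≤
      ENNReal.ofReal C * KpSum U p * lpN (fun x => ‖f x‖ₑ) p := by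
  obtain ⟨C1, hC1, h1⟩ := enorm_calM_le_chain hb hc
  obtain ⟨C2, hC2, h2⟩ := lac (c2 := 2 * |c|) hb (abs_pos.mpr hc)
  obtain ⟨C3, hC3, h3⟩ := grid_lpN_le hb hc
  refine ⟨2 * ((2 * C1 * 1600 + C2) * (2 * 9 ^ 6) + C3),
    fun c' p hp hp2 U hU hU0 f hf hcont hi h0 => ?_⟩
  have hp0 : 0 < p := by linarith
  have hp1 : 0 < p - 1 := by linarith
  choose N σ hσ hσU hN using exists_grid U hp.le
  have hfm : Measurable fun x => ‖f x‖ₑ := hf.1.measurable.enorm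
  set A := lpN (fun x => ‖f x‖ₑ) p with hA
  have m1 := measurable_HLM2 hfm
  have m2 : Measurable fun x => ⨆ j : ℤ × ℤ,
      convP (cm b j.1 j.2 (wt b c j)) (fun y => ‖f y‖ₑ) x :=
    Measurable.iSup fun j => measurable_convP _ hfm
  have m3 : ∀ l, Measurable fun x => ⨆ s ∈ Finset.range (N (l + 1)),
      dif b (gridPt b c (l + 1) fun n => σ (l + 1) n s)
        (gridPt b c l fun n => σ (l + 1) n s / 2) f x := fun l =>
    Measurable.biSup _ (Finset.range _).countable_toSet fun s _ => measurable_dif b _ _ hf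
  refine (lpN_mono hp0 (h1 c' U hU0 N σ hσU f hf hcont h0)).trans ?_
  rw [lpN_const_mul hp0 (by norm_num)]
  have s1 : lpN (fun x => (2 * ENNReal.ofReal C1) * HLM2 (fun y => ‖f y‖ₑ) x) p ≤
      ENNReal.ofReal (2 * C1 * 1600) * ENNReal.ofReal (((p - 1)⁻¹) ^ 6) * A := by
    rw [lpN_const_mul hp0 (ENNReal.mul_ne_top (by norm_num) ENNReal.ofReal_ne_top)]
    refine (mul_le_mul_right (lpN_HLM2_le hp hp2 hfm) _).trans ?_
    rw [← mul_assoc, show (2:ℝ≥0∞) = ENNReal.ofReal 2 by simp, ← ENNReal.ofReal_mul two_pos.le,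
      ← ENNReal.ofReal_mul (by positivity), ← ENNReal.ofReal_mul (by positivity)]
    refine mul_le_mul_left (ENNReal.ofReal_le_ofReal ?_) _
    have hq : 1 ≤ (p - 1)⁻¹ := (one_le_inv₀ hp1).mpr (by linarith)
    have := pow_le_pow_right₀ hq (by norm_num : 2 ≤ 6)
    rw [← mul_assoc]
    gcongr
  have s2 := h2 p hp hp2 (wt b c) (wt_bounds b c) _ hfm
  rw [ENNReal.ofReal_mul (by linarith)] at s2
  have s3 : lpN (fun x => ∑' l : ℕ, ⨆ s ∈ Finset.range (N (l + 1)),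
      dif b (gridPt b c (l + 1) fun n => σ (l + 1) n s)
        (gridPt b c l fun n => σ (l + 1) n s / 2) f x) p ≤ ENNReal.ofReal C3 * KpSum U p * A := by
    refine (lpN_tsum_le hp.le m3).trans ?_
    refine (ENNReal.tsum_le_tsum fun l =>
      h3 p hp hp2 U l (N (l + 1)) (σ (l + 1)) (hσ (l + 1)) (hN (l + 1)) f hf hi).trans (le_of_eq ?_)
    rw [ENNReal.tsum_mul_right, ENNReal.tsum_mul_left, KpSum]
  have hb6 := base_le_KpSum hU hU0 hp hp2
  calc _ ≤ 2 * (ENNReal.ofReal (2 * C1 * 1600) * ENNReal.ofReal (((p - 1)⁻¹) ^ 6) * A +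
        ENNReal.ofReal C2 * ENNReal.ofReal (((p - 1)⁻¹) ^ 6) * A +
        ENNReal.ofReal C3 * KpSum U p * A) := by
        refine mul_le_mul_right ?_ _
        refine (lpN_add_le hp.le ((m1.const_mul _).add m2) (Measurable.tsum m3)).trans ?_
        refine add_le_add ((lpN_add_le hp.le (m1.const_mul _) m2).trans (add_le_add s1 s2)) s3
    _ ≤ 2 * (ENNReal.ofReal (2 * C1 * 1600) * (ENNReal.ofReal (2 * 9 ^ 6) * KpSum U p) * A +
        ENNReal.ofReal C2 * (ENNReal.ofReal (2 * 9 ^ 6) * KpSum U p) * A +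
        ENNReal.ofReal C3 * KpSum U p * A) := by gcongr
    _ = _ := by
        have e : ENNReal.ofReal (2 * ((2 * C1 * 1600 + C2) * (2 * 9 ^ 6) + C3)) =
            2 * ((ENNReal.ofReal (2 * C1 * 1600) + ENNReal.ofReal C2) *
              ENNReal.ofReal (2 * 9 ^ 6) + ENNReal.ofReal C3) := by
          have hC0 : 0 ≤ 2 * C1 * 1600 := by positivity
          rw [← ENNReal.ofReal_add hC0 (by linarith), ← ENNReal.ofReal_mul (by linarith),
            ← ENNReal.ofReal_add (mul_nonneg (by linarith) (by norm_num)) hC3,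
            ENNReal.ofReal_mul two_pos.le, ENNReal.ofReal_ofNat]
        rw [e]
        ring

theorem opNormM_le {b c : ℝ} (hb : 1 < b) (hc : c ≠ 0) : ∃ C : ℝ, ∀ (c' p : ℝ), 1 < p → p ≤ 2 →
    ∀ U : Set ℝ, U.Nonempty → U ⊆ Ioi 0 →
    opNormM b c c' U p ≤ ENNReal.ofReal C * KpSum U p := by
  obtain ⟨C, h⟩ := lpN_calM_le hb hc
  refine ⟨C, fun c' p hp hp2 U hU hU0 => sInf_le fun f => ?_⟩
  have hp0 : 0 < p := by linarith
  rw [eLpNorm_eN hp0, eLpNorm_eN hp0]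
  have hcont : Continuous fun x => |f x| := f.continuous.abs
  have hbd : BM fun x => |f x| := by
    obtain ⟨D, hD⟩ := f.decay 0 0
    refine ⟨hcont.stronglyMeasurable, D, fun x => ?_⟩
    simpa using hD.2 x
  have := h c' p hp hp2 U hU hU0 (fun x => |f x|) hbd hcont f.integrable.abs fun x => abs_nonneg _
  rw [calM_abs] at this
  simpa [← Real.norm_eq_abs] using this

theorem statement8 (b cp cm : ℝ) (hb : 1 < b) (hcp : cp ≠ 0) (hcm : cm ≠ 0) :
    ∃ C : ℝ, ∀ p : ℝ, 1 < p → p ≤ 2 → ∀ U : Set ℝ, U.Nonempty → U ⊆ Ioi (0:ℝ) →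
      opNormM b cp cm U p ≤ ENNReal.ofReal C * KpSum U p := by
  obtain ⟨C, h⟩ := opNormM_le hb hcp
  exact ⟨C, h cm⟩

end
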